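/- arXiv:math/0703535 — 2 statements merged into one kernel-verified Lean document; each statement's English description precedes it below -/
import Mathlib

section
/- Let g : ℝ → ℝ be a positive function decreasing monotonically to 0, and let h be a positive integer. Then the set of n for which φ(n) and λ(n) are both (1+1/h)-dense in [h, x^{g(x)}] has density 1; that is, the number of n ≤ x with this property is (1+o(1))x as x → ∞. -/
open scoped Classical

open Filter

/-- The Carmichael function: the exponent of the unit group `(ℤ/nℤ)ˣ`. -/
noncomputable def carmichael (n : ℕ) : ℕ := Monoid.exponent (ZMod n)ˣ

/-- `n` is `u`-dense in the set `I`. -/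
def DenseDivIn (n : ℕ) (u : ℝ) (I : Set ℝ) : Prop :=
  ∀ y ∈ I, ∃ d : ℕ, d ∣ n ∧ y < (d : ℝ) ∧ (d : ℝ) ≤ u * y

/-! ### Selberg's upper bound sieve over a downward closed family -/

lemma sum_interval_neg_one_pow_card {ι : Type*} [DecidableEq ι] (𝒟 : Finset (Finset ι))
    (hdown : ∀ s ∈ 𝒟, ∀ t ⊆ s, t ∈ 𝒟) (k j : Finset ι) (hj : j ∈ 𝒟) :
    ∑ s ∈ 𝒟, (if k ⊆ s ∧ s ⊆ j then (-1 : ℝ) ^ s.card else 0) =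
      if k = j then (-1 : ℝ) ^ k.card else 0 := by
  have h1 : ∑ s ∈ 𝒟, (if k ⊆ s ∧ s ⊆ j then (-1 : ℝ) ^ s.card else 0) =
      ∑ s ∈ j.powerset, (if k ⊆ s then (-1 : ℝ) ^ s.card else 0) := by
    rw [← Finset.sum_filter, ← Finset.sum_filter]
    apply Finset.sum_congr _ (fun _ _ => rfl)
    ext s
    simp only [Finset.mem_filter, Finset.mem_powerset]
    exact ⟨fun h => ⟨h.2.2, h.2.1⟩, fun h => ⟨hdown j hj s h.1, h.2, h.1⟩⟩
  rw [h1]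
  by_cases hkj : k ⊆ j
  · have h2 := Finset.prod_add (fun _ : ι => (-1 : ℝ)) (fun l => if l ∈ k then 0 else 1) j
    have h3 : ∀ s ∈ j.powerset, (if k ⊆ s then (-1 : ℝ) ^ s.card else 0) =
        (∏ _i ∈ s, (-1 : ℝ)) * ∏ i ∈ j \ s, (if i ∈ k then (0 : ℝ) else 1) := by
      intro s hs
      rw [Finset.prod_const]
      split_ifs with hks
      · rw [Finset.prod_eq_one, mul_one]
        intro i hi
        rw [if_neg fun hik => (Finset.mem_sdiff.1 hi).2 (hks hik)]
      · obtain ⟨i, hik, his⟩ := Finset.not_subset.1 hks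
        rw [Finset.prod_eq_zero (Finset.mem_sdiff.2 ⟨hkj hik, his⟩) (by simp [hik]), mul_zero]
    rw [Finset.sum_congr rfl h3, ← h2]
    split_ifs with he
    · subst he
      rw [Finset.prod_congr rfl (g := fun _ => (-1 : ℝ)) (fun i hi => by simp [hi]),
        Finset.prod_const]
    · obtain ⟨i, hij, hik⟩ := Finset.exists_of_ssubset (Finset.ssubset_iff_subset_ne.2 ⟨hkj, he⟩)
      exact Finset.prod_eq_zero hij (by simp [hik])
  · rw [if_neg (fun h : k = j => hkj (h ▸ Finset.Subset.refl _))]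
    apply Finset.sum_eq_zero
    intro s hs
    rw [if_neg fun hks => hkj (hks.trans (Finset.mem_powerset.1 hs))]

lemma prod_union_eq_sum_subsets {ι : Type*} [DecidableEq ι] (γ : ι → ℝ) (𝒟 : Finset (Finset ι))
    (hdown : ∀ s ∈ 𝒟, ∀ t ⊆ s, t ∈ 𝒟) (s t : Finset ι) (hs : s ∈ 𝒟) (h0 : ∀ l ∈ s, 0 < γ l) :
    ∏ l ∈ s ∪ t, γ l = (∏ l ∈ s, γ l) * (∏ l ∈ t, γ l) *
      ∑ k ∈ 𝒟, (if k ⊆ s ∧ k ⊆ t then ∏ l ∈ k, ((1 - γ l) / γ l) else 0) := by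
  have h1 : ∑ k ∈ 𝒟, (if k ⊆ s ∧ k ⊆ t then ∏ l ∈ k, ((1 - γ l) / γ l) else 0) =
      ∑ k ∈ (s ∩ t).powerset, ∏ l ∈ k, ((1 - γ l) / γ l) := by
    rw [← Finset.sum_filter]
    apply Finset.sum_congr _ (fun _ _ => rfl)
    ext k
    simp only [Finset.mem_filter, Finset.mem_powerset, Finset.subset_inter_iff]
    exact ⟨fun h => h.2, fun h => ⟨hdown s hs k h.1, h⟩⟩
  have h2 : (∏ l ∈ s ∩ t, γ l) * ∏ l ∈ s ∩ t, ((1 - γ l) / γ l + 1) = 1 := by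
    rw [← Finset.prod_mul_distrib]
    apply Finset.prod_eq_one
    intro l hl
    have := (h0 l (Finset.mem_inter.1 hl).1).ne'
    field_simp
    ring
  rw [h1, ← Finset.prod_add_one, ← Finset.prod_union_inter, mul_assoc, h2, mul_one]

/-- **Selberg's sieve**: the sifted sum is bounded by `X / G` plus a remainder, where `G` is the
sum of `∏ γ / (1 - γ)` over a downward closed family of finite sets of sieving conditions. -/
theorem selberg_sieve {ι α : Type*} [DecidableEq ι] (A : Finset α) (w : α → ℝ)
    (hw : ∀ a ∈ A, 0 ≤ w a)
    (B : ι → α → Prop) (γ : ι → ℝ) (𝒟 : Finset (Finset ι))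
    (hγ : ∀ s ∈ 𝒟, ∀ l ∈ s, 0 < γ l ∧ γ l < 1)
    (hdown : ∀ s ∈ 𝒟, ∀ t ⊆ s, t ∈ 𝒟) (hne : ∅ ∈ 𝒟) (X r : ℝ)
    (hrem : ∀ s ∈ 𝒟, ∀ t ∈ 𝒟,
      |∑ a ∈ A with (∀ l ∈ s ∪ t, B l a), w a - X * ∏ l ∈ s ∪ t, γ l| ≤ r) :
    ∑ a ∈ A with (∀ s ∈ 𝒟, ∀ l ∈ s, ¬ B l a), w a ≤
      X / (∑ s ∈ 𝒟, ∏ l ∈ s, (γ l / (1 - γ l))) + r * (∑ s ∈ 𝒟, ∏ l ∈ s, (γ l)⁻¹) ^ 2 := by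
  set h : Finset ι → ℝ := fun s => ∏ l ∈ s, (γ l / (1 - γ l)) with hh
  set G : ℝ := ∑ s ∈ 𝒟, h s with hG
  set P : Finset ι → ℝ := fun s => ∏ l ∈ s, γ l with hP
  have hpos : ∀ s ∈ 𝒟, 0 < h s := fun s hs => Finset.prod_pos fun l hl =>
    div_pos (hγ s hs l hl).1 (sub_pos.2 (hγ s hs l hl).2)
  have hPpos : ∀ s ∈ 𝒟, 0 < P s := fun s hs => Finset.prod_pos fun l hl => (hγ s hs l hl).1
  have hGpos : 0 < G := Finset.sum_pos hpos ⟨∅, hne⟩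
  set H : Finset ι → ℝ := fun s => ∑ k ∈ 𝒟, if s ⊆ k then h k else 0 with hH
  set lam : Finset ι → ℝ := fun s => (-1) ^ s.card * (P s)⁻¹ * (H s / G) with hlam
  set f : α → ℝ := fun a => ∑ s ∈ 𝒟, lam s * (if ∀ l ∈ s, B l a then 1 else 0) with hf
  have hH0 : ∀ s, 0 ≤ H s := fun s => Finset.sum_nonneg fun k hk => by
    split_ifs
    · exact (hpos k hk).le
    · exact le_rfl
  have hHG : ∀ s, H s ≤ G := fun s => Finset.sum_le_sum fun k hk => by
    split_ifs
    · exact le_rfl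
    · exact (hpos k hk).le
  have hlamabs : ∀ s ∈ 𝒟, |lam s| ≤ ∏ l ∈ s, (γ l)⁻¹ := by
    intro s hs
    rw [hlam, abs_mul, abs_mul, abs_pow, abs_neg, abs_one, one_pow, one_mul,
      abs_of_pos (inv_pos.2 (hPpos s hs)), abs_of_nonneg (div_nonneg (hH0 s) hGpos.le),
      Finset.prod_inv_distrib]
    exact mul_le_of_le_one_right (inv_pos.2 (hPpos s hs)).le ((div_le_one hGpos).2 (hHG s))
  have hfone : ∀ a, (∀ s ∈ 𝒟, ∀ l ∈ s, ¬ B l a) → f a = 1 := by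
    intro a ha
    rw [hf]
    simp only
    rw [Finset.sum_eq_single_of_mem ∅ hne]
    · simp [hlam, hP, hH, ← hG, hGpos.ne']
    · intro s hs hs0
      obtain ⟨l, hl⟩ := Finset.nonempty_iff_ne_empty.2 hs0
      rw [if_neg fun hB => ha s hs l hl (hB l hl), mul_zero]
  have hinner : ∀ k ∈ 𝒟, ∑ s ∈ 𝒟, (if k ⊆ s then lam s * P s else 0) =
      (-1) ^ k.card * h k / G := by
    intro k hk
    have e1 : ∀ s ∈ 𝒟, (if k ⊆ s then lam s * P s else 0) =
        ∑ j ∈ 𝒟, h j / G * (if k ⊆ s ∧ s ⊆ j then (-1 : ℝ) ^ s.card else 0) := by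
      intro s hs
      split_ifs with hks
      · have : lam s * P s = (-1) ^ s.card * (H s / G) := by
          rw [hlam]
          field_simp [(hPpos s hs).ne']
        rw [this, hH, Finset.sum_div, Finset.mul_sum]
        refine Finset.sum_congr rfl fun j _ => ?_
        by_cases hsj : s ⊆ j <;> simp [hks, hsj]
        ring
      · simp [hks]
    rw [Finset.sum_congr rfl e1, Finset.sum_comm]
    simp_rw [← Finset.mul_sum]
    rw [Finset.sum_congr rfl fun j hj => by
      rw [sum_interval_neg_one_pow_card 𝒟 hdown k j hj]]
    simp only [mul_ite, mul_zero, Finset.sum_ite_eq, hk, if_true]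
    ring
  have hquad : ∑ s ∈ 𝒟, ∑ t ∈ 𝒟, lam s * lam t * ∏ l ∈ s ∪ t, γ l = 1 / G := by
    have e1 : ∀ s ∈ 𝒟, ∀ t ∈ 𝒟, lam s * lam t * ∏ l ∈ s ∪ t, γ l =
        ∑ k ∈ 𝒟, (∏ l ∈ k, ((1 - γ l) / γ l)) * ((if k ⊆ s then lam s * P s else 0) *
          (if k ⊆ t then lam t * P t else 0)) := by
      intro s hs t ht
      rw [prod_union_eq_sum_subsets γ 𝒟 hdown s t hs fun l hl => (hγ s hs l hl).1,
        Finset.mul_sum, Finset.mul_sum]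
      refine Finset.sum_congr rfl fun k _ => ?_
      by_cases h1 : k ⊆ s <;> by_cases h2 : k ⊆ t <;> simp [h1, h2, hP]
      ring
    rw [Finset.sum_congr rfl fun s hs => Finset.sum_congr rfl fun t ht => e1 s hs t ht]
    have e2 : ∑ s ∈ 𝒟, ∑ t ∈ 𝒟, ∑ k ∈ 𝒟, (∏ l ∈ k, ((1 - γ l) / γ l)) *
        ((if k ⊆ s then lam s * P s else 0) * (if k ⊆ t then lam t * P t else 0)) =
        ∑ k ∈ 𝒟, (∏ l ∈ k, ((1 - γ l) / γ l)) *
          (∑ s ∈ 𝒟, (if k ⊆ s then lam s * P s else 0)) ^ 2 := by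
      simp_rw [sq, Finset.sum_mul_sum, Finset.mul_sum]
      rw [Finset.sum_comm' (s := 𝒟) (t' := 𝒟) (s' := fun _ => 𝒟) (t := fun _ => 𝒟) (by simp)]
      rw [Finset.sum_congr rfl fun t _ => Finset.sum_comm]
      rw [Finset.sum_comm]
      refine Finset.sum_congr rfl fun k _ => ?_
      rw [Finset.sum_comm]
    rw [e2, Finset.sum_congr rfl fun k hk => by rw [hinner k hk]]
    have e3 : ∀ k ∈ 𝒟, (∏ l ∈ k, ((1 - γ l) / γ l)) * ((-1) ^ k.card * h k / G) ^ 2 =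
        h k / G ^ 2 := by
      intro k hk
      have : (∏ l ∈ k, ((1 - γ l) / γ l)) * h k = 1 := by
        rw [hh, ← Finset.prod_mul_distrib]
        refine Finset.prod_eq_one fun l hl => ?_
        have := (hγ k hk l hl).1.ne'
        have := (sub_pos.2 (hγ k hk l hl).2).ne'
        field_simp
      have hsq : ((-1 : ℝ) ^ k.card) ^ 2 = 1 := by
        rw [← pow_mul, mul_comm, pow_mul]; simp
      rw [div_pow, mul_pow, hsq, one_mul, ← mul_div_assoc, sq (h k), ← mul_assoc, this, one_mul]
    rw [Finset.sum_congr rfl e3, ← Finset.sum_div, ← hG]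
    field_simp
  have hsum : ∑ a ∈ A, w a * f a ^ 2 = ∑ s ∈ 𝒟, ∑ t ∈ 𝒟, lam s * lam t *
      ∑ a ∈ A with (∀ l ∈ s ∪ t, B l a), w a := by
    have e1 : ∀ a ∈ A, w a * f a ^ 2 = ∑ s ∈ 𝒟, ∑ t ∈ 𝒟, lam s * lam t *
        (if ∀ l ∈ s ∪ t, B l a then w a else 0) := by
      intro a _
      rw [hf]
      simp only
      rw [sq, Finset.sum_mul_sum, Finset.mul_sum]
      refine Finset.sum_congr rfl fun s _ => ?_
      rw [Finset.mul_sum]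
      refine Finset.sum_congr rfl fun t _ => ?_
      have : (∀ l ∈ s ∪ t, B l a) ↔ (∀ l ∈ s, B l a) ∧ (∀ l ∈ t, B l a) := by
        simp only [Finset.mem_union, or_imp, forall_and]
      by_cases h1 : ∀ l ∈ s, B l a <;> by_cases h2 : ∀ l ∈ t, B l a
      · rw [if_pos h1, if_pos h2, if_pos (this.2 ⟨h1, h2⟩)]; ring
      · rw [if_neg h2, if_neg fun h => h2 (this.1 h).2]; ring
      · rw [if_neg h1, if_neg fun h => h1 (this.1 h).1]; ring
      · rw [if_neg h1, if_neg fun h => h1 (this.1 h).1]; ring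
    rw [Finset.sum_congr rfl e1, Finset.sum_comm]
    refine Finset.sum_congr rfl fun s _ => ?_
    rw [Finset.sum_comm]
    refine Finset.sum_congr rfl fun t _ => ?_
    rw [← Finset.mul_sum, Finset.sum_filter]
  have hr0 : 0 ≤ r := (abs_nonneg _).trans (hrem ∅ hne ∅ hne)
  calc ∑ a ∈ A with (∀ s ∈ 𝒟, ∀ l ∈ s, ¬ B l a), w a
      = ∑ a ∈ A with (∀ s ∈ 𝒟, ∀ l ∈ s, ¬ B l a), w a * f a ^ 2 := by
        refine Finset.sum_congr rfl fun a ha => ?_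
        rw [hfone a (Finset.mem_filter.1 ha).2]; ring
    _ ≤ ∑ a ∈ A, w a * f a ^ 2 :=
        Finset.sum_le_sum_of_subset_of_nonneg (Finset.filter_subset _ _)
          fun a ha _ => mul_nonneg (hw a ha) (sq_nonneg _)
    _ = ∑ s ∈ 𝒟, ∑ t ∈ 𝒟, lam s * lam t *
          ∑ a ∈ A with (∀ l ∈ s ∪ t, B l a), w a := hsum
    _ ≤ ∑ s ∈ 𝒟, ∑ t ∈ 𝒟, (X * (lam s * lam t * ∏ l ∈ s ∪ t, γ l) +
          r * ((∏ l ∈ s, (γ l)⁻¹) * ∏ l ∈ t, (γ l)⁻¹)) := by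
        refine Finset.sum_le_sum fun s hs => Finset.sum_le_sum fun t ht => ?_
        set S := ∑ a ∈ A with (∀ l ∈ s ∪ t, B l a), w a
        have h1 : lam s * lam t * (S - X * ∏ l ∈ s ∪ t, γ l) ≤
            ((∏ l ∈ s, (γ l)⁻¹) * ∏ l ∈ t, (γ l)⁻¹) * r := by
          refine (le_abs_self _).trans ?_
          rw [abs_mul, abs_mul]
          have := hlamabs s hs
          have := hlamabs t ht
          have := hrem s hs t ht
          gcongr
          · exact mul_nonneg ((abs_nonneg _).trans (hlamabs s hs))
              ((abs_nonneg _).trans (hlamabs t ht))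
          · exact (abs_nonneg _).trans (hlamabs s hs)
        linarith
    _ = X / G + r * (∑ s ∈ 𝒟, ∏ l ∈ s, (γ l)⁻¹) ^ 2 := by
        simp_rw [Finset.sum_add_distrib, ← Finset.mul_sum]
        rw [hquad, sq, Finset.sum_mul_sum]
        simp_rw [← Finset.mul_sum]
        ring

/-! ### Integers without prime factors from a given finite set -/

lemma card_le_of_prod_primes_le (𝒟 : Finset (Finset ℕ)) (D : ℕ)
    (hp : ∀ s ∈ 𝒟, ∀ p ∈ s, p.Prime) (hD : ∀ s ∈ 𝒟, ∏ p ∈ s, p ≤ D) : 𝒟.card ≤ D := by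
  calc 𝒟.card ≤ (Finset.Icc 1 D).card := by
        refine Finset.card_le_card_of_injOn (fun s => ∏ p ∈ s, p) (fun s hs => ?_) ?_
        · exact Finset.mem_coe.2 (Finset.mem_Icc.2
            ⟨Finset.prod_pos fun p hps => (hp s hs p hps).pos, hD s hs⟩)
        · intro s hs t ht hst
          rw [← Nat.primeFactors_prod (hp s hs), ← Nat.primeFactors_prod (hp t ht)]
          exact congrArg Nat.primeFactors hst
    _ = D := by simp

lemma two_mul_sum_powersetCard_two {ι : Type*} (P : Finset ι) (f : ι → ℝ) :
    2 * ∑ s ∈ P.powersetCard 2, ∏ i ∈ s, f i = (∑ i ∈ P, f i) ^ 2 - ∑ i ∈ P, f i ^ 2 := by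
  induction P using Finset.induction_on with
  | empty => rw [Finset.powersetCard_eq_empty.2 (by simp)]; simp
  | insert a s ha ih =>
    rw [Finset.powersetCard_succ_insert ha, Finset.sum_union, Finset.sum_insert ha,
      Finset.sum_insert ha, Finset.sum_image, mul_add, ih]
    · have : ∑ x ∈ s.powersetCard 1, ∏ i ∈ insert a x, f i = f a * ∑ i ∈ s, f i := by
        rw [Finset.powersetCard_one, Finset.sum_map, Finset.mul_sum]
        refine Finset.sum_congr rfl fun i hi => ?_
        have : a ≠ i := fun h => ha (h ▸ hi)
        simp [this]
      rw [this]
      ring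
    · intro x hx y hy hxy
      have hx' : a ∉ x := fun h => ha ((Finset.mem_powersetCard.1 (Finset.mem_coe.1 hx)).1 h)
      have hy' : a ∉ y := fun h => ha ((Finset.mem_powersetCard.1 (Finset.mem_coe.1 hy)).1 h)
      rw [← Finset.erase_insert hx', ← Finset.erase_insert hy', hxy]
    · rw [Finset.disjoint_left]
      intro x hx hx'
      obtain ⟨y, -, rfl⟩ := Finset.mem_image.1 hx'
      exact ha ((Finset.mem_powersetCard.1 hx).1 (Finset.mem_insert_self _ _))

lemma prod_primes_dvd_iff (s : Finset ℕ) (hp : ∀ p ∈ s, p.Prime) (n : ℕ) :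
    ∏ p ∈ s, p ∣ n ↔ ∀ p ∈ s, p ∣ n :=
  ⟨fun h _ hps => (Finset.dvd_prod_of_mem _ hps).trans h,
    fun h => Finset.prod_primes_dvd n (fun p hps => (hp p hps).prime) h⟩

lemma abs_card_dvd_sub_le (N : ℕ) (s : Finset ℕ) (hp : ∀ p ∈ s, p.Prime) :
    |(((Finset.Icc 1 N).filter (fun n => ∀ p ∈ s, p ∣ n)).card : ℝ) -
      N * ∏ p ∈ s, (p : ℝ)⁻¹| ≤ 1 := by
  have hf : (Finset.Icc 1 N).filter (fun n => ∀ p ∈ s, p ∣ n) =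
      (Finset.Ioc 0 N).filter (fun n => ∏ p ∈ s, p ∣ n) := by
    ext n
    simp only [Finset.mem_filter, prod_primes_dvd_iff s hp, Finset.mem_Icc, Finset.mem_Ioc]
    rfl
  have hpos : 0 < ∏ p ∈ s, p := Finset.prod_pos fun p hps => (hp p hps).pos
  have hcard : ((Finset.Icc 1 N).filter (fun n => ∀ p ∈ s, p ∣ n)).card = N / ∏ p ∈ s, p := by
    rw [hf, ← Nat.Ioc_filter_dvd_card_eq_div]
  rw [hcard, Finset.prod_inv_distrib, ← Nat.cast_prod, ← div_eq_mul_inv]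
  have h1 : ((N / ∏ p ∈ s, p : ℕ) : ℝ) ≤ (N : ℝ) / ((∏ p ∈ s, p : ℕ) : ℝ) := Nat.cast_div_le
  have h2 : (N : ℝ) / ((∏ p ∈ s, p : ℕ) : ℝ) < ((N / ∏ p ∈ s, p : ℕ) : ℝ) + 1 := by
    rw [div_lt_iff₀ (by exact_mod_cast hpos)]
    have := Nat.lt_mul_div_succ N hpos
    rw [mul_comm]
    exact_mod_cast this
  rw [abs_le]
  constructor <;> linarith

theorem card_not_dvd_primes_le (P : Finset ℕ) (Q N : ℕ) (hp : ∀ p ∈ P, p.Prime)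
    (hQ : ∀ p ∈ P, p ≤ Q) (hQ1 : 1 ≤ Q) (K : ℝ) (hK : 0 < K)
    (hKS : 2 * K ≤ (∑ p ∈ P, (p : ℝ)⁻¹) ^ 2 - ∑ p ∈ P, (p : ℝ)⁻¹) :
    (((Finset.Icc 1 N).filter (fun n => ∀ p ∈ P, ¬ p ∣ n)).card : ℝ) ≤ N / K + (Q : ℝ) ^ 8 := by
  set 𝒟 : Finset (Finset ℕ) := P.powerset.filter (fun s => s.card ≤ 2) with h𝒟
  have hmem : ∀ s, s ∈ 𝒟 ↔ s ⊆ P ∧ s.card ≤ 2 := fun s => by simp [h𝒟]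
  have hDp : ∀ s ∈ 𝒟, ∀ p ∈ s, p.Prime := fun s hs p hps => hp p (((hmem s).1 hs).1 hps)
  have hDQ : ∀ s ∈ 𝒟, ∏ p ∈ s, p ≤ Q ^ 2 := fun s hs =>
    (Finset.prod_le_pow_card s _ Q fun p hps => hQ p (((hmem s).1 hs).1 hps)).trans
      (Nat.pow_le_pow_right hQ1 ((hmem s).1 hs).2)
  have hγ : ∀ s ∈ 𝒟, ∀ l ∈ s, 0 < (l : ℝ)⁻¹ ∧ (l : ℝ)⁻¹ < 1 := fun s hs l hl => by
    have := (hDp s hs l hl).one_lt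
    exact ⟨inv_pos.2 (by exact_mod_cast this.le), inv_lt_one_of_one_lt₀ (by exact_mod_cast this)⟩
  have key := selberg_sieve (Finset.Icc 1 N) (fun _ => (1 : ℝ)) (fun _ _ => zero_le_one)
    (fun l n => l ∣ n) (fun l => (l : ℝ)⁻¹) 𝒟 hγ
    (fun s hs t hts => (hmem t).2 ⟨hts.trans ((hmem s).1 hs).1,
      (Finset.card_le_card hts).trans ((hmem s).1 hs).2⟩)
    ((hmem ∅).2 ⟨Finset.empty_subset _, by simp⟩) N 1 (by
      intro s hs t ht
      have hst : ∀ p ∈ s ∪ t, p.Prime := fun p hps => by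
        rcases Finset.mem_union.1 hps with h | h
        exacts [hDp s hs p h, hDp t ht p h]
      rw [Finset.sum_const, nsmul_eq_mul, mul_one]
      convert abs_card_dvd_sub_le N (s ∪ t) hst
      rfl)
  have hset : ((Finset.Icc 1 N).filter (fun n => ∀ p ∈ P, ¬ p ∣ n)) ⊆
      (Finset.Icc 1 N).filter (fun n => ∀ s ∈ 𝒟, ∀ l ∈ s, ¬ l ∣ n) := by
    intro n hn
    rw [Finset.mem_filter] at hn ⊢
    exact ⟨hn.1, fun s hs l hl => hn.2 l (((hmem s).1 hs).1 hl)⟩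
  have hG : K ≤ ∑ s ∈ 𝒟, ∏ l ∈ s, ((l : ℝ)⁻¹ / (1 - (l : ℝ)⁻¹)) := by
    have h2 := two_mul_sum_powersetCard_two P (fun l => (l : ℝ)⁻¹)
    have h3 : ∑ i ∈ P, ((i : ℝ)⁻¹) ^ 2 ≤ ∑ i ∈ P, (i : ℝ)⁻¹ := by
      refine Finset.sum_le_sum fun i hi => ?_
      have := (hp i hi).one_lt
      have h4 : (i : ℝ)⁻¹ ≤ 1 := inv_le_one_of_one_le₀ (by exact_mod_cast this.le)
      have h5 : 0 ≤ (i : ℝ)⁻¹ := by positivity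
      nlinarith
    have h4 : ∑ s ∈ P.powersetCard 2, ∏ i ∈ s, (i : ℝ)⁻¹ ≤
        ∑ s ∈ 𝒟, ∏ l ∈ s, ((l : ℝ)⁻¹ / (1 - (l : ℝ)⁻¹)) := by
      calc _ ≤ ∑ s ∈ 𝒟, ∏ i ∈ s, (i : ℝ)⁻¹ := by
            refine Finset.sum_le_sum_of_subset_of_nonneg ?_ fun s _ _ =>
              Finset.prod_nonneg fun i _ => by positivity
            intro s hs
            rw [Finset.mem_powersetCard] at hs
            exact (hmem s).2 ⟨hs.1, hs.2.le⟩
        _ ≤ _ := by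
            refine Finset.sum_le_sum fun s hs => Finset.prod_le_prod
              (fun i _ => by positivity) fun i hi => ?_
            obtain ⟨h0, h1⟩ := hγ s hs i hi
            exact le_div_self h0.le (sub_pos.2 h1) (by linarith)
    linarith
  have herr : ∑ s ∈ 𝒟, ∏ l ∈ s, ((l : ℝ)⁻¹)⁻¹ ≤ (Q : ℝ) ^ 4 := by
    calc ∑ s ∈ 𝒟, ∏ l ∈ s, ((l : ℝ)⁻¹)⁻¹ ≤ ∑ s ∈ 𝒟, (Q : ℝ) ^ 2 := by
          refine Finset.sum_le_sum fun s hs => ?_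
          simp_rw [inv_inv]
          rw [← Nat.cast_prod]
          exact_mod_cast hDQ s hs
      _ = 𝒟.card * (Q : ℝ) ^ 2 := by simp
      _ ≤ (Q : ℝ) ^ 2 * (Q : ℝ) ^ 2 := by
          gcongr
          exact_mod_cast card_le_of_prod_primes_le 𝒟 (Q ^ 2) hDp hDQ
      _ = (Q : ℝ) ^ 4 := by ring
  have herr0 : 0 ≤ ∑ s ∈ 𝒟, ∏ l ∈ s, ((l : ℝ)⁻¹)⁻¹ :=
    Finset.sum_nonneg fun s _ => Finset.prod_nonneg fun i _ => by positivity
  calc (((Finset.Icc 1 N).filter (fun n => ∀ p ∈ P, ¬ p ∣ n)).card : ℝ)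
      ≤ (((Finset.Icc 1 N).filter (fun n => ∀ s ∈ 𝒟, ∀ l ∈ s, ¬ l ∣ n)).card : ℝ) := by
        exact_mod_cast Finset.card_le_card hset
    _ ≤ N / (∑ s ∈ 𝒟, ∏ l ∈ s, ((l : ℝ)⁻¹ / (1 - (l : ℝ)⁻¹))) +
          1 * (∑ s ∈ 𝒟, ∏ l ∈ s, ((l : ℝ)⁻¹)⁻¹) ^ 2 := by
        rw [Finset.sum_const, nsmul_eq_mul, mul_one] at key
        convert key
        rfl
    _ ≤ N / K + (Q : ℝ) ^ 8 := by
        rw [one_mul]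
        have : (∑ s ∈ 𝒟, ∏ l ∈ s, ((l : ℝ)⁻¹)⁻¹) ^ 2 ≤ ((Q : ℝ) ^ 4) ^ 2 := by gcongr
        have : ((Q : ℝ) ^ 4) ^ 2 = (Q : ℝ) ^ 8 := by ring
        gcongr
        linarith

/-! ### Reciprocal sums of primes over long intervals -/

/-- The primes `p` with `a < p ≤ b`. -/
def primesIoc (a b : ℕ) : Finset ℕ := (Finset.Ioc a b).filter Nat.Prime

lemma mem_primesIoc {a b p : ℕ} : p ∈ primesIoc a b ↔ (a < p ∧ p ≤ b) ∧ p.Prime := by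
  rw [primesIoc, Finset.mem_filter, Finset.mem_Ioc]

lemma four_pow_ge_aux (j : ℕ) (hj : 7 ≤ j) : 2 * (j + 2) + 8 * 2 ^ j * (j + 1) ≤ 4 ^ j := by
  induction j, hj using Nat.le_induction with
  | base => norm_num
  | succ k hk ih =>
    have h1 : 2 ^ (k + 1) = 2 * 2 ^ k := by ring
    have h2 : 4 ^ (k + 1) = 4 * 4 ^ k := by ring
    rw [h1, h2]
    nlinarith [Nat.zero_le (2 ^ k), Nat.zero_le (2 ^ k * k)]

lemma theta_sub_theta_ge (j : ℕ) (hj : 7 ≤ j) :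
    (4 : ℝ) ^ j * Real.log 2 ≤
      ∑ p ∈ primesIoc (4 ^ j) (4 ^ (j + 1)), Real.log p := by
  have hsplit : Chebyshev.theta ((4 ^ (j + 1) : ℕ) : ℝ) = Chebyshev.theta ((4 ^ j : ℕ) : ℝ) +
      ∑ p ∈ primesIoc (4 ^ j) (4 ^ (j + 1)), Real.log p := by
    have h : 4 ^ j ≤ 4 ^ (j + 1) := Nat.pow_le_pow_right (by norm_num) (by omega)
    rw [primesIoc, Chebyshev.theta, Chebyshev.theta, Nat.floor_natCast, Nat.floor_natCast,
      Finset.sum_filter, Finset.sum_filter, Finset.sum_filter,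
      Finset.sum_Ioc_consecutive _ (Nat.zero_le _) h]
  have hup : Chebyshev.theta ((4 ^ j : ℕ) : ℝ) ≤ Real.log 4 * 4 ^ j := by
    simpa using Chebyshev.theta_le_log4_mul_x (x := ((4 ^ j : ℕ) : ℝ)) (by positivity)
  have hlow := Chebyshev.theta_ge (4 ^ (j + 1))
  have hlog4 : Real.log 4 = 2 * Real.log 2 := by
    rw [show (4 : ℝ) = 2 ^ 2 by norm_num, Real.log_pow]; norm_num
  have hl2 : 0 < Real.log 2 := Real.log_pos (by norm_num)
  have hsqrt : √((4 ^ (j + 1) : ℕ) : ℝ) = 2 ^ (j + 1) := by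
    rw [Real.sqrt_eq_iff_mul_self_eq (by positivity) (by positivity)]
    push_cast
    rw [← mul_pow]
    norm_num
  have hlog : Real.log ((4 ^ (j + 1) : ℕ) : ℝ) = (j + 1) * (2 * Real.log 2) := by
    push_cast
    rw [Real.log_pow, hlog4]
    push_cast
    ring
  have hlog1 : Real.log (((4 ^ (j + 1) : ℕ) : ℝ) + 1) ≤ (j + 2) * (2 * Real.log 2) := by
    have : ((j : ℝ) + 2) * (2 * Real.log 2) = Real.log ((4 : ℝ) ^ (j + 2)) := by
      rw [Real.log_pow, hlog4]
      push_cast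
      ring
    rw [this]
    apply Real.log_le_log (by positivity)
    push_cast
    have : (1 : ℝ) ≤ 4 ^ (j + 1) := one_le_pow₀ (by norm_num)
    rw [pow_succ (4 : ℝ) (j + 1)]
    linarith
  have hnum := four_pow_ge_aux j hj
  have hnum' : 2 * ((j : ℝ) + 2) + 8 * 2 ^ j * (j + 1) ≤ 4 ^ j := by exact_mod_cast hnum
  rw [hsqrt, hlog] at hlow
  have hc : (((4 ^ (j + 1) : ℕ) : ℝ)) = 4 * 4 ^ j := by push_cast; ring
  have h2 : (2 : ℝ) ^ (j + 1) = 2 * 2 ^ j := by ring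
  rw [hsplit] at hlow
  rw [h2] at hlow
  rw [hc] at hlow hlog1
  have := mul_le_mul_of_nonneg_right hnum' hl2.le
  nlinarith

lemma sum_inv_primes_four_pow_ge (j : ℕ) (hj : 7 ≤ j) :
    1 / (8 * ((j : ℝ) + 1)) ≤
      ∑ p ∈ primesIoc (4 ^ j) (4 ^ (j + 1)), (p : ℝ)⁻¹ := by
  have h := theta_sub_theta_ge j hj
  have hl2 : 0 < Real.log 2 := Real.log_pos (by norm_num)
  have hlog4 : Real.log 4 = 2 * Real.log 2 := by
    rw [show (4 : ℝ) = 2 ^ 2 by norm_num, Real.log_pow]; norm_num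
  have h4 : (0 : ℝ) < 4 ^ j := by positivity
  have hC : 0 < 4 * (4 : ℝ) ^ j * ((j + 1) * (2 * Real.log 2)) := by positivity
  have hterm : ∀ p ∈ primesIoc (4 ^ j) (4 ^ (j + 1)),
      Real.log p / (4 * (4 : ℝ) ^ j * ((j + 1) * (2 * Real.log 2))) ≤ (p : ℝ)⁻¹ := by
    intro p hp
    rw [mem_primesIoc] at hp
    have hp0 : (0 : ℝ) < p := by exact_mod_cast hp.2.pos
    have hple : (p : ℝ) ≤ 4 * 4 ^ j := by
      have : p ≤ 4 * 4 ^ j := by rw [← pow_succ']; exact hp.1.2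
      exact_mod_cast this
    have hlog : Real.log p ≤ (j + 1) * (2 * Real.log 2) := by
      have : ((j : ℝ) + 1) * (2 * Real.log 2) = Real.log (4 * (4 : ℝ) ^ j) := by
        rw [← pow_succ', Real.log_pow, hlog4]
        push_cast
        ring
      rw [this]
      exact Real.log_le_log hp0 hple
    rw [div_le_iff₀ hC, inv_mul_eq_div, le_div_iff₀ hp0]
    have hlog0 : 0 ≤ Real.log p := Real.log_natCast_nonneg p
    calc Real.log p * p ≤ ((j + 1) * (2 * Real.log 2)) * (4 * 4 ^ j) := by gcongr
      _ = _ := by ring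
  refine le_trans ?_ (Finset.sum_le_sum hterm)
  rw [← Finset.sum_div, div_le_div_iff₀ (by positivity) hC]
  have := mul_le_mul_of_nonneg_right h (show (0 : ℝ) ≤ 8 * (j + 1) by positivity)
  linarith

lemma sum_inv_primes_double_ge (u : ℕ) (hu : 7 ≤ u) :
    1 / 16 ≤ ∑ p ∈ primesIoc (4 ^ u) (4 ^ (2 * u)), (p : ℝ)⁻¹ := by
  have key : ∀ k ≤ u, (k : ℝ) * (1 / (16 * u)) ≤
      ∑ p ∈ primesIoc (4 ^ u) (4 ^ (u + k)), (p : ℝ)⁻¹ := by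
    intro k
    induction k with
    | zero => simp [primesIoc]
    | succ k ih =>
      intro hk
      have h1 := ih (by omega)
      have h2 := sum_inv_primes_four_pow_ge (u + k) (by omega)
      rw [primesIoc, Finset.sum_filter] at h1 h2 ⊢
      rw [← add_assoc, ← Finset.sum_Ioc_consecutive _
        (Nat.pow_le_pow_right (by norm_num) (Nat.le_add_right u k))
        (Nat.pow_le_pow_right (by norm_num) (Nat.le_succ (u + k)))]
      have h3 : 1 / (16 * (u : ℝ)) ≤ 1 / (8 * (((u + k : ℕ) : ℝ) + 1)) := by
        apply one_div_le_one_div_of_le (by positivity)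
        have : (u : ℝ) + k + 1 ≤ 2 * u := by
          have : u + k + 1 ≤ 2 * u := by omega
          exact_mod_cast this
        push_cast
        linarith
      push_cast at *
      linarith
  have := key u le_rfl
  rw [two_mul]
  refine le_trans (le_of_eq ?_) this
  have : (u : ℝ) ≠ 0 := by positivity
  field_simp

theorem one_le_sum_inv_primes (u : ℕ) (hu : 7 ≤ u) :
    1 ≤ ∑ p ∈ primesIoc (4 ^ u) (4 ^ (2 ^ 16 * u)), (p : ℝ)⁻¹ := by
  have key : ∀ r : ℕ, (r : ℝ) / 16 ≤
      ∑ p ∈ primesIoc (4 ^ u) (4 ^ (2 ^ r * u)), (p : ℝ)⁻¹ := by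
    intro r
    induction r with
    | zero => simp [primesIoc]
    | succ r ih =>
      have hle : u ≤ 2 ^ r * u := Nat.le_mul_of_pos_left u (by positivity)
      have h2 := sum_inv_primes_double_ge (2 ^ r * u) (by omega)
      rw [primesIoc, Finset.sum_filter] at ih h2 ⊢
      have he : 2 ^ (r + 1) * u = 2 * (2 ^ r * u) := by ring
      rw [he, ← Finset.sum_Ioc_consecutive _
        (Nat.pow_le_pow_right (by norm_num) hle)
        (Nat.pow_le_pow_right (n := 4) (by norm_num) (show 2 ^ r * u ≤ 2 * (2 ^ r * u) by omega))]
      push_cast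
      linarith
  have := key 16
  norm_num at this ⊢
  exact this

/-! ### Shifted primes hitting a set of primes -/

theorem abs_sum_div_le (a : ℕ → ℝ) (Y Z : ℕ) (hY : 0 < Y) (hYZ : Y ≤ Z) (C : ℝ)
    (h : ∀ k, Y ≤ k → |∑ n ∈ Finset.Ioc Y k, a n| ≤ C) :
    |∑ n ∈ Finset.Ioc Y Z, a n / n| ≤ C / Y := by
  have hC : 0 ≤ C := (abs_nonneg _).trans (h Y le_rfl)
  have key : ∀ k, Y ≤ k → |∑ n ∈ Finset.Ioc Y k, a n / n - (∑ n ∈ Finset.Ioc Y k, a n) / k| ≤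
      C * (1 / Y - 1 / k) := by
    intro k hk
    induction k, hk using Nat.le_induction with
    | base => simp
    | succ k hk ih =>
      have hk0 : (0 : ℝ) < k := by exact_mod_cast hY.trans_le hk
      rw [Finset.sum_Ioc_succ_top hk, Finset.sum_Ioc_succ_top hk]
      have hS := h k hk
      set T := ∑ n ∈ Finset.Ioc Y k, a n / n
      set S := ∑ n ∈ Finset.Ioc Y k, a n
      have e : T + a (k + 1) / ((k + 1 : ℕ) : ℝ) - (S + a (k + 1)) / ((k + 1 : ℕ) : ℝ) =
          (T - S / k) + S * (1 / k - 1 / ((k + 1 : ℕ) : ℝ)) := by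
        push_cast
        field_simp
        ring
      have hd : (0 : ℝ) ≤ 1 / k - 1 / ((k + 1 : ℕ) : ℝ) := by
        rw [sub_nonneg]
        apply one_div_le_one_div_of_le hk0
        push_cast
        linarith
      rw [e]
      calc _ ≤ |T - S / k| + |S * (1 / k - 1 / ((k + 1 : ℕ) : ℝ))| := abs_add_le _ _
        _ ≤ C * (1 / Y - 1 / k) + C * (1 / k - 1 / ((k + 1 : ℕ) : ℝ)) := by
          rw [abs_mul, abs_of_nonneg hd]
          gcongr
        _ = _ := by ring
  have hZ0 : (0 : ℝ) < Z := by exact_mod_cast hY.trans_le hYZ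
  have h1 := key Z hYZ
  have h2 := h Z hYZ
  set T := ∑ n ∈ Finset.Ioc Y Z, a n / n
  set S := ∑ n ∈ Finset.Ioc Y Z, a n
  calc |T| = |(T - S / Z) + S / Z| := by ring_nf
    _ ≤ |T - S / Z| + |S / Z| := abs_add_le _ _
    _ ≤ C * (1 / Y - 1 / Z) + C / Z := by
      rw [abs_div, abs_of_pos hZ0]
      gcongr
    _ = _ := by ring

theorem abs_card_modEq_sub_le (Y k r v : ℕ) (hr : 0 < r) (hk : Y ≤ k) :
    |(((Finset.Ioc Y k).filter (fun n => n ≡ v [MOD r])).card : ℝ) - ((k : ℝ) - Y) / r| ≤ 1 := by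
  have h := Nat.Ioc_filter_modEq_card Y k hr v
  have hmono : ⌊((Y : ℚ) - v) / (r : ℚ)⌋ ≤ ⌊((k : ℚ) - v) / (r : ℚ)⌋ := by
    apply Int.floor_mono
    gcongr
  rw [max_eq_left (sub_nonneg.2 hmono)] at h
  have hq : |((((Finset.Ioc Y k).filter (fun n => n ≡ v [MOD r])).card : ℤ) : ℚ) -
      ((k : ℚ) - Y) / r| ≤ 1 := by
    have h' : ((((Finset.Ioc Y k).filter (fun n => n ≡ v [MOD r])).card : ℤ)) =
        ⌊((k : ℚ) - v) / (r : ℚ)⌋ - ⌊((Y : ℚ) - v) / (r : ℚ)⌋ := by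
      convert h using 4
    rw [h']
    push_cast
    have e : ((k : ℚ) - Y) / r = ((k : ℚ) - v) / (r : ℚ) - ((Y : ℚ) - v) / (r : ℚ) := by ring
    rw [e]
    have h1 := Int.floor_le (((k : ℚ) - v) / (r : ℚ))
    have h2 := Int.lt_floor_add_one (((k : ℚ) - v) / (r : ℚ))
    have h3 := Int.floor_le (((Y : ℚ) - v) / (r : ℚ))
    have h4 := Int.lt_floor_add_one (((Y : ℚ) - v) / (r : ℚ))
    rw [abs_le]
    constructor <;> linarith
  have := (Rat.cast_le (K := ℝ)).2 hq
  push_cast at this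
  exact_mod_cast this

theorem abs_card_dvd_dvd_sub_le (Y k a b : ℕ) (ha : 0 < a) (hb : 0 < b) (hab : a.Coprime b)
    (hk : Y ≤ k) :
    |(((Finset.Ioc Y k).filter (fun n => a ∣ n ∧ b ∣ n - 1)).card : ℝ) -
      ((k : ℝ) - Y) * ((a : ℝ)⁻¹ * (b : ℝ)⁻¹)| ≤ 1 := by
  obtain ⟨v, hv0, hv1⟩ := Nat.chineseRemainder hab 0 1
  have h := abs_card_modEq_sub_le Y k (a * b) v (Nat.mul_pos ha hb) hk
  have e : (Finset.Ioc Y k).filter (fun n => a ∣ n ∧ b ∣ n - 1) =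
      (Finset.Ioc Y k).filter (fun n => n ≡ v [MOD a * b]) := by
    apply Finset.filter_congr
    intro n hn
    have hn1 : 1 ≤ n := by
      have := (Finset.mem_Ioc.1 hn).1
      omega
    rw [← Nat.modEq_and_modEq_iff_modEq_mul hab, ← Nat.modEq_zero_iff_dvd,
      ← Nat.modEq_iff_dvd' hn1]
    exact and_congr ⟨fun h => h.trans hv0.symm, fun h => h.trans hv0⟩
      ⟨fun h => h.symm.trans hv1.symm, fun h => (h.trans hv1).symm⟩
  rw [e]
  convert h using 3
  push_cast
  rw [div_eq_mul_inv, mul_inv]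

theorem abs_card_hit_sub_le (W s : Finset ℕ) (hs : ∀ l ∈ s, l.Prime) (Y k : ℕ) (hk : Y ≤ k) :
    |(∑ n ∈ Finset.Ioc Y k, (if ∀ l ∈ s, l ∣ n ∨ (l ∈ W ∧ l ∣ n - 1) then (1 : ℝ) else 0)) -
      ((k : ℝ) - Y) * ∏ l ∈ s, ((l : ℝ)⁻¹ + if l ∈ W then (l : ℝ)⁻¹ else 0)| ≤
      ∏ l ∈ s, (l : ℝ) := by
  have h1 : ∀ n ∈ Finset.Ioc Y k,
      (if ∀ l ∈ s, l ∣ n ∨ (l ∈ W ∧ l ∣ n - 1) then (1 : ℝ) else 0) =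
      ∑ u ∈ s.powerset, (if (∀ l ∈ u, l ∣ n) ∧ (∀ l ∈ s \ u, l ∈ W ∧ l ∣ n - 1)
        then (1 : ℝ) else 0) := by
    intro n hn
    have hn1 : 1 ≤ n := by
      have := (Finset.mem_Ioc.1 hn).1
      omega
    have e : (if ∀ l ∈ s, l ∣ n ∨ (l ∈ W ∧ l ∣ n - 1) then (1 : ℝ) else 0) =
        ∏ l ∈ s, ((if l ∣ n then (1 : ℝ) else 0) + if l ∈ W ∧ l ∣ n - 1 then 1 else 0) := by
      have e1 : ∀ l ∈ s, ((if l ∣ n then (1 : ℝ) else 0) + if l ∈ W ∧ l ∣ n - 1 then 1 else 0) =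
          if l ∣ n ∨ (l ∈ W ∧ l ∣ n - 1) then 1 else 0 := by
        intro l hl
        by_cases h1 : l ∣ n
        · have h2 : ¬ (l ∈ W ∧ l ∣ n - 1) := by
            rintro ⟨-, h2⟩
            have h3 := (Nat.dvd_sub_iff_right hn1 h1).1 h2
            exact (hs l hl).one_lt.ne' (Nat.dvd_one.1 h3)
          simp [h1, h2]
        · simp [h1]
      rw [Finset.prod_congr rfl e1]
      by_cases H : ∀ l ∈ s, l ∣ n ∨ (l ∈ W ∧ l ∣ n - 1)
      · rw [if_pos H, Finset.prod_eq_one]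
        intro l hl
        rw [if_pos (H l hl)]
      · rw [if_neg H]
        push Not at H
        obtain ⟨l, hl, h⟩ := H
        rw [Finset.prod_eq_zero hl]
        rw [if_neg]
        tauto
    rw [e, Finset.prod_add]
    apply Finset.sum_congr rfl
    intro u hu
    rw [Finset.prod_ite_zero, Finset.prod_ite_zero]
    simp only [Finset.prod_const_one]
    by_cases h1 : ∀ l ∈ u, l ∣ n
    · by_cases h2 : ∀ l ∈ s \ u, l ∈ W ∧ l ∣ n - 1
      · rw [if_pos h1, if_pos h2, if_pos ⟨h1, h2⟩, mul_one]
      · rw [if_neg h2, mul_zero, if_neg fun h => h2 h.2]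
    · rw [if_neg h1, zero_mul, if_neg fun h => h1 h.1]
  rw [Finset.sum_congr rfl h1, Finset.sum_comm, Finset.prod_add, Finset.mul_sum,
    ← Finset.sum_sub_distrib]
  refine (Finset.abs_sum_le_sum_abs _ _).trans ?_
  have h2 : ∀ u ∈ s.powerset,
      |∑ n ∈ Finset.Ioc Y k, (if (∀ l ∈ u, l ∣ n) ∧ (∀ l ∈ s \ u, l ∈ W ∧ l ∣ n - 1)
        then (1 : ℝ) else 0) - ((k : ℝ) - Y) * ((∏ l ∈ u, (l : ℝ)⁻¹) *
        ∏ l ∈ s \ u, if l ∈ W then (l : ℝ)⁻¹ else 0)| ≤ 1 := by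
    intro u hu
    have hus := Finset.mem_powerset.1 hu
    by_cases hW : ∀ l ∈ s \ u, l ∈ W
    · have e1 : ∏ l ∈ s \ u, (if l ∈ W then (l : ℝ)⁻¹ else 0) = ∏ l ∈ s \ u, (l : ℝ)⁻¹ :=
        Finset.prod_congr rfl fun l hl => if_pos (hW l hl)
      have hpu : ∀ l ∈ u, l.Prime := fun l hl => hs l (hus hl)
      have hpu' : ∀ l ∈ s \ u, l.Prime := fun l hl => hs l (Finset.sdiff_subset hl)
      have hco : (∏ l ∈ u, l).Coprime (∏ l ∈ s \ u, l) := by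
        apply Nat.Coprime.prod_left
        intro i hi
        apply Nat.Coprime.prod_right
        intro j hj
        rw [Nat.coprime_primes (hpu i hi) (hpu' j hj)]
        rintro rfl
        exact (Finset.mem_sdiff.1 hj).2 hi
      have key := abs_card_dvd_dvd_sub_le Y k (∏ l ∈ u, l) (∏ l ∈ s \ u, l)
        (Finset.prod_pos fun l hl => (hpu l hl).pos) (Finset.prod_pos fun l hl => (hpu' l hl).pos)
        hco hk
      rw [e1, Finset.sum_boole]
      push_cast at key
      rw [Finset.prod_inv_distrib, Finset.prod_inv_distrib]
      convert key using 5
      · rfl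
      ext n
      simp only [Finset.mem_filter]
      rw [prod_primes_dvd_iff u hpu, prod_primes_dvd_iff _ hpu']
      constructor
      · rintro ⟨a, b, c⟩
        exact ⟨a, b, fun l hl => (c l hl).2⟩
      · rintro ⟨a, b, c⟩
        exact ⟨a, b, fun l hl => ⟨hW l hl, c l hl⟩⟩
    · have e1 : ∏ l ∈ s \ u, (if l ∈ W then (l : ℝ)⁻¹ else 0) = 0 := by
        push Not at hW
        obtain ⟨l, hl, hlW⟩ := hW
        exact Finset.prod_eq_zero hl (if_neg hlW)
      rw [e1, Finset.sum_eq_zero]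
      · simp
      · intro n _
        rw [if_neg]
        rintro ⟨-, h⟩
        exact hW fun l hl => (h l hl).1
  refine (Finset.sum_le_sum h2).trans ?_
  rw [Finset.sum_const, Finset.card_powerset, nsmul_eq_mul, mul_one]
  push_cast
  rw [← Finset.prod_const]
  apply Finset.prod_le_prod
  · intros; norm_num
  · intro l hl
    exact_mod_cast (hs l hl).two_le

theorem abs_sum_inv_hit_sub_le (W s : Finset ℕ) (hs : ∀ l ∈ s, l.Prime) (Y Z : ℕ) (hY : 0 < Y)
    (hYZ : Y ≤ Z) :
    |(∑ n ∈ (Finset.Ioc Y Z).filter (fun n => ∀ l ∈ s, l ∣ n ∨ (l ∈ W ∧ l ∣ n - 1)), (n : ℝ)⁻¹) -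
      (∑ n ∈ Finset.Ioc Y Z, (n : ℝ)⁻¹) *
        ∏ l ∈ s, ((l : ℝ)⁻¹ + if l ∈ W then (l : ℝ)⁻¹ else 0)| ≤
      (∏ l ∈ s, (l : ℝ)) / Y := by
  set c := ∏ l ∈ s, ((l : ℝ)⁻¹ + if l ∈ W then (l : ℝ)⁻¹ else 0)
  have key := abs_sum_div_le
    (fun n => (if ∀ l ∈ s, l ∣ n ∨ (l ∈ W ∧ l ∣ n - 1) then (1 : ℝ) else 0) - c) Y Z hY hYZ
    (∏ l ∈ s, (l : ℝ)) (by
      intro k hk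
      have := abs_card_hit_sub_le W s hs Y k hk
      rw [Finset.sum_sub_distrib, Finset.sum_const, Nat.card_Ioc, nsmul_eq_mul,
        Nat.cast_sub hk]
      exact this)
  convert key using 2
  rw [Finset.sum_filter, Finset.sum_mul, ← Finset.sum_sub_distrib]
  apply Finset.sum_congr rfl
  intro n _
  split_ifs <;> ring

/-- The finite sets of primes whose product is at most `D`. -/
def primeSetsLE (D : ℕ) : Finset (Finset ℕ) :=
  (primesIoc 0 D).powerset.filter (fun s => ∏ p ∈ s, p ≤ D)

lemma mem_primeSetsLE {D : ℕ} {s : Finset ℕ} :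
    s ∈ primeSetsLE D ↔ (∀ p ∈ s, p.Prime) ∧ ∏ p ∈ s, p ≤ D := by
  rw [primeSetsLE, Finset.mem_filter, Finset.mem_powerset]
  refine ⟨fun ⟨h1, h2⟩ => ⟨fun p hp => (mem_primesIoc.1 (h1 hp)).2, h2⟩,
    fun ⟨h1, h2⟩ => ⟨fun p hp => mem_primesIoc.2 ⟨⟨(h1 p hp).pos, ?_⟩, h1 p hp⟩, h2⟩⟩
  refine le_trans ?_ h2
  exact Nat.le_of_dvd (Finset.prod_pos fun q hq => (h1 q hq).pos) (Finset.dvd_prod_of_mem _ hp)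

lemma primeSetsLE_subset {D : ℕ} {s t : Finset ℕ} (hs : s ∈ primeSetsLE D) (hts : t ⊆ s) :
    t ∈ primeSetsLE D := by
  rw [mem_primeSetsLE] at hs ⊢
  exact ⟨fun p hp => hs.1 p (hts hp), le_trans
    (Finset.prod_le_prod_of_subset_of_one_le' hts fun p hp _ => (hs.1 p hp).one_le) hs.2⟩

lemma half_log_le_sum_primeSetsLE (E : ℕ) (hE : 1 ≤ E) :
    Real.log E / 2 ≤ ∑ s ∈ primeSetsLE E, ∏ l ∈ s, (l : ℝ)⁻¹ := by
  have h1 : Real.log E ≤ ∑ n ∈ Finset.Icc 1 E, (n : ℝ)⁻¹ := by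
    have := log_add_one_le_harmonic E
    rw [harmonic_eq_sum_Icc] at this
    push_cast at this
    refine le_trans (Real.log_le_log (by exact_mod_cast hE) ?_) this
    linarith
  have h2 : ∑ n ∈ Finset.Icc 1 E, (n : ℝ)⁻¹ ≤
      ∑ x ∈ Finset.Icc 1 E ×ˢ primeSetsLE E, ((x.1 ^ 2 * ∏ l ∈ x.2, l : ℕ) : ℝ)⁻¹ := by
    have hsub : Finset.Icc 1 E ⊆
        (Finset.Icc 1 E ×ˢ primeSetsLE E).image (fun x => x.1 ^ 2 * ∏ l ∈ x.2, l) := by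
      intro n hn
      rw [Finset.mem_Icc] at hn
      obtain ⟨a, b, ha, hb, hab, hsq⟩ := Nat.sq_mul_squarefree_of_pos hn.1
      rw [Finset.mem_image]
      refine ⟨(b, a.primeFactors), ?_, ?_⟩
      · rw [Finset.mem_product, Finset.mem_Icc, mem_primeSetsLE]
        dsimp only
        rw [Nat.prod_primeFactors_of_squarefree hsq]
        refine ⟨⟨hb, ?_⟩, fun p hp => Nat.prime_of_mem_primeFactors hp, ?_⟩
        · nlinarith
        · nlinarith [Nat.pow_pos (n := 2) hb]
      · dsimp only
        rw [Nat.prod_primeFactors_of_squarefree hsq, hab]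
    refine (Finset.sum_le_sum_of_subset_of_nonneg hsub fun _ _ _ => by positivity).trans ?_
    exact Finset.sum_image_le_of_nonneg (f := fun n : ℕ => (n : ℝ)⁻¹) fun _ _ => by positivity
  have h3 : ∑ x ∈ Finset.Icc 1 E ×ˢ primeSetsLE E, ((x.1 ^ 2 * ∏ l ∈ x.2, l : ℕ) : ℝ)⁻¹ =
      (∑ b ∈ Finset.Icc 1 E, ((b : ℝ) ^ 2)⁻¹) * ∑ s ∈ primeSetsLE E, ∏ l ∈ s, (l : ℝ)⁻¹ := by
    rw [Finset.sum_mul_sum, Finset.sum_product]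
    apply Finset.sum_congr rfl; intro b _
    apply Finset.sum_congr rfl; intro s _
    push_cast
    rw [mul_inv, Finset.prod_inv_distrib]
  have h4 : ∑ b ∈ Finset.Icc 1 E, ((b : ℝ) ^ 2)⁻¹ ≤ 2 := by
    have := sum_Ioc_inv_sq_le_sub (α := ℝ) one_ne_zero hE
    rw [← Finset.add_sum_Ioc_eq_sum_Icc hE]
    have h0 : (0 : ℝ) ≤ (E : ℝ)⁻¹ := by positivity
    push_cast at this ⊢
    linarith
  have h5 : (0 : ℝ) ≤ ∑ s ∈ primeSetsLE E, ∏ l ∈ s, (l : ℝ)⁻¹ :=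
    Finset.sum_nonneg fun s _ => Finset.prod_nonneg fun i _ => by positivity
  have := mul_le_mul_of_nonneg_right h4 h5
  linarith

lemma log_div_four_le_sum_primeSetsLE_notMem (E q : ℕ) (hE : 1 ≤ E) (hq : 1 ≤ q) :
    Real.log E / 4 ≤ ∑ s ∈ primeSetsLE E with q ∉ s, ∏ l ∈ s, (l : ℝ)⁻¹ := by
  have h := half_log_le_sum_primeSetsLE E hE
  rw [← Finset.sum_filter_add_sum_filter_not _ (fun s => q ∉ s)] at h
  have h5 : (0 : ℝ) ≤ ∑ s ∈ primeSetsLE E with q ∉ s, ∏ l ∈ s, (l : ℝ)⁻¹ :=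
    Finset.sum_nonneg fun s _ => Finset.prod_nonneg fun i _ => by positivity
  have h1 : ∑ s ∈ primeSetsLE E with ¬ q ∉ s, ∏ l ∈ s, (l : ℝ)⁻¹ ≤
      ∑ s ∈ primeSetsLE E with q ∉ s, ∏ l ∈ s, (l : ℝ)⁻¹ := by
    have hq1 : (q : ℝ)⁻¹ ≤ 1 := inv_le_one_of_one_le₀ (by exact_mod_cast hq)
    calc _ ≤ ∑ s ∈ primeSetsLE E with ¬ q ∉ s, ∏ l ∈ s.erase q, (l : ℝ)⁻¹ := by
          apply Finset.sum_le_sum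
          intro s hs
          have hqs : q ∈ s := by simpa using (Finset.mem_filter.1 hs).2
          rw [← Finset.mul_prod_erase s _ hqs]
          exact mul_le_of_le_one_left (Finset.prod_nonneg fun i _ => by positivity) hq1
      _ = ∑ s ∈ ((primeSetsLE E).filter (fun s => ¬ q ∉ s)).image (fun s : Finset ℕ => s.erase q),
            ∏ l ∈ s, (l : ℝ)⁻¹ := by
          rw [Finset.sum_image]
          intro s hs t ht hst
          have hqs : q ∈ s := by simpa using (Finset.mem_filter.1 hs).2
          have hqt : q ∈ t := by simpa using (Finset.mem_filter.1 ht).2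
          dsimp only at hst
          rw [← Finset.insert_erase hqs, hst, Finset.insert_erase hqt]
      _ ≤ _ := by
          apply Finset.sum_le_sum_of_subset_of_nonneg
          · intro t ht
            obtain ⟨s, hs, rfl⟩ := Finset.mem_image.1 ht
            rw [Finset.mem_filter] at hs ⊢
            exact ⟨primeSetsLE_subset hs.1 (Finset.erase_subset _ _), Finset.notMem_erase _ _⟩
          · intro s _ _
            exact Finset.prod_nonneg fun i _ => by positivity
  linarith

lemma sum_inv_mul_log_le_sum_prod (W : Finset ℕ) (E : ℕ) (hE : 1 ≤ E)
    (hW : ∀ q ∈ W, q.Prime ∧ q ≤ E) :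
    (∑ q ∈ W, (q : ℝ)⁻¹) * (Real.log E / 4) ≤
      ∑ s ∈ primeSetsLE (E ^ 2), ∏ l ∈ s, ((l : ℝ)⁻¹ + if l ∈ W then (l : ℝ)⁻¹ else 0) := by
  have h1 : ∀ s : Finset ℕ, ∑ q ∈ W, (if q ∈ s then ∏ l ∈ s, (l : ℝ)⁻¹ else 0) ≤
      ∏ l ∈ s, ((l : ℝ)⁻¹ + if l ∈ W then (l : ℝ)⁻¹ else 0) := by
    intro s
    have e : ∏ l ∈ s, ((l : ℝ)⁻¹ + if l ∈ W then (l : ℝ)⁻¹ else 0) =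
        (∏ l ∈ s, (l : ℝ)⁻¹) * 2 ^ (W ∩ s).card := by
      have : ∀ l ∈ s, ((l : ℝ)⁻¹ + if l ∈ W then (l : ℝ)⁻¹ else 0) =
          (l : ℝ)⁻¹ * if l ∈ W then 2 else 1 := by
        intro l _
        split_ifs <;> ring
      rw [Finset.prod_congr rfl this, Finset.prod_mul_distrib, Finset.prod_ite]
      simp only [Finset.prod_const, one_pow, mul_one]
      rw [Finset.filter_mem_eq_inter, Finset.inter_comm]
    rw [e, ← Finset.sum_filter, Finset.sum_const, nsmul_eq_mul, Finset.filter_mem_eq_inter,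
      mul_comm]
    apply mul_le_mul_of_nonneg_left
    · exact_mod_cast Nat.lt_two_pow_self.le
    · exact Finset.prod_nonneg fun i _ => by positivity
  calc (∑ q ∈ W, (q : ℝ)⁻¹) * (Real.log E / 4)
      ≤ ∑ q ∈ W, ∑ s ∈ primeSetsLE (E ^ 2), (if q ∈ s then ∏ l ∈ s, (l : ℝ)⁻¹ else 0) := by
        rw [Finset.sum_mul]
        apply Finset.sum_le_sum
        intro q hq
        obtain ⟨hqp, hqE⟩ := hW q hq
        calc (q : ℝ)⁻¹ * (Real.log E / 4) ≤
            (q : ℝ)⁻¹ * ∑ s ∈ primeSetsLE E with q ∉ s, ∏ l ∈ s, (l : ℝ)⁻¹ := by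
              apply mul_le_mul_of_nonneg_left _ (by positivity)
              exact log_div_four_le_sum_primeSetsLE_notMem E q hE hqp.one_le
          _ = ∑ s ∈ (primeSetsLE E).filter (fun s => q ∉ s), ∏ l ∈ insert q s, (l : ℝ)⁻¹ := by
              rw [Finset.mul_sum]
              apply Finset.sum_congr rfl
              intro s hs
              rw [Finset.prod_insert (Finset.mem_filter.1 hs).2]
          _ = ∑ s ∈ ((primeSetsLE E).filter (fun s => q ∉ s)).image (fun s => insert q s),
                ∏ l ∈ s, (l : ℝ)⁻¹ := by
              rw [Finset.sum_image]
              intro s hs t ht hst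
              have hqs := (Finset.mem_filter.1 hs).2
              have hqt := (Finset.mem_filter.1 ht).2
              dsimp only at hst
              rw [← Finset.erase_insert hqs, hst, Finset.erase_insert hqt]
          _ ≤ _ := by
              rw [← Finset.sum_filter]
              apply Finset.sum_le_sum_of_subset_of_nonneg
              · intro t ht
                obtain ⟨s, hs, rfl⟩ := Finset.mem_image.1 ht
                rw [Finset.mem_filter] at hs ⊢
                refine ⟨?_, Finset.mem_insert_self _ _⟩
                have hs1 := mem_primeSetsLE.1 hs.1
                rw [mem_primeSetsLE, Finset.prod_insert hs.2]
                refine ⟨?_, ?_⟩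
                · intro p hp
                  rcases Finset.mem_insert.1 hp with rfl | hp
                  · exact hqp
                  · exact hs1.1 p hp
                · rw [sq]
                  exact Nat.mul_le_mul hqE hs1.2
              · intro s _ _
                exact Finset.prod_nonneg fun i _ => by positivity
    _ = ∑ s ∈ primeSetsLE (E ^ 2), ∑ q ∈ W, (if q ∈ s then ∏ l ∈ s, (l : ℝ)⁻¹ else 0) :=
        Finset.sum_comm
    _ ≤ _ := Finset.sum_le_sum fun s _ => h1 s

lemma sum_inv_Ioc_le_log (Y Z : ℕ) (hY : 0 < Y) (hYZ : Y ≤ Z) :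
    ∑ n ∈ Finset.Ioc Y Z, (n : ℝ)⁻¹ ≤ Real.log Z - Real.log Y := by
  induction Z, hYZ using Nat.le_induction with
  | base => simp
  | succ k hk ih =>
    rw [Finset.sum_Ioc_succ_top hk]
    have hk0 : (0 : ℝ) < k := by exact_mod_cast hY.trans_le hk
    have h1 : ((k + 1 : ℕ) : ℝ)⁻¹ ≤ Real.log ((k + 1 : ℕ) : ℝ) - Real.log k := by
      have h2 := Real.one_sub_inv_le_log_of_pos (x := ((k + 1 : ℕ) : ℝ) / k) (by positivity)
      rw [Real.log_div (by positivity) (by positivity)] at h2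
      refine le_trans (le_of_eq ?_) h2
      push_cast
      field_simp
      ring
    linarith

/-- If a set `W` of primes up to `E` has large reciprocal sum, then few primes `p` in the block
`(E ^ A ^ 2, E ^ A ^ 3]` have `p - 1` free of prime factors from `W`. -/
theorem sum_inv_primes_not_hit_le (A E : ℕ) (hA : 4 ≤ A) (hE : 4 ≤ E) (W : Finset ℕ)
    (hW : ∀ q ∈ W, q.Prime ∧ 3 ≤ q ∧ q ≤ E) (hS : 16 * (A : ℝ) ^ 3 ≤ ∑ q ∈ W, (q : ℝ)⁻¹) :
    ∑ p ∈ primesIoc (E ^ A ^ 2) (E ^ A ^ 3) with (∀ q ∈ W, ¬ q ∣ p - 1), (p : ℝ)⁻¹ ≤ 1 / 2 := by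
  set Y := E ^ A ^ 2 with hYdef
  set Z := E ^ A ^ 3 with hZdef
  have hE0 : 0 < E := by omega
  have hY : 0 < Y := by positivity
  have hYZ : Y ≤ Z := Nat.pow_le_pow_right hE0 (Nat.pow_le_pow_right (by omega) (by norm_num))
  have hlog : 0 < Real.log E := Real.log_pos (by exact_mod_cast (by omega : 1 < E))
  set X := ∑ n ∈ Finset.Ioc Y Z, (n : ℝ)⁻¹ with hX
  have hX0 : 0 ≤ X := Finset.sum_nonneg fun _ _ => by positivity
  have hXle : X ≤ (A : ℝ) ^ 3 * Real.log E := by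
    have := sum_inv_Ioc_le_log Y Z hY hYZ
    have hlY : 0 ≤ Real.log Y := Real.log_natCast_nonneg Y
    have hlZ : Real.log Z = (A : ℝ) ^ 3 * Real.log E := by
      rw [hZdef, Nat.cast_pow, Real.log_pow]
      push_cast
      ring
    linarith
  set γ : ℕ → ℝ := fun l => (l : ℝ)⁻¹ + if l ∈ W then (l : ℝ)⁻¹ else 0 with hγdef
  have hγ : ∀ l : ℕ, l.Prime → 0 < γ l ∧ γ l < 1 := by
    intro l hl
    have hl0 : (0 : ℝ) < l := by exact_mod_cast hl.pos
    have hl2 : (2 : ℝ) ≤ l := by exact_mod_cast hl.two_le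
    simp only [hγdef]
    split_ifs with hlW
    · have hl3 : (3 : ℝ) ≤ l := by exact_mod_cast (hW l hlW).2.1
      refine ⟨by positivity, ?_⟩
      have : (l : ℝ)⁻¹ ≤ 3⁻¹ := inv_anti₀ (by norm_num) hl3
      linarith
    · refine ⟨by positivity, ?_⟩
      have : (l : ℝ)⁻¹ ≤ 2⁻¹ := inv_anti₀ (by norm_num) hl2
      linarith
  have hγinv : ∀ l : ℕ, l.Prime → (γ l)⁻¹ ≤ l := by
    intro l hl
    have hl0 : (0 : ℝ) < l := by exact_mod_cast hl.pos
    rw [inv_le_comm₀ (hγ l hl).1 hl0]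
    simp only [hγdef]
    split_ifs
    · have : 0 ≤ (l : ℝ)⁻¹ := by positivity
      linarith
    · linarith
  set 𝒟 := primeSetsLE (E ^ 2) with h𝒟
  have hp : ∀ s ∈ 𝒟, ∀ p ∈ s, p.Prime := fun s hs => (mem_primeSetsLE.1 hs).1
  have hle : ∀ s ∈ 𝒟, ∏ p ∈ s, p ≤ E ^ 2 := fun s hs => (mem_primeSetsLE.1 hs).2
  have hle' : ∀ s ∈ 𝒟, ∏ p ∈ s, (p : ℝ) ≤ (E : ℝ) ^ 2 := fun s hs => by
    have := (Nat.cast_le (α := ℝ)).2 (hle s hs)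
    push_cast at this
    exact this
  have hsieve := selberg_sieve (Finset.Ioc Y Z) (fun n => (n : ℝ)⁻¹) (fun _ _ => by positivity)
    (fun l n => l ∣ n ∨ (l ∈ W ∧ l ∣ n - 1)) γ 𝒟 (fun s hs l hl => hγ l (hp s hs l hl))
    (fun s hs t ht => primeSetsLE_subset hs ht)
    (mem_primeSetsLE.2 ⟨by simp, by simpa using Nat.one_le_pow _ _ hE0⟩) X ((E : ℝ) ^ 4 / Y)
    (by
      intro s hs t ht
      have hst : ∀ l ∈ s ∪ t, l.Prime := by
        intro l hl
        rcases Finset.mem_union.1 hl with hl | hl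
        exacts [hp s hs l hl, hp t ht l hl]
      have key := abs_sum_inv_hit_sub_le W (s ∪ t) hst Y Z hY hYZ
      refine le_trans ?_ (key.trans ?_)
      · apply le_of_eq
        congr!
      · gcongr
        calc ∏ l ∈ s ∪ t, (l : ℝ) = ∏ l ∈ s ∪ t \ s, (l : ℝ) := by
              rw [Finset.union_sdiff_self_eq_union]
          _ = (∏ l ∈ s, (l : ℝ)) * ∏ l ∈ t \ s, (l : ℝ) :=
              Finset.prod_union Finset.disjoint_sdiff
          _ ≤ (E : ℝ) ^ 2 * (E : ℝ) ^ 2 := by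
              apply mul_le_mul (hle' s hs) (hle' _ (primeSetsLE_subset ht Finset.sdiff_subset))
              · exact Finset.prod_nonneg fun _ _ => by positivity
              · positivity
          _ = (E : ℝ) ^ 4 := by ring)
  have hG : 4 * X ≤ ∑ s ∈ 𝒟, ∏ l ∈ s, (γ l / (1 - γ l)) := by
    calc 4 * X ≤ 4 * ((A : ℝ) ^ 3 * Real.log E) := by gcongr
      _ = 16 * (A : ℝ) ^ 3 * (Real.log E / 4) := by ring
      _ ≤ (∑ q ∈ W, (q : ℝ)⁻¹) * (Real.log E / 4) := by gcongr
      _ ≤ ∑ s ∈ 𝒟, ∏ l ∈ s, γ l :=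
          sum_inv_mul_log_le_sum_prod W E hE0 fun q hq => ⟨(hW q hq).1, (hW q hq).2.2⟩
      _ ≤ _ := by
          apply Finset.sum_le_sum
          intro s hs
          apply Finset.prod_le_prod (fun l hl => (hγ l (hp s hs l hl)).1.le)
          intro l hl
          obtain ⟨h0, h1⟩ := hγ l (hp s hs l hl)
          rw [le_div_iff₀ (by linarith)]
          nlinarith
  have hXG : X / (∑ s ∈ 𝒟, ∏ l ∈ s, (γ l / (1 - γ l))) ≤ 1 / 4 := by
    rcases hX0.eq_or_lt with h0 | h0
    · rw [← h0]
      simp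
    · rw [div_le_iff₀ (by linarith)]
      linarith
  have hcard : ((𝒟.card : ℕ) : ℝ) ≤ (E : ℝ) ^ 2 := by
    exact_mod_cast card_le_of_prod_primes_le 𝒟 (E ^ 2) hp hle
  have hΓ : ∑ s ∈ 𝒟, ∏ l ∈ s, (γ l)⁻¹ ≤ (E : ℝ) ^ 4 := by
    calc ∑ s ∈ 𝒟, ∏ l ∈ s, (γ l)⁻¹ ≤ ∑ s ∈ 𝒟, (E : ℝ) ^ 2 := by
          apply Finset.sum_le_sum
          intro s hs
          refine le_trans (Finset.prod_le_prod ?_ ?_) (hle' s hs)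
          · exact fun l hl => (inv_pos.2 (hγ l (hp s hs l hl)).1).le
          · exact fun l hl => hγinv l (hp s hs l hl)
      _ = 𝒟.card * (E : ℝ) ^ 2 := by rw [Finset.sum_const, nsmul_eq_mul]
      _ ≤ (E : ℝ) ^ 2 * (E : ℝ) ^ 2 := by gcongr
      _ = (E : ℝ) ^ 4 := by ring
  have hΓ0 : 0 ≤ ∑ s ∈ 𝒟, ∏ l ∈ s, (γ l)⁻¹ :=
    Finset.sum_nonneg fun s hs => Finset.prod_nonneg fun l hl =>
      (inv_pos.2 (hγ l (hp s hs l hl)).1).le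
  have herr : (E : ℝ) ^ 4 / Y * (∑ s ∈ 𝒟, ∏ l ∈ s, (γ l)⁻¹) ^ 2 ≤ 1 / 4 := by
    have hE4 : (4 : ℝ) ≤ E := by exact_mod_cast hE
    have hY16 : (E : ℝ) ^ 16 ≤ Y := by
      have : E ^ 16 ≤ Y := Nat.pow_le_pow_right hE0 (by nlinarith)
      exact_mod_cast this
    have hY0 : (0 : ℝ) < Y := by exact_mod_cast hY
    calc _ ≤ (E : ℝ) ^ 4 / Y * ((E : ℝ) ^ 4) ^ 2 := by gcongr
      _ = (E : ℝ) ^ 12 / Y := by ring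
      _ ≤ 1 / 4 := by
        rw [div_le_iff₀ hY0]
        have h12 : (0 : ℝ) < (E : ℝ) ^ 12 := by positivity
        have : (4 : ℝ) ≤ (E : ℝ) ^ 4 := by nlinarith [pow_le_pow_left₀ (by norm_num) hE4 4]
        nlinarith
  have hsub : (primesIoc Y Z).filter (fun p => ∀ q ∈ W, ¬ q ∣ p - 1) ⊆
      (Finset.Ioc Y Z).filter
        (fun n => ∀ s ∈ 𝒟, ∀ l ∈ s, ¬ (l ∣ n ∨ (l ∈ W ∧ l ∣ n - 1))) := by
    intro p hpp
    rw [Finset.mem_filter, mem_primesIoc] at hpp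
    rw [Finset.mem_filter, Finset.mem_Ioc]
    refine ⟨hpp.1.1, fun s hs l hl hcon => ?_⟩
    rcases hcon with hcon | ⟨h1, h2⟩
    · have hlp : l = p := (Nat.prime_dvd_prime_iff_eq (hp s hs l hl) hpp.1.2).1 hcon
      have hl2 : l ≤ E ^ 2 := (Nat.le_of_dvd (Finset.prod_pos fun q hq => (hp s hs q hq).pos)
        (Finset.dvd_prod_of_mem _ hl)).trans (hle s hs)
      have hEY : E ^ 2 ≤ Y := Nat.pow_le_pow_right hE0 (by nlinarith)
      have := hpp.1.1.1
      omega
    · exact hpp.2 l h1 h2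
  calc _ ≤ ∑ n ∈ (Finset.Ioc Y Z).filter
        (fun n => ∀ s ∈ 𝒟, ∀ l ∈ s, ¬ (l ∣ n ∨ (l ∈ W ∧ l ∣ n - 1))), (n : ℝ)⁻¹ :=
        Finset.sum_le_sum_of_subset_of_nonneg hsub fun _ _ _ => by positivity
    _ ≤ X / (∑ s ∈ 𝒟, ∏ l ∈ s, (γ l / (1 - γ l))) +
        (E : ℝ) ^ 4 / Y * (∑ s ∈ 𝒟, ∏ l ∈ s, (γ l)⁻¹) ^ 2 := by
        refine le_trans (le_of_eq ?_) hsieve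
        congr!
    _ ≤ 1 / 2 := by linarith

/-! ### Prime factors of `p - 1` for `p ∣ n`, in many disjoint windows -/

lemma exists_disjoint_subsets_sum_ge (f : ℕ → ℝ) (δ : ℝ) (hδ : 0 < δ) (ρ : ℕ) :
    ∀ W : Finset ℕ, (∀ q ∈ W, f q ≤ δ) → 2 * ρ * δ ≤ ∑ q ∈ W, f q →
      ∃ V : ℕ → Finset ℕ, (∀ i < ρ, V i ⊆ W ∧ δ ≤ ∑ q ∈ V i, f q) ∧
        ∀ i < ρ, ∀ j < ρ, i ≠ j → Disjoint (V i) (V j) := by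
  induction ρ with
  | zero => exact fun W _ _ => ⟨fun _ => ∅, by simp, by simp⟩
  | succ ρ ih =>
    intro W hW hsum
    push_cast at hsum
    have hne : (W.powerset.filter (fun U => δ ≤ ∑ q ∈ U, f q)).Nonempty := by
      refine ⟨W, Finset.mem_filter.2 ⟨Finset.mem_powerset_self W, ?_⟩⟩
      have : (0 : ℝ) ≤ ρ * δ := by positivity
      linarith
    obtain ⟨U, hU, hmin⟩ := Finset.exists_min_image _ Finset.card hne
    rw [Finset.mem_filter, Finset.mem_powerset] at hU
    have hU2 : ∑ q ∈ U, f q ≤ 2 * δ := by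
      have hUne : U.Nonempty := by
        rw [Finset.nonempty_iff_ne_empty]
        rintro rfl
        simp only [Finset.sum_empty] at hU
        linarith [hU.2]
      obtain ⟨q, hq⟩ := hUne
      have h1 : ∑ q ∈ U.erase q, f q < δ := by
        by_contra hcon
        push Not at hcon
        have := hmin (U.erase q) (Finset.mem_filter.2 ⟨Finset.mem_powerset.2
          ((Finset.erase_subset _ _).trans hU.1), hcon⟩)
        exact absurd (Finset.card_erase_lt_of_mem hq) (not_lt.2 this)
      rw [← Finset.add_sum_erase _ _ hq]
      linarith [hW q (hU.1 hq)]
    have h2 := Finset.sum_sdiff (f := f) hU.1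
    obtain ⟨V, hV, hdis⟩ := ih (W \ U) (fun q hq => hW q (Finset.sdiff_subset hq)) (by linarith)
    have hdU : ∀ i < ρ, Disjoint (V i) U := fun i hi =>
      Finset.disjoint_of_subset_left (hV i hi).1 Finset.sdiff_disjoint
    refine ⟨fun i => if i < ρ then V i else U, ?_, ?_⟩
    · intro i _
      dsimp only
      split_ifs with h
      · exact ⟨(hV i h).1.trans Finset.sdiff_subset, (hV i h).2⟩
      · exact hU
    · intro i hi j hj hij
      dsimp only
      split_ifs with h h' h'
      · exact hdis i h j h' hij
      · exact hdU i h
      · exact (hdU j h').symm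
      · omega

/-- `q` divides `p - 1` for some prime factor `p` of `n`. -/
def HitBy (n q : ℕ) : Prop := ∃ p, p.Prime ∧ p ∣ n ∧ q ∣ p - 1

lemma sum_primesIoc_add {a b c : ℕ} (hab : a ≤ b) (hbc : b ≤ c) (f : ℕ → ℝ) :
    ∑ p ∈ primesIoc a c, f p = ∑ p ∈ primesIoc a b, f p + ∑ p ∈ primesIoc b c, f p := by
  rw [← Finset.sum_union]
  · congr 1
    ext p
    rw [Finset.mem_union, mem_primesIoc, mem_primesIoc, mem_primesIoc]
    constructor
    · rintro ⟨⟨h1, h2⟩, h3⟩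
      rcases le_or_gt p b with h | h
      · exact Or.inl ⟨⟨h1, h⟩, h3⟩
      · exact Or.inr ⟨⟨h, h2⟩, h3⟩
    · rintro (⟨⟨h1, h2⟩, h3⟩ | ⟨⟨h1, h2⟩, h3⟩)
      · exact ⟨⟨h1, h2.trans hbc⟩, h3⟩
      · exact ⟨⟨hab.trans_lt h1, h2⟩, h3⟩
  · rw [Finset.disjoint_left]
    intro p h1 h2
    have h3 := (mem_primesIoc.1 h1).1.2
    have h4 := (mem_primesIoc.1 h2).1.1
    omega

lemma nat_mul_le_sum_primesIoc {T : ℕ → ℕ} (hT : Monotone T) (f : ℕ → ℝ) (c : ℝ) (a k : ℕ)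
    (hc : ∀ i, a ≤ i → c ≤ ∑ p ∈ primesIoc (T i) (T (i + 1)), f p) :
    k * c ≤ ∑ p ∈ primesIoc (T a) (T (a + k)), f p := by
  induction k with
  | zero => simp [primesIoc]
  | succ k ih =>
    rw [sum_primesIoc_add (hT (Nat.le_add_right a k)) (hT (by omega : a + k ≤ a + (k + 1)))]
    have := hc (a + k) (by omega)
    push_cast
    have e : a + (k + 1) = a + k + 1 := by ring
    rw [e]
    linarith

/-- Thresholds with `T (a + 1) = T a ^ A` such that the primes in each block `(T a, T (a + 1)]`
have reciprocal sum at least one. -/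
structure PrimeBlocks (A : ℕ) (T : ℕ → ℕ) : Prop where
  hA : 16 ≤ A
  h0 : 4 ≤ T 0
  hpow : ∀ a, T (a + 1) = T a ^ A
  hmass : ∀ a, 1 ≤ ∑ p ∈ primesIoc (T a) (T (a + 1)), (p : ℝ)⁻¹

namespace PrimeBlocks

variable {A : ℕ} {T : ℕ → ℕ}

lemma pos (H : PrimeBlocks A T) (a : ℕ) : 0 < T a := by
  induction a with
  | zero => have := H.h0; omega
  | succ a ih => rw [H.hpow]; positivity

lemma mono (H : PrimeBlocks A T) : Monotone T := by
  apply monotone_nat_of_le_succ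
  intro a
  rw [H.hpow]
  exact Nat.le_self_pow (by have := H.hA; omega) _

lemma pow_add (H : PrimeBlocks A T) (a k : ℕ) : T (a + k) = T a ^ A ^ k := by
  induction k with
  | zero => simp
  | succ k ih => rw [← add_assoc, H.hpow, ih, ← pow_mul, ← pow_succ]

lemma card_not_hit_le (H : PrimeBlocks A T) (W : Finset ℕ) (c k N : ℕ) (hk : 4 ≤ k)
    (hW : ∀ q ∈ W, q.Prime ∧ 3 ≤ q ∧ q ≤ T c)
    (hS : 16 * (A : ℝ) ^ 3 ≤ ∑ q ∈ W, (q : ℝ)⁻¹) :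
    (((Finset.Icc 1 N).filter (fun n => ∀ q ∈ W, ¬ HitBy n q)).card : ℝ) ≤
      16 * N / (k : ℝ) ^ 2 + (T (c + 2 + k) : ℝ) ^ 8 := by
  set P := (primesIoc (T (c + 2)) (T (c + 2 + k))).filter (fun p => ∃ q ∈ W, q ∣ p - 1) with hP
  have hmass : (k : ℝ) / 2 ≤ ∑ p ∈ P, (p : ℝ)⁻¹ := by
    rw [hP, Finset.sum_filter]
    have := nat_mul_le_sum_primesIoc H.mono
      (fun p : ℕ => if ∃ q ∈ W, q ∣ p - 1 then (p : ℝ)⁻¹ else 0) (1 / 2) (c + 2) k (by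
        intro i hi
        obtain ⟨j, rfl⟩ := Nat.exists_eq_add_of_le' (by omega : 2 ≤ i)
        have h1 := sum_inv_primes_not_hit_le A (T j) (by have := H.hA; omega)
          (H.h0.trans (H.mono (Nat.zero_le j))) W (fun q hq => ⟨(hW q hq).1, (hW q hq).2.1,
            (hW q hq).2.2.trans (H.mono (by omega))⟩) hS
        rw [← H.pow_add, ← H.pow_add] at h1
        have h2 := H.hmass (j + 2)
        rw [← Finset.sum_filter]
        rw [← Finset.sum_filter_add_sum_filter_not _ (fun p => ∃ q ∈ W, q ∣ p - 1)] at h2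
        have e : (primesIoc (T (j + 2)) (T (j + 3))).filter (fun p => ∀ q ∈ W, ¬ q ∣ p - 1) =
            (primesIoc (T (j + 2)) (T (j + 2 + 1))).filter (fun p => ¬ ∃ q ∈ W, q ∣ p - 1) := by
          apply Finset.filter_congr
          intro p _
          push Not
          rfl
        rw [e] at h1
        linarith)
    linarith
  have hk4 : (4 : ℝ) ≤ k := by exact_mod_cast hk
  have key := card_not_dvd_primes_le P (T (c + 2 + k)) N
    (fun p hp => (mem_primesIoc.1 (Finset.mem_filter.1 hp).1).2)
    (fun p hp => (mem_primesIoc.1 (Finset.mem_filter.1 hp).1).1.2) (H.pos _)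
    ((k : ℝ) ^ 2 / 16) (by positivity) (by nlinarith)
  have e : (N : ℝ) / ((k : ℝ) ^ 2 / 16) = 16 * N / (k : ℝ) ^ 2 := by
    field_simp
  rw [e] at key
  refine le_trans ?_ key
  norm_cast
  apply Finset.card_le_card
  intro n hn
  rw [Finset.mem_filter] at hn ⊢
  refine ⟨hn.1, fun p hp hpn => ?_⟩
  rw [Finset.mem_filter, mem_primesIoc] at hp
  obtain ⟨⟨-, hpp⟩, q, hq, hqp⟩ := hp
  exact hn.2 q hq ⟨p, hpp, hpn, hqp⟩

lemma card_few_hits_le (H : PrimeBlocks A T) (m R a k N : ℕ) (hm : 64 * A ^ 3 ≤ m) (hk : 4 ≤ k)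
    (hR : 0 < R) (hTR : 4 * R ≤ T 0) :
    (((Finset.Icc 1 N).filter
      (fun n => ((primesIoc (T a) (T (a + m))).filter (HitBy n)).card < R)).card : ℝ) ≤
      4 ^ R * (16 * N / (k : ℝ) ^ 2 + (T (a + m + 2 + k) : ℝ) ^ 8) := by
  set W := primesIoc (T a) (T (a + m)) with hWdef
  have hWm : (m : ℝ) ≤ ∑ q ∈ W, (q : ℝ)⁻¹ := by
    have := nat_mul_le_sum_primesIoc H.mono (fun p : ℕ => (p : ℝ)⁻¹) 1 a m
      (fun i _ => H.hmass i)
    rwa [mul_one] at this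
  have hm1 : 1 ≤ m := by
    have : 0 < A ^ 3 := Nat.pow_pos (by have := H.hA; omega)
    omega
  have hm0 : (1 : ℝ) ≤ m := by exact_mod_cast hm1
  have hR0 : (0 : ℝ) < R := by exact_mod_cast hR
  have hTa : T 0 ≤ T a := H.mono (Nat.zero_le a)
  set δ : ℝ := m / (4 * R) with hδ
  have hδ0 : 0 < δ := by positivity
  obtain ⟨V, hV, hdis⟩ := exists_disjoint_subsets_sum_ge (fun q : ℕ => (q : ℝ)⁻¹) δ hδ0 (2 * R) W
    (by
      intro q hq
      have h1 : T a < q := (mem_primesIoc.1 hq).1.1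
      have h2 : (4 * R : ℝ) ≤ q := by exact_mod_cast (by omega : 4 * R ≤ q)
      calc (q : ℝ)⁻¹ ≤ (4 * R : ℝ)⁻¹ := inv_anti₀ (by positivity) h2
        _ ≤ m / (4 * R) := by
          rw [inv_eq_one_div]
          gcongr)
    (by
      refine le_trans (le_of_eq ?_) hWm
      rw [hδ]
      push_cast
      field_simp
      norm_num)
  set U : Finset ℕ → Finset ℕ := fun S => S.biUnion V
  set F : Finset (Finset ℕ) := (Finset.range (2 * R)).powerset.filter (fun S => R ≤ S.card) with hF
  have hFcard : (F.card : ℝ) ≤ 4 ^ R := by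
    have : F.card ≤ 4 ^ R := by
      refine (Finset.card_filter_le _ _).trans (le_of_eq ?_)
      rw [Finset.card_powerset, Finset.card_range, pow_mul]
      norm_num
    exact_mod_cast this
  have hcover : (Finset.Icc 1 N).filter (fun n => (W.filter (HitBy n)).card < R) ⊆
      F.biUnion (fun S => (Finset.Icc 1 N).filter (fun n => ∀ q ∈ U S, ¬ HitBy n q)) := by
    intro n hn
    rw [Finset.mem_filter] at hn
    rw [Finset.mem_biUnion]
    set S := (Finset.range (2 * R)).filter (fun i => ∀ q ∈ V i, ¬ HitBy n q) with hS
    refine ⟨S, ?_, ?_⟩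
    · rw [hF, Finset.mem_filter, Finset.mem_powerset]
      refine ⟨Finset.filter_subset _ _, ?_⟩
      set S' := (Finset.range (2 * R)).filter (fun i => ¬ ∀ q ∈ V i, ¬ HitBy n q) with hS'
      have h1 : S.card + S'.card = 2 * R := by
        rw [hS, hS', Finset.card_filter_add_card_filter_not, Finset.card_range]
      have h2 : S'.card ≤ (W.filter (HitBy n)).card := by
        have hex : ∀ i ∈ S', ∃ q ∈ V i, HitBy n q := by
          intro i hi
          have := (Finset.mem_filter.1 hi).2
          push Not at this
          exact this
        choose! φ hφ using hex
        apply Finset.card_le_card_of_injOn φ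
        · intro i hi
          have hi2 : i < 2 * R := Finset.mem_range.1 (Finset.mem_filter.1 hi).1
          exact Finset.mem_coe.2 (Finset.mem_filter.2 ⟨(hV i hi2).1 (hφ i hi).1, (hφ i hi).2⟩)
        · intro i hi j hj hij
          by_contra hne
          have hi2 : i < 2 * R := Finset.mem_range.1 (Finset.mem_filter.1 hi).1
          have hj2 : j < 2 * R := Finset.mem_range.1 (Finset.mem_filter.1 hj).1
          refine Finset.disjoint_left.1 (hdis i hi2 j hj2 hne) (hφ i hi).1 ?_
          rw [hij]
          exact (hφ j hj).1
      omega
    · rw [Finset.mem_filter]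
      refine ⟨hn.1, fun q hq => ?_⟩
      obtain ⟨i, hi, hqi⟩ := Finset.mem_biUnion.1 hq
      exact (Finset.mem_filter.1 hi).2 q hqi
  have hbd : ∀ S ∈ F, (((Finset.Icc 1 N).filter (fun n => ∀ q ∈ U S, ¬ HitBy n q)).card : ℝ) ≤
      16 * N / (k : ℝ) ^ 2 + (T (a + m + 2 + k) : ℝ) ^ 8 := by
    intro S hS
    rw [hF, Finset.mem_filter, Finset.mem_powerset] at hS
    have hSR : ∀ i ∈ S, i < 2 * R := fun i hi => Finset.mem_range.1 (hS.1 hi)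
    apply H.card_not_hit_le (U S) (a + m) k N hk
    · intro q hq
      obtain ⟨i, hi, hqi⟩ := Finset.mem_biUnion.1 hq
      have := mem_primesIoc.1 ((hV i (hSR i hi)).1 hqi)
      have h0 := H.h0
      exact ⟨this.2, by omega, this.1.2⟩
    · have hsum : ∑ q ∈ U S, (q : ℝ)⁻¹ = ∑ i ∈ S, ∑ q ∈ V i, (q : ℝ)⁻¹ := by
        apply Finset.sum_biUnion
        intro i hi j hj hij
        exact hdis i (hSR i hi) j (hSR j hj) hij
      rw [hsum]
      have hmA : 64 * (A : ℝ) ^ 3 ≤ m := by exact_mod_cast hm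
      calc 16 * (A : ℝ) ^ 3 ≤ R * δ := by
            rw [hδ]
            have : (R : ℝ) * (m / (4 * R)) = m / 4 := by field_simp
            linarith
        _ ≤ S.card * δ := by
            have : (R : ℝ) ≤ S.card := by exact_mod_cast hS.2
            gcongr
        _ ≤ _ := by
            rw [← nsmul_eq_mul]
            exact Finset.card_nsmul_le_sum _ _ _ fun i hi => (hV i (hSR i hi)).2
  calc _ ≤ ((F.biUnion (fun S => (Finset.Icc 1 N).filter
          (fun n => ∀ q ∈ U S, ¬ HitBy n q))).card : ℝ) := by
        exact_mod_cast Finset.card_le_card hcover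
    _ ≤ ∑ S ∈ F, (((Finset.Icc 1 N).filter (fun n => ∀ q ∈ U S, ¬ HitBy n q)).card : ℝ) := by
        exact_mod_cast Finset.card_biUnion_le
    _ ≤ ∑ S ∈ F, (16 * N / (k : ℝ) ^ 2 + (T (a + m + 2 + k) : ℝ) ^ 8) := Finset.sum_le_sum hbd
    _ = F.card * (16 * N / (k : ℝ) ^ 2 + (T (a + m + 2 + k) : ℝ) ^ 8) := by
        rw [Finset.sum_const, nsmul_eq_mul]
    _ ≤ _ := by gcongr

lemma card_exists_window_few_hits_le (H : PrimeBlocks A T) (m R I b k N : ℕ)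
    (hm : 64 * A ^ 3 ≤ m) (hk : 4 ≤ k) (hb : I * m + 2 + k ≤ b) (hR : 0 < R)
    (hTR : 4 * R ≤ T 0) :
    (((Finset.Icc 1 N).filter (fun n => ∃ i < I,
      ((primesIoc (T (i * m)) (T ((i + 1) * m))).filter (HitBy n)).card < R)).card : ℝ) ≤
      4 ^ R * (16 * N / (k - 1) + I * (T b : ℝ) ^ 8) := by
  have hm1 : 1 ≤ m := by
    have : 0 < A ^ 3 := Nat.pow_pos (by have := H.hA; omega)
    omega
  have hk4 : (4 : ℝ) ≤ k := by exact_mod_cast hk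
  have hsum : ∀ J : ℕ, 1 ≤ J →
      ∑ j ∈ Finset.range J, 1 / ((k : ℝ) + j) ^ 2 ≤ 1 / ((k : ℝ) - 1) - 1 / ((k : ℝ) + J - 1) := by
    intro J hJ
    have step : ∀ j : ℕ, 1 / ((k : ℝ) + j) ^ 2 ≤ 1 / ((k : ℝ) + j - 1) - 1 / ((k : ℝ) + j) := by
      intro j
      have hj : (0 : ℝ) ≤ j := by positivity
      rw [div_sub_div _ _ (by linarith) (by linarith), div_le_div_iff₀ (by positivity)
        (mul_pos (by linarith) (by linarith))]
      nlinarith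
    induction J, hJ using Nat.le_induction with
    | base =>
      have := step 0
      simpa using this
    | succ J _ ih =>
      rw [Finset.sum_range_succ]
      have := step J
      push_cast
      have e : (k : ℝ) + (J + 1) - 1 = k + J := by ring
      rw [e]
      linarith
  have hsum' : ∑ j ∈ Finset.range I, 1 / ((k : ℝ) + j) ^ 2 ≤ 1 / ((k : ℝ) - 1) := by
    rcases Nat.eq_zero_or_pos I with rfl | hI
    · simp only [Finset.range_zero, Finset.sum_empty]
      exact div_nonneg zero_le_one (by linarith)
    · have h1 := hsum I hI
      have h2 : (1 : ℝ) ≤ I := by exact_mod_cast hI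
      have h3 : (0 : ℝ) ≤ 1 / ((k : ℝ) + I - 1) := div_nonneg zero_le_one (by linarith)
      linarith
  have hw : ∀ i ∈ Finset.range I, (((Finset.Icc 1 N).filter (fun n =>
      ((primesIoc (T (i * m)) (T ((i + 1) * m))).filter (HitBy n)).card < R)).card : ℝ) ≤
      4 ^ R * (16 * N * (1 / ((k : ℝ) + (I - 1 - i : ℕ)) ^ 2) + (T b : ℝ) ^ 8) := by
    intro i hi
    have hi' := Finset.mem_range.1 hi
    have key := H.card_few_hits_le m R (i * m) (k + (I - 1 - i)) N hm (by omega) hR hTR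
    have hle : i * m + m + 2 + (k + (I - 1 - i)) ≤ b := by
      obtain ⟨j, rfl⟩ := Nat.exists_eq_add_of_lt hi'
      have e : i + j + 1 - 1 - i = j := by omega
      rw [e]
      have : j ≤ j * m := Nat.le_mul_of_pos_right _ hm1
      have e2 : (i + j + 1) * m = i * m + j * m + m := by ring
      omega
    have hT : (T (i * m + m + 2 + (k + (I - 1 - i))) : ℝ) ≤ T b := by
      exact_mod_cast H.mono hle
    have e : (i + 1) * m = i * m + m := by ring
    rw [e]
    refine key.trans ?_
    push_cast
    rw [mul_one_div]
    gcongr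
  calc _ ≤ (((Finset.range I).biUnion (fun i => (Finset.Icc 1 N).filter (fun n =>
        ((primesIoc (T (i * m)) (T ((i + 1) * m))).filter (HitBy n)).card < R))).card : ℝ) := by
        norm_cast
        apply Finset.card_le_card
        intro n hn
        rw [Finset.mem_filter] at hn
        obtain ⟨hn, i, hi, h⟩ := hn
        exact Finset.mem_biUnion.2 ⟨i, Finset.mem_range.2 hi, Finset.mem_filter.2 ⟨hn, h⟩⟩
    _ ≤ ∑ i ∈ Finset.range I, (((Finset.Icc 1 N).filter (fun n =>
        ((primesIoc (T (i * m)) (T ((i + 1) * m))).filter (HitBy n)).card < R)).card : ℝ) := by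
        exact_mod_cast Finset.card_biUnion_le
    _ ≤ _ := Finset.sum_le_sum hw
    _ = 4 ^ R * (16 * N * ∑ j ∈ Finset.range I, 1 / ((k : ℝ) + j) ^ 2 + I * (T b : ℝ) ^ 8) := by
        rw [← Finset.mul_sum, Finset.sum_add_distrib, ← Finset.mul_sum,
          Finset.sum_range_reflect (fun j : ℕ => 1 / ((k : ℝ) + j) ^ 2), Finset.sum_const,
          Finset.card_range, nsmul_eq_mul]
    _ ≤ 4 ^ R * (16 * N * (1 / ((k : ℝ) - 1)) + I * (T b : ℝ) ^ 8) := by gcongr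
    _ = _ := by ring

end PrimeBlocks

/-! ### Dense divisors -/

lemma DenseDivIn.mono {n n' : ℕ} {u : ℝ} {I I' : Set ℝ} (hd : DenseDivIn n u I) (hn : n ∣ n')
    (hI : I' ⊆ I) : DenseDivIn n' u I' := fun y hy => by
  obtain ⟨d, h1, h2⟩ := hd y (hI hy)
  exact ⟨d, h1.trans hn, h2⟩

lemma DenseDivIn.mul {n q : ℕ} {u a z : ℝ} (hd : DenseDivIn n u (Set.Ico a z)) (hq : 0 < q)
    (hqz : q * a ≤ z) : DenseDivIn (n * q) u (Set.Ico a (z * q)) := by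
  intro y hy
  have hq0 : (0 : ℝ) < q := by exact_mod_cast hq
  rcases lt_or_ge y z with h | h
  · obtain ⟨d, h1, h2⟩ := hd y ⟨hy.1, h⟩
    exact ⟨d, h1.mul_right q, h2⟩
  · obtain ⟨d, h1, h2, h3⟩ := hd (y / q)
      ⟨(le_div_iff₀ hq0).2 (by linarith), (div_lt_iff₀ hq0).2 hy.2⟩
    refine ⟨d * q, Nat.mul_dvd_mul_right h1 q, ?_, ?_⟩
    · push_cast
      rwa [div_lt_iff₀ hq0] at h2
    · push_cast
      rwa [← mul_div_assoc, le_div_iff₀ hq0] at h3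

lemma DenseDivIn.mul_prod {n : ℕ} {u a z : ℝ} (ha : 0 ≤ a) (hd : DenseDivIn n u (Set.Ico a z))
    (Q : Finset ℕ) (hQ : ∀ q ∈ Q, 0 < q ∧ q * a ≤ z) :
    DenseDivIn (n * ∏ q ∈ Q, q) u (Set.Ico a (z * ∏ q ∈ Q, (q : ℝ))) := by
  induction Q using Finset.induction_on with
  | empty => simpa using hd
  | insert q Q hqQ ih =>
    have h1 := ih fun p hp => hQ p (Finset.mem_insert_of_mem hp)
    obtain ⟨hq, hqz⟩ := hQ q (Finset.mem_insert_self q Q)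
    rw [Finset.prod_insert hqQ, Finset.prod_insert hqQ, mul_comm q, mul_comm (q : ℝ),
      ← mul_assoc, ← mul_assoc]
    apply h1.mul hq
    refine hqz.trans (le_mul_of_one_le_right (le_trans (by positivity) hqz) ?_)
    have : 1 ≤ ∏ p ∈ Q, p :=
      Finset.one_le_prod' fun p hp => (hQ p (Finset.mem_insert_of_mem hp)).1
    have := (Nat.cast_le (α := ℝ)).2 this
    push_cast at this
    exact this

lemma denseDivIn_factorial_mul_two_pow (h : ℕ) (hh : 0 < h) (s : ℕ) :
    DenseDivIn ((2 * h).factorial * 2 ^ s) (1 + 1 / h) (Set.Ico (h : ℝ) (2 * h * 2 ^ s)) := by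
  have hh0 : (0 : ℝ) < h := by exact_mod_cast hh
  induction s with
  | zero =>
    intro y hy
    simp only [pow_zero, mul_one, Set.mem_Ico] at hy
    have hy0 : 0 ≤ y := hh0.le.trans hy.1
    refine ⟨⌊y⌋₊ + 1, ?_, ?_, ?_⟩
    · rw [pow_zero, mul_one]
      apply Nat.dvd_factorial (Nat.succ_pos _)
      have : ⌊y⌋₊ < 2 * h := (Nat.floor_lt hy0).2 (by push_cast; exact hy.2)
      omega
    · push_cast
      exact Nat.lt_floor_add_one y
    · push_cast
      have h1 := Nat.floor_le hy0
      have h2 : 1 ≤ y / h := (one_le_div hh0).2 hy.1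
      have e : (1 + 1 / (h : ℝ)) * y = y + y / h := by ring
      rw [e]
      linarith
  | succ s ih =>
    have := ih.mul (q := 2) (by norm_num) (by
      push_cast
      exact le_mul_of_one_le_right (by positivity) (one_le_pow₀ (by norm_num)))
    rw [pow_succ, ← mul_assoc]
    convert this using 2
    push_cast
    ring

lemma PrimeBlocks.denseDivIn {A : ℕ} {T : ℕ → ℕ} (H : PrimeBlocks A T) {m R h : ℕ} {u : ℝ}
    (hR : A ^ (2 * m) ≤ R) {M L : ℕ} (hML : M ∣ L) (hMp : ∀ p, p.Prime → p ∣ M → p ≤ T 0)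
    (hM : DenseDivIn M u (Set.Ico (h : ℝ) (h * T m))) (I : ℕ)
    (hI : ∀ i < I, ∃ Q ⊆ primesIoc (T (i * m)) (T ((i + 1) * m)),
      R ≤ Q.card ∧ ∀ q ∈ Q, q ∣ L) :
    DenseDivIn L u (Set.Ico (h : ℝ) (h * T ((I + 1) * m))) := by
  suffices ∃ D, D ∣ L ∧ (∀ p, p.Prime → p ∣ D → p ≤ T (I * m)) ∧
      DenseDivIn D u (Set.Ico (h : ℝ) (h * T ((I + 1) * m))) by
    obtain ⟨D, h1, -, h2⟩ := this
    exact h2.mono h1 le_rfl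
  induction I with
  | zero => exact ⟨M, hML, by simpa using hMp, by simpa using hM⟩
  | succ I ih =>
    obtain ⟨D, hDL, hDp, hD⟩ := ih fun i hi => hI i (by omega)
    obtain ⟨Q, hQ, hQR, hQL⟩ := hI I (by omega)
    have hQp : ∀ q ∈ Q, q.Prime := fun q hq => (mem_primesIoc.1 (hQ hq)).2
    refine ⟨D * ∏ q ∈ Q, q, ?_, ?_, ?_⟩
    · apply Nat.Coprime.mul_dvd_of_dvd_of_dvd _ hDL ((prod_primes_dvd_iff Q hQp L).2 hQL)
      apply Nat.Coprime.prod_right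
      intro q hq
      rw [Nat.coprime_comm, (hQp q hq).coprime_iff_not_dvd]
      intro hqD
      have h1 := hDp q (hQp q hq) hqD
      have h2 := (mem_primesIoc.1 (hQ hq)).1.1
      omega
    · intro p hp hpD
      rcases (hp.dvd_mul).1 hpD with h1 | h1
      · exact (hDp p hp h1).trans (H.mono (Nat.mul_le_mul_right m (Nat.le_succ I)))
      · obtain ⟨q, hq, hpq⟩ := (hp.prime.dvd_finsetProd_iff _).1 h1
        rw [(Nat.prime_dvd_prime_iff_eq hp (hQp q hq)).1 hpq]
        exact (mem_primesIoc.1 (hQ hq)).1.2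
    · refine (hD.mul_prod (by positivity) Q fun q hq => ⟨(hQp q hq).pos, ?_⟩).mono dvd_rfl ?_
      · rw [mul_comm]
        have := (mem_primesIoc.1 (hQ hq)).1.2
        gcongr
      · apply Set.Ico_subset_Ico_right
        rw [mul_assoc]
        apply mul_le_mul_of_nonneg_left _ (by positivity)
        have h1 : T ((I + 1 + 1) * m) ≤ ∏ q ∈ Q, q := by
          have e : (I + 1 + 1) * m = I * m + 2 * m := by ring
          rw [e, H.pow_add]
          calc T (I * m) ^ A ^ (2 * m) ≤ T (I * m) ^ Q.card :=
                Nat.pow_le_pow_right (H.pos _) (hR.trans hQR)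
            _ ≤ _ := Finset.pow_card_le_prod _ _ _ fun q hq =>
                (mem_primesIoc.1 (hQ hq)).1.1.le
        have h2 : (T ((I + 1 + 1) * m) : ℝ) ≤ ∏ q ∈ Q, (q : ℝ) := by
          have := (Nat.cast_le (α := ℝ)).2 h1
          push_cast at this
          exact this
        have h3 : (1 : ℝ) ≤ T ((I + 1) * m) := by exact_mod_cast H.pos _
        refine h2.trans (le_mul_of_one_le_left (le_trans (by positivity) h2) h3)

/-! ### Divisors of the Carmichael function -/

lemma carmichael_dvd_totient {n : ℕ} (hn : 0 < n) : carmichael n ∣ n.totient := by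
  have : NeZero n := ⟨hn.ne'⟩
  rw [← ZMod.card_units_eq_totient n]
  exact Group.exponent_dvd_card

lemma sub_one_dvd_carmichael {n p : ℕ} (hn : 0 < n) (hp : p.Prime) (hpn : p ∣ n) :
    p - 1 ∣ carmichael n := by
  have : NeZero n := ⟨hn.ne'⟩
  have : Fact p.Prime := ⟨hp⟩
  have h1 := MonoidHom.exponent_dvd (ZMod.unitsMap_surjective hpn)
  rw [IsCyclic.exponent_eq_card, Nat.card_eq_fintype_card, ZMod.card_units_eq_totient,
    Nat.totient_prime hp] at h1
  exact h1

lemma HitBy.dvd_carmichael {n q : ℕ} (hn : 0 < n) (h : HitBy n q) : q ∣ carmichael n := by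
  obtain ⟨p, hp, hpn, hqp⟩ := h
  exact hqp.trans (sub_one_dvd_carmichael hn hp hpn)

/-! ### Prime factors congruent to `1` modulo a fixed integer -/

open ArithmeticFunction.vonMangoldt in
lemma not_summable_inv_primes_residueClass {q : ℕ} [NeZero q] {a : ZMod q} (ha : IsUnit a) :
    ¬ Summable fun n : ℕ => if n.Prime ∧ (n : ZMod q) = a then (n : ℝ)⁻¹ else 0 := by
  intro hs
  set f : ℕ → ℝ := fun n => if n.Prime ∧ (n : ZMod q) = a then (n : ℝ)⁻¹ else 0 with hf
  have hf0 : ∀ n, 0 ≤ f n := fun n => by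
    simp only [hf]
    split_ifs <;> positivity
  set c : ℝ := (q.totient : ℝ)⁻¹ with hc
  have hc0 : 0 < c := inv_pos.2 (by exact_mod_cast q.totient_pos.2 (NeZero.pos q))
  obtain ⟨C, hC⟩ := LSeries_residueClass_lower_bound ha
  have htail := (tendsto_order.1 (tendsto_tsum_compl_atTop_zero f)).2 (c / 2) (by positivity)
  obtain ⟨s, hst⟩ := htail.exists
  have hst' : ∑' n, (↑s : Set ℕ)ᶜ.indicator f n < c / 2 := by
    rw [← tsum_subtype]
    exact hst
  set np : ℕ → ℝ := fun n => (if n.Prime then 0 else residueClass a n) / n with hnp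
  have hnps : Summable np := summable_residueClass_non_primes_div a
  set head : ℕ → ℝ := fun n => if n ∈ s then residueClass a n / n else 0 with hhead
  have hheads : Summable head := summable_of_ne_finset_zero (s := s) fun n hn => if_neg hn
  have htls : Summable ((↑s : Set ℕ)ᶜ.indicator f) := hs.indicator _
  have hbound : ∀ σ : ℝ, 0 < σ → σ ≤ 1 → c / (2 * σ) ≤ C + ∑' n, np n + ∑' n, head n := by
    intro σ hσ hσ1
    have hterm : ∀ n : ℕ, residueClass a n / (n : ℝ) ^ (1 + σ) ≤
        np n + head n + σ⁻¹ * (↑s : Set ℕ)ᶜ.indicator f n := by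
      intro n
      have hra := residueClass_nonneg a n
      have hnp0 : 0 ≤ np n := by
        simp only [hnp]
        split_ifs <;> positivity
      have hhead0 : 0 ≤ head n := by
        simp only [hhead]
        split_ifs <;> positivity
      have htl0 : 0 ≤ σ⁻¹ * (↑s : Set ℕ)ᶜ.indicator f n :=
        mul_nonneg (by positivity) (Set.indicator_nonneg (fun i _ => hf0 i) n)
      rcases Nat.eq_zero_or_pos n with rfl | hn
      · rw [residueClass_apply_zero, zero_div]
        positivity
      have hn1 : (1 : ℝ) ≤ n := by exact_mod_cast hn
      have hn0 : (0 : ℝ) < n := by linarith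
      have hdiv : residueClass a n / (n : ℝ) ^ (1 + σ) ≤ residueClass a n / n := by
        gcongr
        calc (n : ℝ) = (n : ℝ) ^ (1 : ℝ) := (Real.rpow_one _).symm
          _ ≤ _ := Real.rpow_le_rpow_of_exponent_le hn1 (by linarith)
      by_cases hnpr : n.Prime
      · by_cases hns : n ∈ s
        · have e : head n = residueClass a n / n := if_pos hns
          linarith
        · have e : (↑s : Set ℕ)ᶜ.indicator f n = f n :=
            Set.indicator_of_mem (by simpa using hns) _
          suffices h : residueClass a n / (n : ℝ) ^ (1 + σ) ≤ σ⁻¹ * f n by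
            rw [e] at htl0 ⊢
            linarith
          by_cases hna : (n : ZMod q) = a
          · have e1 : residueClass a n = Real.log n := by
              rw [residueClass, Set.indicator_of_mem (by exact hna),
                ArithmeticFunction.vonMangoldt_apply_prime hnpr]
            have e2 : f n = (n : ℝ)⁻¹ := if_pos ⟨hnpr, hna⟩
            rw [e1, e2, Real.rpow_add hn0, Real.rpow_one]
            have hpσ : (0 : ℝ) < (n : ℝ) ^ σ := Real.rpow_pos_of_pos hn0 σ
            have hl := Real.log_le_rpow_div hn0.le hσ
            rw [div_le_iff₀ (by positivity)]
            refine hl.trans (le_of_eq ?_)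
            field_simp
          · have e1 : residueClass a n = 0 := by
              rw [residueClass, Set.indicator_of_notMem (by exact hna)]
            rw [e1, zero_div]
            exact mul_nonneg (by positivity) (hf0 n)
      · have e : np n = residueClass a n / n := by
          simp only [hnp]
          rw [if_neg hnpr]
        linarith
    have hBs : Summable fun n => np n + head n + σ⁻¹ * (↑s : Set ℕ)ᶜ.indicator f n :=
      (hnps.add hheads).add (htls.mul_left _)
    have hAs : Summable fun n : ℕ => residueClass a n / (n : ℝ) ^ (1 + σ) :=
      Summable.of_nonneg_of_le (fun n => by
        have := residueClass_nonneg a n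
        positivity) hterm hBs
    have h1 := hAs.tsum_le_tsum hterm hBs
    rw [(hnps.add hheads).tsum_add (htls.mul_left _), hnps.tsum_add hheads, tsum_mul_left] at h1
    have h2 := hC (x := 1 + σ) ⟨by linarith, by linarith⟩
    rw [add_sub_cancel_left] at h2
    have h3 : σ⁻¹ * ∑' n, (↑s : Set ℕ)ᶜ.indicator f n ≤ σ⁻¹ * (c / 2) := by gcongr
    have h4 : σ⁻¹ * (c / 2) = c / (2 * σ) := by field_simp
    have h5 : c / σ = c / (2 * σ) + c / (2 * σ) := by
      field_simp
      ring
    linarith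
  set D := C + ∑' n, np n + ∑' n, head n
  have hD : 0 < |D| + 1 := by positivity
  have hσ : 0 < min 1 (c / (2 * (|D| + 1))) := lt_min one_pos (by positivity)
  have h1 := hbound _ hσ (min_le_left _ _)
  have h2 : |D| + 1 ≤ c / (2 * min 1 (c / (2 * (|D| + 1)))) := by
    rw [le_div_iff₀ (by positivity)]
    have h3 : min 1 (c / (2 * (|D| + 1))) ≤ c / (2 * (|D| + 1)) := min_le_right _ _
    rw [le_div_iff₀ (by positivity)] at h3
    linarith
  linarith [le_abs_self D]

lemma exists_sum_inv_primes_one_mod_ge (M : ℕ) (hM : 0 < M) (K : ℝ) :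
    ∃ Z, K ≤ ∑ p ∈ primesIoc 0 Z with M ∣ p - 1, (p : ℝ)⁻¹ := by
  have : NeZero M := ⟨hM.ne'⟩
  have h := not_summable_inv_primes_residueClass (q := M) (a := 1) isUnit_one
  rw [not_summable_iff_tendsto_nat_atTop_of_nonneg (fun n => by split_ifs <;> positivity)] at h
  obtain ⟨Z, hZ⟩ := (h.eventually_ge_atTop K).exists
  refine ⟨Z, hZ.trans ?_⟩
  rw [← Finset.sum_filter]
  apply Finset.sum_le_sum_of_subset_of_nonneg
  · intro p hp
    rw [Finset.mem_filter, Finset.mem_range] at hp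
    obtain ⟨hpZ, hpp, hp1⟩ := hp
    rw [Finset.mem_filter, mem_primesIoc]
    refine ⟨⟨⟨hpp.pos, hpZ.le⟩, hpp⟩, ?_⟩
    rw [← Nat.modEq_iff_dvd' hpp.one_le, ← ZMod.natCast_eq_natCast_iff]
    simp [hp1]
  · intro p _ _
    positivity

lemma exists_card_not_hitBy_le (M : ℕ) (hM : 0 < M) (ε : ℝ) (hε : 0 < ε) :
    ∃ C : ℝ, ∀ N : ℕ, (((Finset.Icc 1 N).filter (fun n => ¬ HitBy n M)).card : ℝ) ≤
      ε * N + C := by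
  obtain ⟨Z, hZ⟩ := exists_sum_inv_primes_one_mod_ge M hM (2 + 2 / ε)
  set P := (primesIoc 0 Z).filter (fun p => M ∣ p - 1) with hP
  refine ⟨((Z + 1 : ℕ) : ℝ) ^ 8, fun N => ?_⟩
  have hε' : 0 < 1 / ε := by positivity
  have e2 : 2 / ε = 2 * (1 / ε) := by ring
  have key := card_not_dvd_primes_le P (Z + 1) N
    (fun p hp => (mem_primesIoc.1 (Finset.mem_filter.1 hp).1).2)
    (fun p hp => (mem_primesIoc.1 (Finset.mem_filter.1 hp).1).1.2.trans (Nat.le_succ Z))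
    (by omega) (1 / ε) (by positivity) (by rw [e2] at hZ; nlinarith)
  have e : (N : ℝ) / (1 / ε) = ε * N := by
    field_simp
  rw [e] at key
  refine le_trans ?_ key
  have hsub : (Finset.Icc 1 N).filter (fun n => ¬ HitBy n M) ⊆
      (Finset.Icc 1 N).filter (fun n => ∀ p ∈ P, ¬ p ∣ n) := by
    intro n hn
    rw [Finset.mem_filter] at hn ⊢
    refine ⟨hn.1, fun p hp hpn => hn.2 ?_⟩
    rw [hP, Finset.mem_filter, mem_primesIoc] at hp
    exact ⟨p, hp.1.2, hpn, hp.2⟩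
  exact_mod_cast Finset.card_le_card hsub

/-! ### The main theorem -/

lemma exists_primeBlocks : ∃ A, ∀ B, ∃ T, PrimeBlocks A T ∧ B ≤ T 0 := by
  refine ⟨2 ^ 16, fun B => ⟨fun a => 4 ^ ((B + 7) * (2 ^ 16) ^ a), ⟨by norm_num, ?_, ?_, ?_⟩, ?_⟩⟩
  · exact Nat.le_self_pow (by positivity) 4
  · intro a
    rw [pow_succ (2 ^ 16) a, ← mul_assoc, pow_mul 4]
  · intro a
    have h1 : 1 ≤ (2 ^ 16) ^ a := Nat.one_le_pow _ _ (by norm_num)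
    have h := one_le_sum_inv_primes ((B + 7) * (2 ^ 16) ^ a) (by nlinarith)
    have e : 2 ^ 16 * ((B + 7) * (2 ^ 16) ^ a) = (B + 7) * (2 ^ 16) ^ (a + 1) := by
      rw [pow_succ]
      ring
    rwa [e] at h
  · dsimp only
    rw [pow_zero, mul_one]
    exact (Nat.lt_pow_self (by norm_num : 1 < 4)).le.trans
      (Nat.pow_le_pow_right (by norm_num) (Nat.le_add_right B 7))

lemma PrimeBlocks.lt_self {A : ℕ} {T : ℕ → ℕ} (H : PrimeBlocks A T) (b : ℕ) : b < T b := by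
  induction b with
  | zero => exact H.pos 0
  | succ b ih =>
    have h1 : T b ^ 2 ≤ T (b + 1) := by
      rw [H.hpow]
      exact Nat.pow_le_pow_right (H.pos b) (by have := H.hA; omega)
    have h2 : 4 ≤ T b := H.h0.trans (H.mono (Nat.zero_le b))
    nlinarith

lemma PrimeBlocks.exists_le_lt {A : ℕ} {T : ℕ → ℕ} (H : PrimeBlocks A T) (b₀ : ℕ) {x : ℝ}
    (hx : (T (b₀ + 2) : ℝ) ≤ x) : ∃ b, b₀ ≤ b ∧ (T (b + 1) : ℝ) ≤ x ∧ x < T (b + 2) := by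
  have hex : ∃ b, x < T (b + 2) := by
    obtain ⟨k, hk⟩ := exists_nat_gt x
    refine ⟨k, hk.trans ?_⟩
    exact_mod_cast (by omega : k < k + 2).trans (H.lt_self _)
  have hmin : ∀ b, b ≤ b₀ → ¬ x < T (b + 2) := by
    intro b hb hlt
    have : (T (b + 2) : ℝ) ≤ T (b₀ + 2) := by exact_mod_cast H.mono (by omega)
    linarith
  have hlt : b₀ < Nat.find hex := by
    by_contra hcon
    exact hmin _ (not_lt.1 hcon) (Nat.find_spec hex)
  obtain ⟨c, hc⟩ := Nat.exists_eq_succ_of_ne_zero (by omega : Nat.find hex ≠ 0)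
  refine ⟨Nat.find hex, hlt.le, ?_, Nat.find_spec hex⟩
  have := Nat.find_min hex (by omega : c < Nat.find hex)
  rw [hc]
  exact not_lt.1 this

lemma exists_card_not_denseDivIn_le (h : ℕ) (hh : 0 < h) (ε : ℝ) (hε : 0 < ε) :
    ∃ δ > 0, ∃ x₀ : ℝ, ∀ x ≥ x₀, ∀ θ : ℝ, 0 < θ → θ ≤ δ →
      (((Finset.Icc 1 ⌊x⌋₊).filter (fun n =>
        ¬ DenseDivIn (carmichael n) (1 + 1 / h) (Set.Icc (h : ℝ) (x ^ θ)))).card : ℝ) ≤ ε * x := by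
  obtain ⟨A, hA⟩ := exists_primeBlocks
  set m := 64 * A ^ 3 with hm
  set R := A ^ (2 * m) + 1 with hR
  obtain ⟨T, H, hT0⟩ := hA (4 ^ R + 4 * R + 2 * h)
  obtain ⟨h4R, hRT, h2T⟩ : 4 ^ R ≤ T 0 ∧ 4 * R ≤ T 0 ∧ 2 * h ≤ T 0 := by
    generalize 4 ^ R = r at hT0
    omega
  have hm0 : 0 < m := by
    have := H.hA
    positivity
  have hh1 : (1 : ℝ) ≤ h := by exact_mod_cast hh
  set M := (2 * h).factorial * 2 ^ T m with hM
  have hM0 : 0 < M := by positivity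
  have hMp : ∀ p, p.Prime → p ∣ M → p ≤ T 0 := by
    intro p hp hpM
    have h2 : p ≤ 2 * h := by
      rcases hp.dvd_mul.1 hpM with h1 | h1
      · exact hp.dvd_factorial.1 h1
      · have := Nat.le_of_dvd (by norm_num) (hp.dvd_of_dvd_pow h1)
        omega
    omega
  have hMd : DenseDivIn M (1 + 1 / h) (Set.Ico (h : ℝ) (h * T m)) := by
    refine (denseDivIn_factorial_mul_two_pow h hh (T m)).mono dvd_rfl (Set.Ico_subset_Ico_right ?_)
    have h1 : (T m : ℝ) ≤ 2 ^ T m := by exact_mod_cast Nat.lt_two_pow_self.le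
    have h2 : (h : ℝ) * T m ≤ h * 2 ^ T m := by gcongr
    have h3 : (0 : ℝ) ≤ h * 2 ^ T m := by positivity
    linarith
  obtain ⟨C, hC⟩ := exists_card_not_hitBy_le M hM0 (ε / 4) (by positivity)
  obtain ⟨k, hk⟩ := exists_nat_gt (4 + 64 * 4 ^ R / ε)
  have hk0 : (4 : ℝ) < k := lt_of_le_of_lt (le_add_of_nonneg_right (by positivity)) hk
  have hk4 : 4 ≤ k := by exact_mod_cast hk0.le
  have hkε : 64 * 4 ^ R ≤ ε * ((k : ℝ) - 1) := by
    have : 64 * 4 ^ R / ε ≤ (k : ℝ) - 1 := by linarith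
    rw [div_le_iff₀ hε] at this
    linarith
  obtain ⟨b₁, hb₁⟩ := exists_nat_gt (4 / ε)
  refine ⟨1 / (A : ℝ) ^ (k + 3), by have := H.hA; positivity,
    max (T (k + 2 + b₁ + 2)) (4 * C / ε), fun x hx θ hθ0 hθ => ?_⟩
  obtain ⟨b, hb, hbx, hxb⟩ := H.exists_le_lt (k + 2 + b₁) ((le_max_left _ _).trans hx)
  have hx0 : 0 < x := lt_of_lt_of_le (by exact_mod_cast H.pos _) hbx
  have hN : ((⌊x⌋₊ : ℕ) : ℝ) ≤ x := Nat.floor_le hx0.le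
  have hCx : C ≤ ε / 4 * x := by
    have := (le_max_right _ _).trans hx
    rw [div_le_iff₀ hε] at this
    linarith
  set N := ⌊x⌋₊
  set I := (b - 2 - k) / m with hI
  have hIm : I * m ≤ b - 2 - k := Nat.div_mul_le_self _ _
  have hIm' : b - 2 - k < (I + 1) * m := by
    have := Nat.lt_div_mul_add (a := b - 2 - k) hm0
    rw [add_mul, one_mul]
    exact this
  have hbad := H.card_exists_window_few_hits_le m R I b k N le_rfl hk4 (by omega)
    (Nat.succ_pos _) hRT
  set bad₁ := (Finset.Icc 1 N).filter (fun n => ∃ i < I,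
    ((primesIoc (T (i * m)) (T ((i + 1) * m))).filter (HitBy n)).card < R)
  set bad₂ := (Finset.Icc 1 N).filter (fun n => ¬ HitBy n M)
  have hxθ : x ^ θ < h * T ((I + 1) * m) := by
    have hTpos : (1 : ℝ) ≤ T ((I + 1) * m) := by exact_mod_cast H.pos _
    have hA0 : (0 : ℝ) < (A : ℝ) ^ (k + 3) := by have := H.hA; positivity
    have h1 : x < (T ((I + 1) * m) : ℝ) ^ (A ^ (k + 3)) := by
      refine hxb.trans_le ?_
      have : T (b + 2) ≤ T ((I + 1) * m) ^ (A ^ (k + 3)) := by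
        rw [← H.pow_add]
        exact H.mono (by omega)
      exact_mod_cast this
    calc x ^ θ < ((T ((I + 1) * m) : ℝ) ^ (A ^ (k + 3))) ^ θ :=
          Real.rpow_lt_rpow hx0.le h1 hθ0
      _ = (T ((I + 1) * m) : ℝ) ^ (((A ^ (k + 3) : ℕ) : ℝ) * θ) := by
          rw [← Real.rpow_natCast, ← Real.rpow_mul (by linarith)]
      _ ≤ (T ((I + 1) * m) : ℝ) ^ (1 : ℝ) := by
          apply Real.rpow_le_rpow_of_exponent_le hTpos
          push_cast
          rw [le_div_iff₀ hA0] at hθ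
          linarith
      _ = T ((I + 1) * m) := Real.rpow_one _
      _ ≤ h * T ((I + 1) * m) := le_mul_of_one_le_left (by linarith) hh1
  have hsub : (Finset.Icc 1 N).filter (fun n =>
      ¬ DenseDivIn (carmichael n) (1 + 1 / h) (Set.Icc (h : ℝ) (x ^ θ))) ⊆ bad₁ ∪ bad₂ := by
    intro n hn
    rw [Finset.mem_filter] at hn
    obtain ⟨hn, hnd⟩ := hn
    have hn1 : 0 < n := (Finset.mem_Icc.1 hn).1
    by_contra hcon
    rw [Finset.mem_union, not_or, Finset.mem_filter, Finset.mem_filter] at hcon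
    obtain ⟨hcon₁, hcon₂⟩ := hcon
    have hhit : HitBy n M := by
      by_contra hc
      exact hcon₂ ⟨hn, hc⟩
    have hwin : ∀ i < I,
        R ≤ ((primesIoc (T (i * m)) (T ((i + 1) * m))).filter (HitBy n)).card := by
      intro i hi
      by_contra hc
      exact hcon₁ ⟨hn, i, hi, not_le.1 hc⟩
    refine hnd ((H.denseDivIn (R := R) (h := h) (u := 1 + 1 / h) (Nat.le_succ _)
      (hhit.dvd_carmichael hn1) hMp hMd I fun i hi => ⟨_, Finset.filter_subset _ _, hwin i hi,
        fun q hq => (Finset.mem_filter.1 hq).2.dvd_carmichael hn1⟩).mono dvd_rfl ?_)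
    exact fun y hy => ⟨hy.1, hy.2.trans_lt hxθ⟩
  have hb₂ : 4 ^ R * (16 * (N : ℝ) / (k - 1)) ≤ ε / 4 * x := by
    have hk1 : (0 : ℝ) < (k : ℝ) - 1 := by linarith
    rw [← mul_div_assoc, div_le_iff₀ hk1]
    have h4 : (0 : ℝ) < 4 ^ R := by positivity
    calc 4 ^ R * (16 * (N : ℝ)) ≤ 4 ^ R * (16 * x) := by gcongr
      _ = (64 * 4 ^ R) * (x / 4) := by ring
      _ ≤ (ε * ((k : ℝ) - 1)) * (x / 4) := by gcongr
      _ = _ := by ring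
  have hb₃ : 4 ^ R * (I * (T b : ℝ) ^ 8) ≤ ε / 4 * x := by
    have hTb : 0 < T b := H.pos b
    have hTb0 : (1 : ℝ) ≤ T b := by exact_mod_cast hTb
    have h1 : (4 : ℝ) ^ R ≤ T b := by
      exact_mod_cast h4R.trans (H.mono (Nat.zero_le b))
    have h2 : (I : ℝ) ≤ T b := by
      have h3 : I ≤ b - 2 - k := Nat.div_le_self _ _
      have h4 := H.lt_self b
      exact_mod_cast (by omega : I ≤ T b)
    have h5 : (T b : ℝ) ^ 16 ≤ x := by
      refine le_trans ?_ hbx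
      have : T b ^ 16 ≤ T (b + 1) := by
        rw [H.hpow]
        exact Nat.pow_le_pow_right hTb H.hA
      exact_mod_cast this
    have h6 : 4 / ε ≤ T b := by
      refine hb₁.le.trans ?_
      have h4 := H.lt_self b
      exact_mod_cast (by omega : b₁ ≤ T b)
    rw [div_le_iff₀ hε] at h6
    calc 4 ^ R * (I * (T b : ℝ) ^ 8) ≤ T b * (T b * (T b : ℝ) ^ 8) := by gcongr
      _ = (T b : ℝ) ^ 10 := by ring
      _ ≤ (T b : ℝ) ^ 15 := pow_le_pow_right₀ hTb0 (by norm_num)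
      _ ≤ (T b * ε / 4) * (T b : ℝ) ^ 15 := le_mul_of_one_le_left (by positivity) (by linarith)
      _ = ε / 4 * (T b : ℝ) ^ 16 := by ring
      _ ≤ _ := by gcongr
  calc _ ≤ ((bad₁ ∪ bad₂).card : ℝ) := by exact_mod_cast Finset.card_le_card hsub
    _ ≤ bad₁.card + bad₂.card := by exact_mod_cast Finset.card_union_le _ _
    _ ≤ 4 ^ R * (16 * N / (k - 1) + I * (T b : ℝ) ^ 8) + (ε / 4 * N + C) :=
        add_le_add hbad (hC N)
    _ = 4 ^ R * (16 * (N : ℝ) / (k - 1)) + 4 ^ R * (I * (T b : ℝ) ^ 8) + (ε / 4 * N + C) := by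
        rw [mul_add]
    _ ≤ ε / 4 * x + ε / 4 * x + (ε / 4 * x + ε / 4 * x) := by gcongr
    _ = ε * x := by ring

theorem stmt_9 (g : ℝ → ℝ) (hgpos : ∀ x, 0 < g x) (hmono : Antitone g)
    (hg0 : Tendsto g atTop (nhds 0)) (h : ℕ) (hh : 0 < h) :
    Tendsto (fun x : ℝ =>
      (((Finset.Icc 1 ⌊x⌋₊).filter
        (fun n => DenseDivIn (Nat.totient n) (1 + 1 / h) (Set.Icc (h : ℝ) (x ^ g x)) ∧
                  DenseDivIn (carmichael n) (1 + 1 / h) (Set.Icc (h : ℝ) (x ^ g x)))).card : ℝ) / x)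
      atTop (nhds 1) := by
  rw [tendsto_order]
  constructor
  · intro a ha
    obtain ⟨δ, hδ, x₀, hx₀⟩ := exists_card_not_denseDivIn_le h hh ((1 - a) / 2) (by linarith)
    filter_upwards [eventually_ge_atTop x₀, hg0.eventually (eventually_le_nhds hδ),
      eventually_gt_atTop 0, eventually_gt_atTop (2 / (1 - a))] with x hx hgx hxpos hxa
    have hbad := hx₀ x hx (g x) (hgpos x) hgx
    set N := ⌊x⌋₊ with hN
    have hsplit := Finset.card_filter_add_card_filter_not (s := Finset.Icc 1 N)
      (fun n => DenseDivIn (carmichael n) (1 + 1 / h) (Set.Icc (h : ℝ) (x ^ g x)))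
    rw [Nat.card_Icc, Nat.add_sub_cancel] at hsplit
    have hgood : (Finset.Icc 1 N).filter
        (fun n => DenseDivIn (carmichael n) (1 + 1 / h) (Set.Icc (h : ℝ) (x ^ g x))) ⊆
        (Finset.Icc 1 N).filter
        (fun n => DenseDivIn (Nat.totient n) (1 + 1 / h) (Set.Icc (h : ℝ) (x ^ g x)) ∧
          DenseDivIn (carmichael n) (1 + 1 / h) (Set.Icc (h : ℝ) (x ^ g x))) := by
      intro n hn
      rw [Finset.mem_filter] at hn ⊢
      exact ⟨hn.1, hn.2.mono (carmichael_dvd_totient (Finset.mem_Icc.1 hn.1).1) le_rfl, hn.2⟩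
    have hcard := (Nat.cast_le (α := ℝ)).2 (Finset.card_le_card hgood)
    have hsplit' := congrArg (Nat.cast (R := ℝ)) hsplit
    rw [Nat.cast_add] at hsplit'
    have hfl : x < N + 1 := Nat.lt_floor_add_one x
    have h1a : 0 < 1 - a := by linarith
    rw [div_lt_iff₀ h1a] at hxa
    rw [lt_div_iff₀ hxpos]
    linarith
  · intro a ha
    filter_upwards [eventually_gt_atTop 0] with x hx
    refine lt_of_le_of_lt ?_ ha
    rw [div_le_one hx]
    refine le_trans ?_ (Nat.floor_le hx.le)
    refine Nat.cast_le.2 ((Finset.card_filter_le _ _).trans (le_of_eq ?_))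
    rw [Nat.card_Icc, Nat.add_sub_cancel]
end

section
/- Let g(x) → 0 monotonically as x → ∞. Then for 1 ≤ y ≤ x^{g(x)}, the number of n ≤ x such that φ(n) has a divisor in (y, 2y] is (1+o(1))x as x → ∞. -/
open scoped Classical

open Filter

namespace TotientDivisors

theorem sum_range_mul_of_coprime {N M : ℕ} (h : N.Coprime M) {a b : ℕ → ℝ}
    (ha : ∀ m, a (m % N) = a m) (hb : ∀ m, b (m % M) = b m) :
    ∑ m ∈ Finset.range (N * M), a m * b m
      = (∑ m ∈ Finset.range N, a m) * ∑ m ∈ Finset.range M, b m := by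
  rw [Finset.sum_mul_sum, ← Finset.sum_product']
  rcases Nat.eq_zero_or_pos N with rfl | hN
  · simp
  rcases Nat.eq_zero_or_pos M with rfl | hM
  · simp
  refine Finset.sum_nbij' (fun m => (m % N, m % M))
    (fun p => (Nat.chineseRemainder h p.1 p.2 : ℕ)) ?_ ?_ ?_ ?_ ?_
  · intro m _
    simp [Nat.mod_lt _ hN, Nat.mod_lt _ hM]
  · intro p _
    exact Finset.mem_range.2 (Nat.chineseRemainder_lt_mul h _ _ hN.ne' hM.ne')
  · intro m hm
    have hm' := Finset.mem_range.1 hm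
    refine Nat.ModEq.eq_of_lt_of_lt ?_ (Nat.chineseRemainder_lt_mul h _ _ hN.ne' hM.ne') hm'
    refine (Nat.modEq_and_modEq_iff_modEq_mul h).1 ⟨?_, ?_⟩
    · exact (Nat.chineseRemainder h (m % N) (m % M)).2.1.trans (Nat.mod_modEq _ _)
    · exact (Nat.chineseRemainder h (m % N) (m % M)).2.2.trans (Nat.mod_modEq _ _)
  · rintro ⟨u, v⟩ hp
    simp only [Finset.mem_product, Finset.mem_range] at hp
    have h1 := (Nat.chineseRemainder h u v).2.1
    have h2 := (Nat.chineseRemainder h u v).2.2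
    unfold Nat.ModEq at h1 h2
    simp only [Prod.mk.injEq]
    exact ⟨h1.trans (Nat.mod_eq_of_lt hp.1), h2.trans (Nat.mod_eq_of_lt hp.2)⟩
  · intro m _
    simp [ha, hb]

theorem prod_mod_eq {R : Finset ℕ} {F : ℕ → ℕ → ℝ} (hF : ∀ p m, F p (m % p) = F p m)
    {N : ℕ} (hN : ∀ p ∈ R, p ∣ N) (m : ℕ) :
    ∏ p ∈ R, F p (m % N) = ∏ p ∈ R, F p m := by
  refine Finset.prod_congr rfl fun p hp => ?_
  rw [← hF p (m % N), Nat.mod_mod_of_dvd _ (hN p hp), hF]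

theorem sum_range_prod_eq_prod_sum {R : Finset ℕ} (hR : ∀ p ∈ R, p.Prime) {F : ℕ → ℕ → ℝ}
    (hF : ∀ p m, F p (m % p) = F p m) :
    ∑ m ∈ Finset.range (∏ p ∈ R, p), ∏ p ∈ R, F p m
      = ∏ p ∈ R, ∑ m ∈ Finset.range p, F p m := by
  induction R using Finset.induction_on with
  | empty => simp
  | insert p R hp ih =>
    have hR' : ∀ q ∈ R, q.Prime := fun q hq => hR q (Finset.mem_insert_of_mem hq)
    simp only [Finset.prod_insert hp]
    rw [sum_range_mul_of_coprime _ (hF p), ih hR']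
    · exact fun m => prod_mod_eq hF (fun q hq => Finset.dvd_prod_of_mem _ hq) m
    · refine Nat.Coprime.prod_right fun q hq => ?_
      refine (Nat.coprime_primes (hR p (Finset.mem_insert_self _ _)) (hR' q hq)).2 ?_
      rintro rfl
      exact hp hq

theorem sum_range_le_of_periodic {N : ℕ} (hN : 0 < N) {G : ℕ → ℝ} (hG : ∀ m, G (m % N) = G m)
    (hG1 : ∀ m, G m ≤ 1) (hS : 0 ≤ ∑ m ∈ Finset.range N, G m) (X : ℕ) :
    ∑ m ∈ Finset.range X, G m ≤ X / N * (∑ m ∈ Finset.range N, G m) + N := by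
  induction X using Nat.strong_induction_on with
  | _ X ih =>
    by_cases h : X < N
    · calc ∑ m ∈ Finset.range X, G m ≤ ∑ m ∈ Finset.range X, (1 : ℝ) :=
            Finset.sum_le_sum fun m _ => hG1 m
        _ = X := by simp
        _ ≤ N := by exact_mod_cast h.le
        _ ≤ _ := le_add_of_nonneg_left (by positivity)
    · push Not at h
      obtain ⟨Y, rfl⟩ := Nat.exists_eq_add_of_le h
      rw [Finset.sum_range_add]
      have h1 : ∑ m ∈ Finset.range Y, G (N + m) = ∑ m ∈ Finset.range Y, G m :=
        Finset.sum_congr rfl fun m _ => by rw [← hG (N + m), Nat.add_mod_left, hG]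
      have h2 := ih Y (by omega)
      have hN' : (N : ℝ) ≠ 0 := by positivity
      rw [h1]
      push_cast
      rw [add_div, div_self hN', add_mul, one_mul]
      linarith

/-- An abstract form of Selberg's upper bound sieve. -/
theorem selberg_sieve {ε : ℕ → ℕ → ℝ} {h : ℕ → ℝ} (hper : ∀ p m, ε p (m % p) = ε p m)
    (hzero : ∀ p : ℕ, p.Prime → ∑ m ∈ Finset.range p, ε p m = 0)
    (hsq : ∀ p : ℕ, p.Prime → ∑ m ∈ Finset.range p, ε p m ^ 2 = p * h p)
    (hle : ∀ p : ℕ, p.Prime → ∀ m, |ε p m| ≤ 1) (hh : ∀ p : ℕ, p.Prime → 0 ≤ h p)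
    (z X : ℕ) (hz : 1 ≤ z) :
    (((Finset.range X).filter
      (fun m => ∀ p : ℕ, p.Prime → p ≤ z → ε p m = h p)).card : ℝ) ≤
      X / (∑ d ∈ (Finset.Icc 1 z).filter Squarefree, ∏ p ∈ d.primeFactors, h p) + z ^ 4 := by
  set D := (Finset.Icc 1 z).filter Squarefree with hD
  set H : ℕ → ℝ := fun d => ∏ p ∈ d.primeFactors, h p with hH
  set L := ∑ d ∈ D, H d with hL
  set ψ : ℕ → ℕ → ℝ := fun d m => ∏ p ∈ d.primeFactors, ε p m with hψ
  set A := (Finset.range X).filter (fun m => ∀ p : ℕ, p.Prime → p ≤ z → ε p m = h p) with hA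
  have hDmem : ∀ d ∈ D, 1 ≤ d ∧ d ≤ z ∧ Squarefree d := by
    intro d hd
    simp only [hD, Finset.mem_filter, Finset.mem_Icc] at hd
    tauto
  have hH0 : ∀ d, 0 ≤ H d := fun d =>
    Finset.prod_nonneg fun p hp => hh p (Nat.prime_of_mem_primeFactors hp)
  have hL1 : 1 ≤ L := by
    have h1 : (1 : ℕ) ∈ D := by simp [hD, hz]
    calc (1 : ℝ) = H 1 := by simp [hH]
      _ ≤ L := Finset.single_le_sum (fun d _ => hH0 d) h1
  have key : ∀ d ∈ D, ∀ e ∈ D, ∑ m ∈ Finset.range X, ψ d m * ψ e m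
      ≤ (if d = e then X * H d else 0) + (z : ℝ) ^ 2 := by
    intro d hd e he
    obtain ⟨hd1, hdz, hds⟩ := hDmem d hd
    obtain ⟨he1, hez, hes⟩ := hDmem e he
    set R := d.primeFactors ∪ e.primeFactors with hR
    have hRp : ∀ p ∈ R, p.Prime := by
      intro p hp
      rcases Finset.mem_union.1 hp with hp | hp <;> exact Nat.prime_of_mem_primeFactors hp
    set F : ℕ → ℕ → ℝ := fun p m => (if p ∈ d.primeFactors then ε p m else 1) *
      (if p ∈ e.primeFactors then ε p m else 1) with hF
    have hFper : ∀ p m, F p (m % p) = F p m := fun p m => by simp only [hF, hper]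
    have hprod : ∀ m, ψ d m * ψ e m = ∏ p ∈ R, F p m := by
      intro m
      simp only [hF, Finset.prod_mul_distrib, Finset.prod_ite_mem, hψ, hR,
        Finset.union_inter_cancel_left, Finset.union_inter_cancel_right]
    have hRpos : 0 < ∏ p ∈ R, p := Finset.prod_pos fun p hp => (hRp p hp).pos
    have hRle : ((∏ p ∈ R, p : ℕ) : ℝ) ≤ (z : ℝ) ^ 2 := by
      have h1 : (∏ p ∈ R, p) ≤ d * e := by
        refine Nat.le_of_dvd (by positivity) ?_
        have h2 := Finset.prod_union_inter (s₁ := d.primeFactors) (s₂ := e.primeFactors)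
          (f := fun p => p)
        rw [Nat.prod_primeFactors_of_squarefree hds, Nat.prod_primeFactors_of_squarefree hes] at h2
        exact ⟨_, h2.symm⟩
      calc ((∏ p ∈ R, p : ℕ) : ℝ) ≤ ((d * e : ℕ) : ℝ) := by exact_mod_cast h1
        _ = (d : ℝ) * e := by push_cast; ring
        _ ≤ (z : ℝ) * z := by gcongr
        _ = _ := by ring
    have hsum : ∑ m ∈ Finset.range (∏ p ∈ R, p), ∏ p ∈ R, F p m
        = if d = e then (∏ p ∈ R, p : ℕ) * H d else 0 := by
      rw [sum_range_prod_eq_prod_sum hRp hFper]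
      split_ifs with hde
      · subst hde
        have hR' : R = d.primeFactors := by simp [hR]
        rw [hR', hH]
        push_cast
        rw [← Finset.prod_mul_distrib]
        refine Finset.prod_congr rfl fun p hp => ?_
        rw [← hsq p (Nat.prime_of_mem_primeFactors hp)]
        simp only [hF, if_pos hp]
        exact Finset.sum_congr rfl fun m _ => by ring
      · have hne : d.primeFactors ≠ e.primeFactors := by
          intro hc
          apply hde
          rw [← Nat.prod_primeFactors_of_squarefree hds, hc,
            Nat.prod_primeFactors_of_squarefree hes]
        obtain ⟨p, hp⟩ : ∃ p, ¬ (p ∈ d.primeFactors ↔ p ∈ e.primeFactors) := by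
          by_contra! hc
          exact hne (Finset.ext hc)
        have hpR : p ∈ R := by
          simp only [hR, Finset.mem_union]
          tauto
        refine Finset.prod_eq_zero hpR ?_
        rw [← hzero p (hRp p hpR)]
        refine Finset.sum_congr rfl fun m _ => ?_
        simp only [hF]
        by_cases h1 : p ∈ d.primeFactors
        · have h2 : p ∉ e.primeFactors := fun h2 => hp ⟨fun _ => h2, fun _ => h1⟩
          rw [if_pos h1, if_neg h2, mul_one]
        · have h2 : p ∈ e.primeFactors := by
            by_contra h2
            exact hp ⟨fun h => absurd h h1, fun h => absurd h h2⟩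
          rw [if_neg h1, if_pos h2, one_mul]
    have h1 := sum_range_le_of_periodic hRpos (G := fun m => ∏ p ∈ R, F p m)
      (fun m => prod_mod_eq hFper (fun q hq => Finset.dvd_prod_of_mem _ hq) m) ?_ ?_ X
    · simp only [hprod]
      refine h1.trans ?_
      rw [hsum]
      refine add_le_add ?_ hRle
      have hR0 : ((∏ p ∈ R, p : ℕ) : ℝ) ≠ 0 := by exact_mod_cast hRpos.ne'
      split_ifs
      · rw [← mul_assoc, div_mul_cancel₀ _ hR0]
      · simp
    · intro m
      refine (le_abs_self _).trans ?_
      rw [Finset.abs_prod]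
      refine Finset.prod_le_one (fun _ _ => abs_nonneg _) fun p hp => ?_
      have := hle p (hRp p hp) m
      simp only [hF, abs_mul]
      refine mul_le_one₀ ?_ (abs_nonneg _) ?_ <;> split_ifs <;> simp [this]
    · rw [hsum]
      split_ifs
      · exact mul_nonneg (by positivity) (hH0 d)
      · exact le_rfl
  have hcardD : (D.card : ℝ) ≤ z := by
    have : D.card ≤ (Finset.Icc 1 z).card := Finset.card_filter_le _ _
    simp only [Nat.card_Icc, Nat.add_sub_cancel] at this
    exact_mod_cast this
  have hsq_sum : ∑ m ∈ Finset.range X, (∑ d ∈ D, ψ d m) ^ 2 ≤ X * L + (z : ℝ) ^ 4 := by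
    calc ∑ m ∈ Finset.range X, (∑ d ∈ D, ψ d m) ^ 2
        = ∑ d ∈ D, ∑ e ∈ D, ∑ m ∈ Finset.range X, ψ d m * ψ e m := by
          simp only [sq, Finset.sum_mul_sum]
          rw [Finset.sum_comm]
          exact Finset.sum_congr rfl fun d _ => Finset.sum_comm
      _ ≤ ∑ d ∈ D, ∑ e ∈ D, ((if d = e then X * H d else 0) + (z : ℝ) ^ 2) :=
          Finset.sum_le_sum fun d hd => Finset.sum_le_sum fun e he => key d hd e he
      _ = X * L + D.card * (D.card * (z : ℝ) ^ 2) := by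
          simp only [Finset.sum_add_distrib, Finset.sum_const, nsmul_eq_mul]
          congr 1
          rw [hL, Finset.mul_sum]
          refine Finset.sum_congr rfl fun d hd => ?_
          rw [Finset.sum_ite_eq, if_pos hd]
      _ ≤ X * L + z * (z * (z : ℝ) ^ 2) := by gcongr
      _ = _ := by ring
  have hAL : (A.card : ℝ) * L ^ 2 ≤ X * L + (z : ℝ) ^ 4 := by
    refine le_trans ?_ hsq_sum
    calc (A.card : ℝ) * L ^ 2 = ∑ m ∈ A, L ^ 2 := by simp
      _ = ∑ m ∈ A, (∑ d ∈ D, ψ d m) ^ 2 := by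
          refine Finset.sum_congr rfl fun m hm => ?_
          have hm' := (Finset.mem_filter.1 hm).2
          congr 1
          refine Finset.sum_congr rfl fun d hd => Finset.prod_congr rfl fun p hp => ?_
          obtain ⟨hd1, hdz, -⟩ := hDmem d hd
          exact (hm' p (Nat.prime_of_mem_primeFactors hp)
            ((Nat.le_of_mem_primeFactors hp).trans hdz)).symm
      _ ≤ _ := Finset.sum_le_sum_of_subset_of_nonneg (Finset.filter_subset _ _)
          fun _ _ _ => sq_nonneg _
  have hLpos : 0 < L := by linarith
  rw [← mul_le_mul_iff_left₀ (show 0 < L ^ 2 by positivity)]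
  refine hAL.trans ?_
  rw [add_mul]
  refine add_le_add (le_of_eq (by field_simp)) ?_
  exact le_mul_of_one_le_right (by positivity) (one_le_pow₀ hL1)

theorem sum_range_shifted_sieve {Q : Finset ℕ} {p : ℕ} (hp : p.Prime) (a b : ℝ) :
    ∑ m ∈ Finset.range p, (if p ∣ m + 1 ∨ (p ∈ Q ∧ p ∣ m) then a else b)
      = (if p ∈ Q then 2 else 1) * a + (p - (if p ∈ Q then 2 else 1)) * b := by
  have h2 := hp.two_le
  have h1 : ((Finset.range p).filter (fun m => p ∣ m + 1 ∨ (p ∈ Q ∧ p ∣ m)))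
      = if p ∈ Q then {p - 1, 0} else {p - 1} := by
    ext m
    simp only [Finset.mem_filter, Finset.mem_range]
    have e1 : m < p → (p ∣ m + 1 ↔ m = p - 1) := by
      intro hm
      constructor
      · intro h
        have := Nat.le_of_dvd (by omega) h
        omega
      · rintro rfl
        rw [Nat.sub_add_cancel (by omega)]
    have e2 : m < p → (p ∣ m ↔ m = 0) := by
      intro hm
      exact ⟨fun h => Nat.eq_zero_of_dvd_of_lt h hm, by rintro rfl; simp⟩
    split_ifs with hQ
    · simp only [hQ, true_and, Finset.mem_insert, Finset.mem_singleton]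
      constructor
      · rintro ⟨hm, h⟩
        rwa [e1 hm, e2 hm] at h
      · intro h
        have hm : m < p := by omega
        rw [e1 hm, e2 hm]
        exact ⟨hm, h⟩
    · simp only [hQ, false_and, or_false, Finset.mem_singleton]
      constructor
      · rintro ⟨hm, h⟩
        rwa [e1 hm] at h
      · intro h
        have hm : m < p := by omega
        rw [e1 hm]
        exact ⟨hm, h⟩
  have hc : (((Finset.range p).filter (fun m => p ∣ m + 1 ∨ (p ∈ Q ∧ p ∣ m))).card : ℝ)
      = if p ∈ Q then 2 else 1 := by
    rw [h1]
    split_ifs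
    · rw [Finset.card_pair (by omega)]; norm_num
    · simp
  have h3 := Finset.card_filter_add_card_filter_not (s := Finset.range p)
    (fun m => p ∣ m + 1 ∨ (p ∈ Q ∧ p ∣ m))
  have h4 : (((Finset.range p).filter (fun m => ¬ (p ∣ m + 1 ∨ (p ∈ Q ∧ p ∣ m)))).card : ℝ)
      = p - if p ∈ Q then 2 else 1 := by
    rw [← hc, eq_sub_iff_add_eq', ← Nat.cast_add, h3, Finset.card_range]
  rw [Finset.sum_ite, Finset.sum_const, Finset.sum_const, nsmul_eq_mul, nsmul_eq_mul, hc, h4]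

theorem log_le_sum_squarefree_inv {q : ℕ} (hq : q.Prime) (w : ℕ) :
    Real.log (w + 1) ≤
      3 * ∑ a ∈ (Finset.Icc 1 w).filter (fun a => Squarefree a ∧ ¬ q ∣ a), (1 / a : ℝ) := by
  set 𝒜 := (Finset.Icc 1 w).filter (fun a => Squarefree a ∧ ¬ q ∣ a) with h𝒜
  have h0 : Real.log (w + 1) ≤ ∑ n ∈ Finset.Icc 1 w, (1 / n : ℝ) := by
    have := log_add_one_le_harmonic w
    rw [harmonic_eq_sum_Icc] at this
    push_cast at this
    simpa using this
  set 𝒯 := 𝒜 ×ˢ (Finset.Icc 1 w ×ˢ Finset.range 2) with h𝒯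
  set φ : ℕ × ℕ × ℕ → ℕ := fun t => t.1 * (t.2.1 ^ 2 * q ^ t.2.2) with hφ
  have hsub : Finset.Icc 1 w ⊆ 𝒯.image φ := by
    intro n hn
    obtain ⟨hn1, hnw⟩ := Finset.mem_Icc.1 hn
    obtain ⟨a, b, ha⟩ := Nat.sq_mul_squarefree n
    obtain ⟨hab, hsq⟩ := ha
    have ha0 : 0 < a := Nat.pos_of_ne_zero (by rintro rfl; simp at hab; omega)
    have hb0 : 0 < b := Nat.pos_of_ne_zero (by rintro rfl; simp at hab; omega)
    have hbw : b ≤ w := le_trans (Nat.le_of_dvd (by omega) ⟨b * a, by rw [← hab]; ring⟩) hnw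
    have haw : a ≤ w := le_trans (Nat.le_of_dvd (by omega) ⟨b ^ 2, by rw [← hab]; ring⟩) hnw
    rw [Finset.mem_image]
    by_cases hqa : q ∣ a
    · obtain ⟨c, rfl⟩ := hqa
      have hc0 : 0 < c := Nat.pos_of_mul_pos_left ha0
      refine ⟨(c, b, 1), ?_, ?_⟩
      · simp only [h𝒯, h𝒜, Finset.mem_product, Finset.mem_filter, Finset.mem_Icc,
          Finset.mem_range]
        refine ⟨⟨⟨hc0, le_trans (Nat.le_mul_of_pos_left c hq.pos) haw⟩,
          hsq.squarefree_of_dvd ⟨q, by ring⟩, ?_⟩, ⟨hb0, hbw⟩, by norm_num⟩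
        rintro ⟨e, rfl⟩
        have := hsq q ⟨e, by ring⟩
        exact hq.one_lt.ne' (Nat.isUnit_iff.1 this)
      · simp only [hφ, ← hab]; ring
    · refine ⟨(a, b, 0), ?_, ?_⟩
      · simp only [h𝒯, h𝒜, Finset.mem_product, Finset.mem_filter, Finset.mem_Icc,
          Finset.mem_range]
        exact ⟨⟨⟨ha0, haw⟩, hsq, hqa⟩, ⟨hb0, hbw⟩, by norm_num⟩
      · simp only [hφ, ← hab]; ring
  have h1 : ∑ n ∈ Finset.Icc 1 w, (1 / n : ℝ) ≤ ∑ t ∈ 𝒯, (1 / (φ t : ℕ) : ℝ) := by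
    calc ∑ n ∈ Finset.Icc 1 w, (1 / n : ℝ) ≤ ∑ n ∈ 𝒯.image φ, (1 / n : ℝ) :=
          Finset.sum_le_sum_of_subset_of_nonneg hsub fun _ _ _ => by positivity
      _ ≤ ∑ n ∈ 𝒯.image φ, ∑ t ∈ 𝒯 with φ t = n, (1 / (φ t : ℕ) : ℝ) := by
          refine Finset.sum_le_sum fun n hn => ?_
          obtain ⟨t, ht, rfl⟩ := Finset.mem_image.1 hn
          exact Finset.single_le_sum (f := fun t => (1 / (φ t : ℕ) : ℝ))
            (fun _ _ => by positivity) (Finset.mem_filter.2 ⟨ht, rfl⟩)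
      _ = _ := Finset.sum_fiberwise_of_maps_to (fun t ht => Finset.mem_image_of_mem _ ht) _
  have h2 : ∑ t ∈ 𝒯, (1 / (φ t : ℕ) : ℝ)
      = (∑ a ∈ 𝒜, (1 / a : ℝ)) * ((∑ b ∈ Finset.Icc 1 w, (1 / (b : ℝ) ^ 2))
        * ∑ i ∈ Finset.range 2, (1 / (q : ℝ) ^ i)) := by
    rw [h𝒯, Finset.sum_mul_sum, Finset.sum_product, Finset.sum_mul]
    refine Finset.sum_congr rfl fun a _ => ?_
    rw [Finset.sum_product]
    rw [Finset.mul_sum]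
    refine Finset.sum_congr rfl fun b _ => ?_
    rw [Finset.mul_sum]
    refine Finset.sum_congr rfl fun i _ => ?_
    simp only [hφ]
    push_cast
    simp only [one_div, mul_inv]
  have h3 : (∑ b ∈ Finset.Icc 1 w, (1 / (b : ℝ) ^ 2)) ≤ 2 := by
    rcases Nat.eq_zero_or_pos w with rfl | hw
    · simp
    rw [← Finset.add_sum_Ioc_eq_sum_Icc hw]
    have := sum_Ioc_inv_sq_le_sub (α := ℝ) one_ne_zero hw
    have h5 : (0 : ℝ) ≤ (w : ℝ)⁻¹ := by positivity
    norm_num at this ⊢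
    linarith
  have h4 : ∑ i ∈ Finset.range 2, (1 / (q : ℝ) ^ i) ≤ 3 / 2 := by
    have : (1 / q : ℝ) ≤ 1 / 2 :=
      one_div_le_one_div_of_le (by norm_num) (by exact_mod_cast hq.two_le)
    simp only [Finset.sum_range_succ, Finset.range_zero, Finset.sum_empty]
    norm_num at *
    linarith
  have h5 : (0 : ℝ) ≤ ∑ a ∈ 𝒜, (1 / a : ℝ) := Finset.sum_nonneg fun _ _ => by positivity
  calc Real.log (w + 1) ≤ _ := h0
    _ ≤ _ := h1
    _ = _ := h2
    _ ≤ (∑ a ∈ 𝒜, (1 / a : ℝ)) * (2 * (3 / 2)) := by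
        refine mul_le_mul_of_nonneg_left ?_ h5
        refine mul_le_mul h3 h4 (Finset.sum_nonneg fun _ _ => by positivity) (by norm_num)
    _ = _ := by ring

/-- Lower bound for the main term of the sieve. -/
theorem log_mul_sum_le_sieve_main {Q : Finset ℕ} {z : ℕ}
    (hQ : ∀ q ∈ Q, q.Prime ∧ 5 ≤ q ∧ q ^ 2 ≤ z) :
    Real.log z * (∑ q ∈ Q, (1 / q : ℝ)) ≤
      6 * ∑ d ∈ (Finset.Icc 1 z).filter Squarefree, ∏ p ∈ d.primeFactors,
        ((if p ∈ Q then 2 else 1) / ((p : ℝ) - if p ∈ Q then 2 else 1)) := by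
  set D := (Finset.Icc 1 z).filter Squarefree with hD
  have h1 : ∀ d ∈ D, ∑ q ∈ Q, (if q ∣ d then (1 / d : ℝ) else 0) ≤ ∏ p ∈ d.primeFactors,
        ((if p ∈ Q then 2 else 1) / ((p : ℝ) - if p ∈ Q then 2 else 1)) := by
    intro d hd
    simp only [hD, Finset.mem_filter, Finset.mem_Icc] at hd
    obtain ⟨⟨hd1, hdz⟩, hsq⟩ := hd
    have hd0 : d ≠ 0 := by omega
    calc ∑ q ∈ Q, (if q ∣ d then (1 / d : ℝ) else 0)
        = ((Q.filter (fun q => q ∣ d)).card : ℝ) * (1 / d) := by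
          rw [← Finset.sum_filter, Finset.sum_const, nsmul_eq_mul]
      _ ≤ 2 ^ (Q.filter (fun q => q ∣ d)).card * (1 / d) := by
          refine mul_le_mul_of_nonneg_right ?_ (by positivity)
          exact_mod_cast Nat.lt_two_pow_self.le
      _ = (∏ p ∈ d.primeFactors, (if p ∈ Q then (2 : ℝ) else 1))
            * (1 / ((∏ p ∈ d.primeFactors, p : ℕ) : ℝ)) := by
          congr 1
          · rw [Finset.prod_ite, Finset.prod_const, Finset.prod_const_one, mul_one]
            congr 2
            ext p
            simp only [Finset.mem_filter, Nat.mem_primeFactors]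
            constructor
            · rintro ⟨h1, h2⟩
              exact ⟨⟨(hQ p h1).1, h2, hd0⟩, h1⟩
            · tauto
          · rw [Nat.prod_primeFactors_of_squarefree hsq]
      _ = ∏ p ∈ d.primeFactors, ((if p ∈ Q then 2 else 1) / (p : ℝ)) := by
          push_cast
          rw [Finset.prod_div_distrib, mul_one_div]
      _ ≤ _ := by
          refine Finset.prod_le_prod (fun p _ => ?_) fun p hp => ?_
          · split_ifs <;> positivity
          · have hp' := Nat.prime_of_mem_primeFactors hp
            have hp2 : (2 : ℝ) ≤ p := by exact_mod_cast hp'.two_le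
            split_ifs with hpQ
            · have : (5 : ℝ) ≤ p := by exact_mod_cast (hQ p hpQ).2.1
              exact div_le_div_of_nonneg_left (by norm_num) (by linarith) (by linarith)
            · exact div_le_div_of_nonneg_left (by norm_num) (by linarith) (by linarith)
  have h2 : ∀ q ∈ Q, Real.log z * (1 / q : ℝ) ≤ 6 * ∑ d ∈ D, (if q ∣ d then (1 / d : ℝ) else 0) := by
    intro q hq
    obtain ⟨hqp, hq5, hqz⟩ := hQ q hq
    have hq0 : (0 : ℝ) < q := by exact_mod_cast hqp.pos
    have hz0 : (0 : ℝ) < z := by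
      have : 0 < z := lt_of_lt_of_le (by positivity) hqz
      exact_mod_cast this
    have h3 := log_le_sum_squarefree_inv hqp (z / q)
    have h4 : Real.log z ≤ 2 * Real.log ((z / q : ℕ) + 1) := by
      have h5 : (z : ℝ) / q ≤ (z / q : ℕ) + 1 := by
        rw [div_le_iff₀ hq0]
        have := Nat.lt_div_mul_add (a := z) hqp.pos
        have h6 : z ≤ (z / q + 1) * q := by rw [add_mul, one_mul]; exact this.le
        exact_mod_cast h6
      have h6 : Real.log z - Real.log q ≤ Real.log ((z / q : ℕ) + 1) := by
        rw [← Real.log_div hz0.ne' hq0.ne']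
        exact Real.log_le_log (by positivity) h5
      have h7 : 2 * Real.log q ≤ Real.log z := by
        have : Real.log ((q : ℝ) ^ 2) ≤ Real.log z :=
          Real.log_le_log (by positivity) (by exact_mod_cast hqz)
        rw [Real.log_pow] at this
        exact_mod_cast this
      linarith
    have h5 : (1 / q : ℝ) * ∑ a ∈ (Finset.Icc 1 (z / q)).filter
        (fun a => Squarefree a ∧ ¬ q ∣ a), (1 / a : ℝ)
        ≤ ∑ d ∈ D, (if q ∣ d then (1 / d : ℝ) else 0) := by
      rw [← Finset.sum_filter, Finset.mul_sum]
      calc _ = ∑ d ∈ ((Finset.Icc 1 (z / q)).filter (fun a => Squarefree a ∧ ¬ q ∣ a)).image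
            (fun a => q * a), (1 / d : ℝ) := by
            rw [Finset.sum_image (fun a _ b _ h => Nat.eq_of_mul_eq_mul_left hqp.pos h)]
            refine Finset.sum_congr rfl fun a _ => ?_
            push_cast
            simp only [one_div, mul_inv]
        _ ≤ _ := by
            refine Finset.sum_le_sum_of_subset_of_nonneg ?_ fun _ _ _ => by positivity
            intro d hd
            obtain ⟨a, ha, rfl⟩ := Finset.mem_image.1 hd
            simp only [Finset.mem_filter, Finset.mem_Icc, hD] at ha ⊢
            obtain ⟨⟨ha1, haz⟩, hsq, hqa⟩ := ha
            refine ⟨⟨⟨Nat.mul_pos hqp.pos ha1, ?_⟩, ?_⟩, ⟨a, rfl⟩⟩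
            · rw [mul_comm]
              exact (Nat.le_div_iff_mul_le hqp.pos).1 haz
            · exact Nat.squarefree_mul_iff.2
                ⟨(Nat.Prime.coprime_iff_not_dvd hqp).2 hqa, hqp.squarefree, hsq⟩
    have h6 : (0 : ℝ) ≤ 1 / q := by positivity
    calc Real.log z * (1 / q : ℝ) ≤ (2 * (3 * ∑ a ∈ (Finset.Icc 1 (z / q)).filter
        (fun a => Squarefree a ∧ ¬ q ∣ a), (1 / a : ℝ))) * (1 / q) := by
          refine mul_le_mul_of_nonneg_right ?_ h6
          linarith
      _ = 6 * ((1 / q : ℝ) * ∑ a ∈ (Finset.Icc 1 (z / q)).filter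
        (fun a => Squarefree a ∧ ¬ q ∣ a), (1 / a : ℝ)) := by ring
      _ ≤ _ := by linarith
  calc Real.log z * (∑ q ∈ Q, (1 / q : ℝ))
      = ∑ q ∈ Q, Real.log z * (1 / q : ℝ) := Finset.mul_sum _ _ _
    _ ≤ ∑ q ∈ Q, 6 * ∑ d ∈ D, (if q ∣ d then (1 / d : ℝ) else 0) := Finset.sum_le_sum h2
    _ = 6 * ∑ d ∈ D, ∑ q ∈ Q, (if q ∣ d then (1 / d : ℝ) else 0) := by
        rw [← Finset.mul_sum, Finset.sum_comm]
    _ ≤ _ := by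
        refine mul_le_mul_of_nonneg_left (Finset.sum_le_sum h1) (by norm_num)

/-- Few primes `p` are such that `p - 1` has no prime factor in `Q`. -/
theorem card_primes_avoiding_le {Q : Finset ℕ} {z X : ℕ} (hz : 2 ≤ z)
    (hQ : ∀ q ∈ Q, q.Prime ∧ 5 ≤ q ∧ q ^ 2 ≤ z) (hQ0 : Q.Nonempty) :
    (((Finset.Ioc z X).filter
      (fun p => p.Prime ∧ ∀ q ∈ Q, ¬ q ∣ p - 1)).card : ℝ) ≤
      6 * X / (Real.log z * ∑ q ∈ Q, (1 / q : ℝ)) + z ^ 4 := by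
  set ω : ℕ → ℝ := fun p => if p ∈ Q then 2 else 1 with hω
  set h : ℕ → ℝ := fun p => ω p / (p - ω p) with hh
  set ε : ℕ → ℕ → ℝ := fun p m => if p ∣ m + 1 ∨ (p ∈ Q ∧ p ∣ m) then -1 else h p with hε
  have hωp : ∀ p : ℕ, p.Prime → 1 ≤ ω p ∧ 2 * ω p ≤ p := by
    intro p hp
    have hp2 : (2 : ℝ) ≤ p := by exact_mod_cast hp.two_le
    simp only [hω]
    split_ifs with hpQ
    · have : (5 : ℝ) ≤ p := by exact_mod_cast (hQ p hpQ).2.1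
      constructor <;> linarith
    · constructor <;> linarith
  have hh0 : ∀ p : ℕ, p.Prime → 0 ≤ h p ∧ h p ≤ 1 := by
    intro p hp
    obtain ⟨h1, h2⟩ := hωp p hp
    constructor
    · exact div_nonneg (by linarith) (by linarith)
    · exact div_le_one_of_le₀ (by linarith) (by linarith)
  have hsieve := selberg_sieve (ε := ε) (h := h) ?_ ?_ ?_ ?_ (fun p hp => (hh0 p hp).1) z X
    (by omega)
  · have hmain := log_mul_sum_le_sieve_main hQ
    have hpos : 0 < Real.log z * ∑ q ∈ Q, (1 / q : ℝ) := by
      refine mul_pos (Real.log_pos (by exact_mod_cast hz)) (Finset.sum_pos (fun q hq => ?_) hQ0)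
      have := (hQ q hq).1.pos
      positivity
    refine le_trans ?_ (hsieve.trans ?_)
    · rw [Nat.cast_le]
      refine Finset.card_le_card_of_injOn (fun p => p - 1) ?_ ?_
      · intro p hp
        simp only [Finset.coe_filter, Finset.mem_Ioc, Set.mem_ofPred_eq, Finset.mem_range] at hp ⊢
        obtain ⟨⟨hzp, hpX⟩, hpp, hav⟩ := hp
        refine ⟨by omega, fun r hr hrz => if_neg ?_⟩
        rw [Nat.sub_add_cancel (by omega)]
        rintro (h1 | ⟨h1, h2⟩)
        · have := (Nat.prime_dvd_prime_iff_eq hr hpp).1 h1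
          omega
        · exact hav r h1 h2
      · intro p hp q hq hpq
        simp only [Finset.coe_filter, Finset.mem_Ioc, Set.mem_ofPred_eq] at hp hq hpq
        omega
    · refine add_le_add_left ?_ _
      rw [div_le_div_iff₀ (by linarith) hpos]
      calc (X : ℝ) * (Real.log z * ∑ q ∈ Q, (1 / q : ℝ)) ≤ X * _ :=
            mul_le_mul_of_nonneg_left hmain (by positivity)
        _ = _ := by simp only [hh, hω]; ring
  · intro p m
    simp only [hε]
    rcases Nat.eq_zero_or_pos p with rfl | hp
    · simp
    have e1 : p ∣ m % p + 1 ↔ p ∣ m + 1 := by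
      rw [Nat.dvd_iff_mod_eq_zero, Nat.dvd_iff_mod_eq_zero, Nat.mod_add_mod]
    have e2 : p ∣ m % p ↔ p ∣ m := by
      rw [Nat.dvd_iff_mod_eq_zero, Nat.dvd_iff_mod_eq_zero, Nat.mod_mod]
    simp only [e1, e2]
  · intro p hp
    simp only [hε]
    rw [sum_range_shifted_sieve hp]
    obtain ⟨h1, h2⟩ := hωp p hp
    have : (p : ℝ) - ω p ≠ 0 := by linarith
    change ω p * (-1) + (p - ω p) * (ω p / (p - ω p)) = 0
    field_simp
    ring
  · intro p hp
    simp only [hε, ite_pow]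
    rw [sum_range_shifted_sieve hp]
    obtain ⟨h1, h2⟩ := hωp p hp
    have : (p : ℝ) - ω p ≠ 0 := by linarith
    change ω p * (-1) ^ 2 + (p - ω p) * (ω p / (p - ω p)) ^ 2 = p * (ω p / (p - ω p))
    field_simp
    ring
  · intro p hp m
    obtain ⟨h1, h2⟩ := hh0 p hp
    simp only [hε]
    split_ifs
    · simp
    · rwa [abs_of_nonneg h1]

theorem eventually_le_theta :
    ∀ᶠ n : ℕ in atTop, (n : ℝ) * (Real.log 2 / 2) ≤ Chebyshev.theta n := by
  have h1 : ∀ᶠ s : ℝ in atTop, Real.log s ≤ 1 / 32 * s := by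
    have := Real.isLittleO_log_id_atTop.bound (show (0 : ℝ) < 1 / 32 by norm_num)
    filter_upwards [this, eventually_ge_atTop 1] with s hs hs1
    rw [Real.norm_of_nonneg (Real.log_nonneg hs1), id, Real.norm_of_nonneg (by linarith)] at hs
    exact hs
  have h2 : Tendsto (fun n : ℕ => √(n : ℝ)) atTop atTop :=
    Real.tendsto_sqrt_atTop.comp tendsto_natCast_atTop_atTop
  filter_upwards [h2.eventually h1, eventually_ge_atTop 2] with n hn hn2
  have hn2' : (2 : ℝ) ≤ n := by exact_mod_cast hn2
  have hss : √(n : ℝ) * √(n : ℝ) = n := Real.mul_self_sqrt (by linarith)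
  have hs1 : 1 ≤ √(n : ℝ) := by
    rw [Real.one_le_sqrt]; linarith
  have hlog : Real.log n = 2 * Real.log √(n : ℝ) := by
    rw [Real.log_sqrt (by linarith)]; ring
  have hlog1 : Real.log (n + 1) ≤ 2 * Real.log n := by
    rw [← Real.log_rpow (by linarith)]
    refine Real.log_le_log (by linarith) ?_
    norm_num
    nlinarith
  have h3 := Chebyshev.theta_ge n
  have h4 := Real.log_two_gt_d9
  have h5 : 2 * √(n : ℝ) * Real.log n ≤ n * (1 / 8) := by
    rw [hlog]
    nlinarith
  have h6 : Real.log (n + 1) ≤ n * (1 / 8) := by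
    nlinarith
  nlinarith

theorem log_eight_le : Real.log 8 ≤ 3 ∧ 2 ≤ Real.log 8 := by
  have h : Real.log 8 = 3 * Real.log 2 := by
    rw [show (8 : ℝ) = 2 ^ 3 by norm_num, Real.log_pow]; norm_num
  have h1 := Real.log_two_gt_d9
  have h2 := Real.log_two_lt_d9
  constructor <;> linarith

theorem exists_prime_block :
    ∃ k₀ : ℕ, ∀ k ≥ k₀, (1 / 24 : ℝ) / (k + 1) ≤
      ∑ p ∈ (Finset.Ioc (8 ^ k) (8 ^ (k + 1))).filter Nat.Prime, (1 / p : ℝ) := by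
  obtain ⟨n₀, hn₀⟩ := eventually_atTop.1 eventually_le_theta
  refine ⟨n₀, fun k hk => ?_⟩
  have hkn : n₀ ≤ 8 ^ (k + 1) :=
    le_trans hk (le_trans (Nat.lt_pow_self (by norm_num)).le
      (Nat.pow_le_pow_right (by norm_num) (Nat.le_succ k)))
  have h1 := hn₀ _ hkn
  have h2 := Chebyshev.theta_le_log4_mul_x (x := ((8 ^ k : ℕ) : ℝ)) (by positivity)
  have h3 : Chebyshev.theta ((8 ^ (k + 1) : ℕ) : ℝ) = Chebyshev.theta ((8 ^ k : ℕ) : ℝ)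
      + ∑ p ∈ (Finset.Ioc (8 ^ k) (8 ^ (k + 1))).filter Nat.Prime, Real.log p := by
    unfold Chebyshev.theta
    rw [Nat.floor_natCast, Nat.floor_natCast, Finset.sum_filter, Finset.sum_filter,
      Finset.sum_filter, Finset.sum_Ioc_consecutive _ (Nat.zero_le _)
        (Nat.pow_le_pow_right (by norm_num) (Nat.le_succ k))]
  have h4 : Real.log 4 = 2 * Real.log 2 := by
    rw [show (4 : ℝ) = 2 ^ 2 by norm_num, Real.log_pow]; norm_num
  have h5 := Real.log_two_gt_d9
  have hN : (1 : ℝ) ≤ ((8 ^ k : ℕ) : ℝ) := by exact_mod_cast Nat.one_le_pow _ _ (by norm_num)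
  have hN8 : ((8 ^ (k + 1) : ℕ) : ℝ) = 8 * ((8 ^ k : ℕ) : ℝ) := by push_cast; ring
  set N : ℝ := ((8 ^ k : ℕ) : ℝ) with hNdef
  have h6 : N ≤ ∑ p ∈ (Finset.Ioc (8 ^ k) (8 ^ (k + 1))).filter Nat.Prime, Real.log p := by
    rw [hN8] at h1 h3
    rw [h4] at h2
    nlinarith
  have h7 : ∀ p ∈ (Finset.Ioc (8 ^ k) (8 ^ (k + 1))).filter Nat.Prime,
      Real.log p ≤ (1 / p : ℝ) * (8 * N * (3 * (k + 1))) := by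
    intro p hp
    simp only [Finset.mem_filter, Finset.mem_Ioc] at hp
    obtain ⟨⟨hp1, hp2⟩, hpp⟩ := hp
    have hp0 : (0 : ℝ) < p := by exact_mod_cast hpp.pos
    have hp3 : (p : ℝ) ≤ 8 * N := by rw [← hN8]; exact_mod_cast hp2
    have hp4 : Real.log p ≤ 3 * (k + 1) := by
      have : Real.log p ≤ Real.log ((8 : ℝ) ^ (k + 1)) :=
        Real.log_le_log hp0 (by exact_mod_cast hp2)
      rw [Real.log_pow] at this
      refine this.trans ?_
      push_cast
      rw [mul_comm]
      exact mul_le_mul_of_nonneg_right log_eight_le.1 (by positivity)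
    rw [one_div_mul_eq_div, le_div_iff₀ hp0, mul_comm]
    exact mul_le_mul hp3 hp4 (Real.log_nonneg (by exact_mod_cast hpp.one_lt.le)) (by positivity)
  have h8 := h6.trans (Finset.sum_le_sum h7)
  rw [← Finset.sum_mul] at h8
  have hN0 : 0 < N := by linarith
  rw [div_le_iff₀ (by positivity)]
  by_contra! hc
  nlinarith

theorem ninetysix_mul_le_pow (k : ℕ) (hk : 9 ≤ k) :
    8 ^ (4 * ((k + 1) / 8)) * (96 * (k + 1)) ≤ 8 ^ k := by
  have h1 : ∀ u : ℕ, 4 ≤ u → 96 * (2 * u + 3) ≤ 8 ^ u := by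
    intro u hu
    induction u, hu using Nat.le_induction with
    | base => norm_num
    | succ u hu ih =>
      rw [pow_succ]
      omega
  have h2 := h1 ((k - 1) / 2) (by omega)
  calc 8 ^ (4 * ((k + 1) / 8)) * (96 * (k + 1))
      ≤ 8 ^ (4 * ((k + 1) / 8)) * 8 ^ ((k - 1) / 2) := by
        refine Nat.mul_le_mul_left _ (le_trans ?_ h2)
        omega
    _ = 8 ^ (4 * ((k + 1) / 8) + (k - 1) / 2) := by rw [pow_add]
    _ ≤ 8 ^ k := Nat.pow_le_pow_right (by norm_num) (by omega)

/-- A positive proportion of the primes `p` is such that `p - 1` has a prime factor in `Q`. -/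
theorem exists_good_prime_block :
    ∃ k₁ : ℕ, ∀ k ≥ k₁, ∀ (Q : Finset ℕ) (e : ℕ),
      (∀ q ∈ Q, q.Prime ∧ 5 ≤ q ∧ q ≤ 8 ^ e) → 16 * e ≤ k + 1 →
      (18432 : ℝ) ≤ ∑ q ∈ Q, (1 / q : ℝ) →
      (1 / 96 : ℝ) / (k + 1) ≤ ∑ p ∈ (Finset.Ioc (8 ^ k) (8 ^ (k + 1))).filter
        (fun p => p.Prime ∧ ∃ q ∈ Q, q ∣ p - 1), (1 / p : ℝ) := by
  obtain ⟨k₀, hk₀⟩ := exists_prime_block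
  refine ⟨max k₀ 9, fun k hk Q e hQ hek hS => ?_⟩
  have hk9 : 9 ≤ k := le_trans (le_max_right _ _) hk
  have hall := hk₀ k (le_trans (le_max_left _ _) hk)
  set t := (k + 1) / 8 with ht
  set S := ∑ q ∈ Q, (1 / q : ℝ) with hSdef
  have hS0 : 0 < S := by linarith
  have hQ0 : Q.Nonempty := by
    by_contra h
    rw [Finset.not_nonempty_iff_eq_empty] at h
    simp [hSdef, h] at hS
    linarith
  have hbad := card_primes_avoiding_le (Q := Q) (z := 8 ^ t) (X := 8 ^ (k + 1)) ?_ ?_ hQ0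
  rotate_left
  · calc 2 ≤ 8 ^ 1 := by norm_num
      _ ≤ 8 ^ t := Nat.pow_le_pow_right (by norm_num) (by omega)
  · intro q hq
    obtain ⟨h1, h2, h3⟩ := hQ q hq
    refine ⟨h1, h2, ?_⟩
    calc q ^ 2 ≤ (8 ^ e) ^ 2 := Nat.pow_le_pow_left h3 2
      _ = 8 ^ (e * 2) := by rw [pow_mul]
      _ ≤ 8 ^ t := Nat.pow_le_pow_right (by norm_num) (by omega)
  set B := (Finset.Ioc (8 ^ k) (8 ^ (k + 1))).filter
    (fun p => p.Prime ∧ ¬ ∃ q ∈ Q, q ∣ p - 1) with hB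
  set G := (Finset.Ioc (8 ^ k) (8 ^ (k + 1))).filter
    (fun p => p.Prime ∧ ∃ q ∈ Q, q ∣ p - 1) with hG
  have hsplit : ∑ p ∈ (Finset.Ioc (8 ^ k) (8 ^ (k + 1))).filter Nat.Prime, (1 / p : ℝ)
      = ∑ p ∈ G, (1 / p : ℝ) + ∑ p ∈ B, (1 / p : ℝ) := by
    rw [hG, hB, ← Finset.filter_filter, ← Finset.filter_filter, Finset.sum_filter_add_sum_filter_not]
  have hN : (0 : ℝ) < 8 ^ k := by positivity
  have hk1 : (0 : ℝ) < (k : ℝ) + 1 := by positivity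
  have hBcard : (B.card : ℝ) ≤ 6 * (8 ^ (k + 1) : ℝ) / ((k + 1) / 8 * S) + (8 ^ t) ^ 4 := by
    have h1 : (B.card : ℝ) ≤ ((Finset.Ioc (8 ^ t) (8 ^ (k + 1))).filter
      (fun p => p.Prime ∧ ∀ q ∈ Q, ¬ q ∣ p - 1)).card := by
      rw [Nat.cast_le]
      refine Finset.card_le_card fun p hp => ?_
      simp only [hB, Finset.mem_filter, Finset.mem_Ioc, not_exists, not_and] at hp ⊢
      refine ⟨⟨lt_of_le_of_lt ?_ hp.1.1, hp.1.2⟩, hp.2⟩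
      exact Nat.pow_le_pow_right (by norm_num) (by omega)
    refine h1.trans (hbad.trans ?_)
    push_cast
    refine add_le_add_left ?_ _
    refine div_le_div_of_nonneg_left (by positivity) (by positivity) ?_
    refine mul_le_mul_of_nonneg_right ?_ hS0.le
    rw [Real.log_pow]
    have h2 : ((k : ℝ) + 1) / 16 ≤ t := by
      rw [div_le_iff₀ (by norm_num)]
      have : k + 1 ≤ t * 16 := by omega
      exact_mod_cast this
    have h3 := log_eight_le.2
    nlinarith
  have hBsum : ∑ p ∈ B, (1 / p : ℝ) ≤ (1 / 32) / (k + 1) := by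
    have h1 : ∑ p ∈ B, (1 / p : ℝ) ≤ B.card * (1 / 8 ^ k) := by
      rw [← nsmul_eq_mul]
      refine Finset.sum_le_card_nsmul _ _ _ fun p hp => ?_
      simp only [hB, Finset.mem_filter, Finset.mem_Ioc] at hp
      exact one_div_le_one_div_of_le hN (by exact_mod_cast hp.1.1.le)
    have h2 : ((8 : ℝ) ^ t) ^ 4 * (1 / 8 ^ k) ≤ (1 / 96) / (k + 1) := by
      have h3 : (8 : ℝ) ^ (4 * t) * (96 * (k + 1)) ≤ 8 ^ k := by
        exact_mod_cast ninetysix_mul_le_pow k hk9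
      rw [← pow_mul, mul_comm t 4, mul_one_div, div_le_div_iff₀ hN hk1]
      linarith
    have h4 : 6 * (8 ^ (k + 1) : ℝ) / ((k + 1) / 8 * S) * (1 / 8 ^ k) ≤ (1 / 48) / (k + 1) := by
      rw [mul_one_div, div_div, div_le_div_iff₀ (by positivity) hk1, pow_succ]
      have : (0 : ℝ) ≤ (k + 1) * 8 ^ k := by positivity
      nlinarith
    calc ∑ p ∈ B, (1 / p : ℝ) ≤ B.card * (1 / 8 ^ k) := h1
      _ ≤ (6 * (8 ^ (k + 1) : ℝ) / ((k + 1) / 8 * S) + (8 ^ t) ^ 4) * (1 / 8 ^ k) :=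
          mul_le_mul_of_nonneg_right hBcard (by positivity)
      _ ≤ (1 / 48) / (k + 1) + (1 / 96) / (k + 1) := by
          rw [add_mul]
          exact add_le_add h4 h2
      _ = _ := by ring
  rw [hsplit] at hall
  have : (1 / 24 : ℝ) / (k + 1) - (1 / 32) / (k + 1) = (1 / 96) / (k + 1) := by ring
  linarith

theorem log_le_sum_inv_of_blocks {P : ℕ → Prop} [DecidablePred P] {c : ℝ}
    (hc : 0 ≤ c) {a b : ℕ} (hab : a ≤ b)
    (hP : ∀ k ≥ a, c / (k + 1) ≤
      ∑ p ∈ (Finset.Ioc (8 ^ k) (8 ^ (k + 1))).filter P, (1 / p : ℝ)) :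
    c * Real.log ((b + 1) / (a + 1)) ≤
      ∑ p ∈ (Finset.Ioc (8 ^ a) (8 ^ b)).filter P, (1 / p : ℝ) := by
  induction b, hab using Nat.le_induction with
  | base =>
    rw [div_self (by positivity)]
    simp
  | succ b hb ih =>
    have h1 := hP b hb
    have h2 : ∑ p ∈ (Finset.Ioc (8 ^ a) (8 ^ (b + 1))).filter P, (1 / p : ℝ)
        = ∑ p ∈ (Finset.Ioc (8 ^ a) (8 ^ b)).filter P, (1 / p : ℝ)
          + ∑ p ∈ (Finset.Ioc (8 ^ b) (8 ^ (b + 1))).filter P, (1 / p : ℝ) := by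
      rw [Finset.sum_filter, Finset.sum_filter, Finset.sum_filter, Finset.sum_Ioc_consecutive]
      · exact Nat.pow_le_pow_right (by norm_num) hb
      · exact Nat.pow_le_pow_right (by norm_num) (Nat.le_succ b)
    have h3 : Real.log (((b + 1 : ℕ) + 1) / (a + 1))
        ≤ Real.log ((b + 1) / (a + 1)) + 1 / (b + 1) := by
      have h4 : (((b + 1 : ℕ) : ℝ) + 1) / (a + 1)
          = ((b + 1) / (a + 1)) * (1 + 1 / (b + 1)) := by
        push_cast
        field_simp
      rw [h4, Real.log_mul (by positivity) (by positivity)]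
      have := Real.log_le_sub_one_of_pos (show (0 : ℝ) < 1 + 1 / (b + 1) by positivity)
      linarith
    rw [h2]
    calc _ ≤ c * (Real.log ((b + 1) / (a + 1)) + 1 / (b + 1)) :=
          mul_le_mul_of_nonneg_left h3 hc
      _ = c * Real.log ((b + 1) / (a + 1)) + c / (b + 1) := by ring
      _ ≤ _ := add_le_add ih h1

/-- The weight `2 ^ (-#{p ∈ G : p ∣ n})`. -/
noncomputable def damping (G : Finset ℕ) (n : ℕ) : ℝ :=
  ∏ p ∈ G, if p ∣ n then 1 / 2 else 1

theorem damping_nonneg (G : Finset ℕ) (n : ℕ) : 0 ≤ damping G n :=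
  Finset.prod_nonneg fun p _ => by split_ifs <;> norm_num

theorem damping_le_one (G : Finset ℕ) (n : ℕ) : damping G n ≤ 1 :=
  Finset.prod_le_one (fun p _ => by split_ifs <;> norm_num) fun p _ => by
    split_ifs <;> norm_num

theorem damping_eq (G : Finset ℕ) (n : ℕ) :
    damping G n = (1 / 2) ^ (G.filter (fun p => p ∣ n)).card := by
  rw [damping, Finset.prod_ite, Finset.prod_const, Finset.prod_const_one, mul_one]

theorem damping_le_of_dvd (G : Finset ℕ) {m n : ℕ} (h : m ∣ n) : damping G n ≤ damping G m := by
  refine Finset.prod_le_prod (fun p _ => by split_ifs <;> norm_num) fun p _ => ?_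
  by_cases hm : p ∣ m
  · simp [hm, hm.trans h]
  · simp only [hm, if_false]
    split_ifs <;> norm_num

theorem damping_prime_mul {G : Finset ℕ} (hG : ∀ p ∈ G, p.Prime) {q : ℕ} (hq : q.Prime)
    (hqG : q ∉ G) (m : ℕ) : damping G (q * m) = damping G m := by
  refine Finset.prod_congr rfl fun p hp => ?_
  have h : p ∣ q * m ↔ p ∣ m := by
    refine ⟨fun h => ?_, fun h => h.mul_left q⟩
    rcases (hG p hp).dvd_mul.1 h with h | h
    · rw [Nat.prime_dvd_prime_iff_eq (hG p hp) hq] at h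
      exact absurd (h ▸ hp) hqG
    · exact h
  simp only [h]

theorem summable_damping (G : Finset ℕ) {s : ℝ} (hs : 1 < s) :
    Summable fun n : ℕ => damping G n * (n : ℝ) ^ (-s) := by
  refine Summable.of_nonneg_of_le (fun n => mul_nonneg (damping_nonneg G n) (by positivity))
    (fun n => ?_) (Real.summable_nat_rpow.2 (by linarith : -s < -1))
  exact mul_le_of_le_one_left (by positivity) (damping_le_one G n)

theorem tsum_damping {G : Finset ℕ} (hG : ∀ p ∈ G, p.Prime) {s : ℝ} (hs : 1 < s) :
    ∑' n : ℕ, damping G n * (n : ℝ) ^ (-s)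
      = (∏ p ∈ G, (1 - (p : ℝ) ^ (-s) / 2)) * ∑' n : ℕ, (n : ℝ) ^ (-s) := by
  induction G using Finset.induction_on with
  | empty => simp [damping]
  | insert q G hq ih =>
    have hG' : ∀ p ∈ G, p.Prime := fun p hp => hG p (Finset.mem_insert_of_mem hp)
    have hqp : q.Prime := hG q (Finset.mem_insert_self _ _)
    set F : ℕ → ℝ := fun n => damping G n * (n : ℝ) ^ (-s) with hF
    have hFs : Summable F := summable_damping G hs
    set I : ℕ → ℝ := fun n => if q ∣ n then F n else 0 with hI
    have hIs : Summable I := by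
      refine Summable.of_nonneg_of_le (fun n => ?_) (fun n => ?_) hFs
      · simp only [hI, hF]
        split_ifs
        · exact mul_nonneg (damping_nonneg G n) (by positivity)
        · exact le_rfl
      · simp only [hI, hF]
        split_ifs
        · exact le_rfl
        · exact mul_nonneg (damping_nonneg G n) (by positivity)
    have h1 : ∀ n : ℕ, damping (insert q G) n * (n : ℝ) ^ (-s) = F n - 1 / 2 * I n := by
      intro n
      simp only [hI, hF]
      rw [damping, Finset.prod_insert hq, ← damping]
      split_ifs <;> ring
    have h2 : ∑' n, I n = (q : ℝ) ^ (-s) * ∑' n, F n := by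
      have hinj : Function.Injective (fun m : ℕ => q * m) :=
        fun a b h => Nat.eq_of_mul_eq_mul_left hqp.pos h
      rw [← hinj.tsum_eq, ← tsum_mul_left]
      · refine tsum_congr fun m => ?_
        simp only [hI, hF, dvd_mul_right, if_true]
        rw [damping_prime_mul hG' hqp hq]
        push_cast
        rw [Real.mul_rpow (by positivity) (by positivity)]
        ring
      · intro n hn
        rw [Function.mem_support] at hn
        by_cases h : q ∣ n
        · obtain ⟨m, rfl⟩ := h
          exact ⟨m, rfl⟩
        · simp [hI, h] at hn
    rw [tsum_congr h1, hFs.tsum_sub (hIs.mul_left _), tsum_mul_left, h2, ih hG',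
      Finset.prod_insert hq]
    ring

theorem sum_damping_mul_log_le (G : Finset ℕ) (N : ℕ) :
    ∑ n ∈ Finset.Ioc 0 N, damping G n * Real.log n ≤
      6 * N * ∑ n ∈ Finset.Ioc 0 N, damping G n / n := by
  set f : ArithmeticFunction ℝ := ⟨fun n => if n = 0 then 0 else damping G n, by simp⟩ with hf
  have hfn : ∀ n, n ≠ 0 → f n = damping G n := fun n hn => by
    change (if n = 0 then 0 else damping G n) = _
    rw [if_neg hn]
  calc ∑ n ∈ Finset.Ioc 0 N, damping G n * Real.log n
      ≤ ∑ n ∈ Finset.Ioc 0 N, (f * ArithmeticFunction.vonMangoldt) n := by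
        refine Finset.sum_le_sum fun n hn => ?_
        have hn0 : n ≠ 0 := by have := (Finset.mem_Ioc.1 hn).1; omega
        rw [ArithmeticFunction.mul_apply, ← ArithmeticFunction.vonMangoldt_sum, Finset.mul_sum,
          Nat.sum_divisorsAntidiagonal' (f := fun a b => f a * ArithmeticFunction.vonMangoldt b)]
        refine Finset.sum_le_sum fun i hi => ?_
        have hin := Nat.dvd_of_mem_divisors hi
        rw [hfn (n / i) (Nat.div_ne_zero_iff_of_dvd hin |>.2
          ⟨hn0, ne_zero_of_dvd_ne_zero hn0 hin⟩)]
        exact mul_le_mul_of_nonneg_right (damping_le_of_dvd G (Nat.div_dvd_of_dvd hin))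
          ArithmeticFunction.vonMangoldt_nonneg
    _ = ∑ n ∈ Finset.Ioc 0 N, f n *
          ∑ m ∈ Finset.Ioc 0 (N / n), ArithmeticFunction.vonMangoldt m :=
        ArithmeticFunction.sum_Ioc_mul_eq_sum_sum _ _ _
    _ ≤ ∑ n ∈ Finset.Ioc 0 N, damping G n * (6 * (N / n : ℝ)) := by
        refine Finset.sum_le_sum fun n hn => ?_
        have hn0 : n ≠ 0 := by have := (Finset.mem_Ioc.1 hn).1; omega
        rw [hfn n hn0]
        refine mul_le_mul_of_nonneg_left ?_ (damping_nonneg G n)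
        have h1 := Chebyshev.psi_le_const_mul_self (x := (N / n : ℝ)) (by positivity)
        rw [Chebyshev.psi, Nat.floor_div_eq_div] at h1
        refine h1.trans (mul_le_mul_of_nonneg_right ?_ (by positivity))
        have h4 : Real.log 4 = 2 * Real.log 2 := by
          rw [show (4 : ℝ) = 2 ^ 2 by norm_num, Real.log_pow]; norm_num
        have h5 := Real.log_two_lt_d9
        linarith
    _ = _ := by
        rw [Finset.mul_sum]
        exact Finset.sum_congr rfl fun n _ => by ring

theorem sum_damping_mul_log_le' (G : Finset ℕ) (N : ℕ) :
    (∑ n ∈ Finset.Ioc 0 N, damping G n) * Real.log N ≤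
      7 * N * ∑ n ∈ Finset.Ioc 0 N, damping G n / n := by
  have h1 := sum_damping_mul_log_le G N
  have h2 : (∑ n ∈ Finset.Ioc 0 N, damping G n) * Real.log N ≤
      ∑ n ∈ Finset.Ioc 0 N, damping G n * Real.log n
        + N * ∑ n ∈ Finset.Ioc 0 N, damping G n / n := by
    rw [Finset.mul_sum, Finset.sum_mul, ← Finset.sum_add_distrib]
    refine Finset.sum_le_sum fun n hn => ?_
    obtain ⟨hn0, hnN⟩ := Finset.mem_Ioc.1 hn
    have hn' : (0 : ℝ) < n := by exact_mod_cast hn0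
    have hN' : (0 : ℝ) < N := by exact_mod_cast hn0.trans_le hnN
    have h3 := Real.log_le_sub_one_of_pos (show (0 : ℝ) < N / n by positivity)
    rw [Real.log_div hN'.ne' hn'.ne'] at h3
    have h4 : Real.log N ≤ Real.log n + N / n := by linarith
    calc _ ≤ damping G n * (Real.log n + N / n) :=
          mul_le_mul_of_nonneg_left h4 (damping_nonneg G n)
      _ = _ := by ring
  linarith

theorem exists_sum_damping_le :
    ∃ N₀ : ℕ, ∀ N ≥ N₀, ∀ G : Finset ℕ, (∀ p ∈ G, p.Prime ∧ p ≤ N) →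
      ∑ n ∈ Finset.Ioc 0 N, damping G n ≤
        42 * N * Real.exp (-(1 / 6) * ∑ p ∈ G, (1 / p : ℝ)) := by
  have hlim : Tendsto (fun N : ℕ => 1 + 1 / Real.log N) atTop (nhdsWithin 1 (Set.Ioi 1)) := by
    rw [tendsto_nhdsWithin_iff]
    constructor
    · have : Tendsto (fun N : ℕ => 1 / Real.log N) atTop (nhds 0) :=
        (tendsto_const_nhds.div_atTop (Real.tendsto_log_atTop.comp tendsto_natCast_atTop_atTop))
      simpa using this.const_add 1
    · filter_upwards [eventually_ge_atTop 2] with N hN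
      have : 0 < Real.log N := Real.log_pos (by exact_mod_cast hN)
      simpa using this
  have h2 := (tendsto_sub_mul_tsum_nat_rpow.comp hlim).eventually_le_const
    (show (1 : ℝ) < 2 by norm_num)
  obtain ⟨N₀, hN₀⟩ := eventually_atTop.1 (h2.and (eventually_ge_atTop 2))
  refine ⟨N₀, fun N hN G hG => ?_⟩
  obtain ⟨hz, hN2⟩ := hN₀ N hN
  have hlog : 0 < Real.log N := Real.log_pos (by exact_mod_cast hN2)
  have hN0 : (0 : ℝ) < N := by positivity
  set s : ℝ := 1 + 1 / Real.log N with hs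
  have hs1 : 1 < s := by
    have : 0 < 1 / Real.log N := by positivity
    linarith
  simp only [Function.comp, add_sub_cancel_left] at hz
  rw [← hs, one_div_mul_eq_div, div_le_iff₀ hlog] at hz
  have hzeta : ∑' n : ℕ, (n : ℝ) ^ (-s) ≤ 2 * Real.log N := by
    refine le_trans (le_of_eq (tsum_congr fun n => ?_)) hz
    rw [Real.rpow_neg (by positivity), one_div]
  have hrpow : ∀ n : ℕ, 0 < n → n ≤ N → (1 / n : ℝ) ≤ Real.exp 1 * (n : ℝ) ^ (-s) := by
    intro n hn hnN
    have hn' : (0 : ℝ) < n := by exact_mod_cast hn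
    have h3 : (n : ℝ) ^ (-s) = (1 / n) * Real.exp (-(Real.log n / Real.log N)) := by
      rw [Real.rpow_def_of_pos hn', hs,
        show Real.log n * -(1 + 1 / Real.log N) = -Real.log n + -(Real.log n / Real.log N) by ring,
        Real.exp_add, Real.exp_neg, Real.exp_log hn', one_div]
    rw [h3, mul_left_comm, ← Real.exp_add]
    refine le_mul_of_one_le_right (by positivity) ?_
    have : Real.log n / Real.log N ≤ 1 := by
      rw [div_le_one hlog]
      exact Real.log_le_log hn' (by exact_mod_cast hnN)
    exact Real.one_le_exp (by linarith)
  have hsum : ∑ n ∈ Finset.Ioc 0 N, damping G n / n ≤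
      Real.exp 1 * ∑' n : ℕ, damping G n * (n : ℝ) ^ (-s) := by
    calc ∑ n ∈ Finset.Ioc 0 N, damping G n / n
        ≤ ∑ n ∈ Finset.Ioc 0 N, Real.exp 1 * (damping G n * (n : ℝ) ^ (-s)) := by
          refine Finset.sum_le_sum fun n hn => ?_
          obtain ⟨hn0, hnN⟩ := Finset.mem_Ioc.1 hn
          calc damping G n / n = damping G n * (1 / n) := by ring
            _ ≤ damping G n * (Real.exp 1 * (n : ℝ) ^ (-s)) :=
              mul_le_mul_of_nonneg_left (hrpow n hn0 hnN) (damping_nonneg G n)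
            _ = _ := by ring
      _ = Real.exp 1 * ∑ n ∈ Finset.Ioc 0 N, damping G n * (n : ℝ) ^ (-s) := by
          rw [Finset.mul_sum]
      _ ≤ _ := by
          refine mul_le_mul_of_nonneg_left ?_ (Real.exp_pos 1).le
          exact (summable_damping G hs1).sum_le_tsum _
            fun n _ => mul_nonneg (damping_nonneg G n) (by positivity)
  have he := Real.exp_one_lt_d9
  have hprod : ∏ p ∈ G, (1 - (p : ℝ) ^ (-s) / 2) ≤
      Real.exp (-(1 / 6) * ∑ p ∈ G, (1 / p : ℝ)) := by
    rw [Finset.mul_sum, Real.exp_sum]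
    refine Finset.prod_le_prod (fun p hp => ?_) fun p hp => ?_
    · have : (p : ℝ) ^ (-s) ≤ 1 :=
        Real.rpow_le_one_of_one_le_of_nonpos (by exact_mod_cast (hG p hp).1.one_lt.le)
          (by linarith)
      linarith
    · have h3 := hrpow p (hG p hp).1.pos (hG p hp).2
      have h4 := Real.add_one_le_exp (-(1 / 6) * (1 / p : ℝ))
      have h5 : (0 : ℝ) ≤ (p : ℝ) ^ (-s) := by positivity
      nlinarith
  rw [tsum_damping (fun p hp => (hG p hp).1) hs1] at hsum
  have hfin := sum_damping_mul_log_le' G N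
  set E := Real.exp (-(1 / 6) * ∑ p ∈ G, (1 / p : ℝ)) with hE
  have hE0 : 0 < E := Real.exp_pos _
  have hprodz : (∏ p ∈ G, (1 - (p : ℝ) ^ (-s) / 2)) * ∑' n : ℕ, (n : ℝ) ^ (-s)
      ≤ E * (2 * Real.log N) :=
    mul_le_mul hprod hzeta (tsum_nonneg fun n => by positivity) hE0.le
  have h6 : ∑ n ∈ Finset.Ioc 0 N, damping G n / n ≤ 3 * (E * (2 * Real.log N)) :=
    hsum.trans (mul_le_mul (by linarith) hprodz
      (mul_nonneg (Finset.prod_nonneg fun p hp => by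
        have : (p : ℝ) ^ (-s) ≤ 1 :=
          Real.rpow_le_one_of_one_le_of_nonpos (by exact_mod_cast (hG p hp).1.one_lt.le)
            (by linarith)
        linarith) (tsum_nonneg fun n => by positivity)) (by norm_num))
  rw [← mul_le_mul_iff_left₀ hlog]
  calc _ ≤ _ := hfin
    _ ≤ 7 * N * (3 * (E * (2 * Real.log N))) := mul_le_mul_of_nonneg_left h6 (by positivity)
    _ = _ := by ring

/-- Most integers have many prime factors from a set of primes with large reciprocal sum. -/
theorem exists_card_few_prime_factors_le :
    ∃ N₀ : ℕ, ∀ N ≥ N₀, ∀ (G : Finset ℕ) (K : ℕ), (∀ p ∈ G, p.Prime ∧ p ≤ N) →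
      (((Finset.Ioc 0 N).filter (fun n => (G.filter (fun p => p ∣ n)).card < K)).card : ℝ) ≤
        2 ^ K * (42 * N * Real.exp (-(1 / 6) * ∑ p ∈ G, (1 / p : ℝ))) := by
  obtain ⟨N₀, hN₀⟩ := exists_sum_damping_le
  refine ⟨N₀, fun N hN G K hG => ?_⟩
  have h := hN₀ N hN G hG
  have h1 : (((Finset.Ioc 0 N).filter
      (fun n => (G.filter (fun p => p ∣ n)).card < K)).card : ℝ) * (1 / 2) ^ K ≤
      ∑ n ∈ Finset.Ioc 0 N, damping G n := by
    rw [← nsmul_eq_mul]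
    refine (Finset.card_nsmul_le_sum _ (damping G) _ fun n hn => ?_).trans
      (Finset.sum_le_sum_of_subset_of_nonneg (Finset.filter_subset _ _)
        fun n _ _ => damping_nonneg G n)
    rw [damping_eq]
    exact pow_le_pow_of_le_one (by norm_num) (by norm_num) (Finset.mem_filter.1 hn).2.le
  have h2 := h1.trans h
  rw [one_div, inv_pow, ← div_eq_mul_inv, div_le_iff₀ (by positivity)] at h2
  linarith

/-- Every dyadic interval `(t, 2t]` with `1 ≤ t < Z` contains a divisor of `D`. -/
def HasDyadicDivisors (D : ℕ) (Z : ℝ) : Prop :=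
  ∀ t : ℝ, 1 ≤ t → t < Z → ∃ d : ℕ, d ∣ D ∧ t < d ∧ (d : ℝ) ≤ 2 * t

theorem HasDyadicDivisors.mono {D D' : ℕ} {Z Z' : ℝ} (h : HasDyadicDivisors D Z) (hD : D ∣ D')
    (hZ : Z' ≤ Z) : HasDyadicDivisors D' Z' := fun t ht htZ =>
  let ⟨d, hd, h1, h2⟩ := h t ht (htZ.trans_le hZ)
  ⟨d, hd.trans hD, h1, h2⟩

theorem hasDyadicDivisors_two_pow (v : ℕ) : HasDyadicDivisors (2 ^ v) (2 ^ v) := by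
  intro t ht htv
  obtain ⟨k, hk1, hk2⟩ := exists_nat_pow_near ht (show (1 : ℝ) < 2 by norm_num)
  have hkv : k < v := (pow_lt_pow_iff_right₀ (show (1 : ℝ) < 2 by norm_num)).1 (hk1.trans_lt htv)
  refine ⟨2 ^ (k + 1), pow_dvd_pow 2 hkv, ?_, ?_⟩
  · push_cast
    exact hk2
  · push_cast
    rw [pow_succ]
    linarith

theorem HasDyadicDivisors.mul {D q : ℕ} {Z : ℝ} (h : HasDyadicDivisors D Z) (hq : 1 ≤ q)
    (hqZ : (q : ℝ) ≤ Z) : HasDyadicDivisors (D * q) (q * Z) := by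
  intro t ht htZ
  have hq0 : (0 : ℝ) < q := by exact_mod_cast hq
  rcases lt_or_ge t Z with htZ' | htZ'
  · exact h.mono (dvd_mul_right D q) le_rfl t ht htZ'
  · obtain ⟨d, hd, h1, h2⟩ := h (t / q) ((one_le_div hq0).2 (hqZ.trans htZ'))
      ((div_lt_iff₀ hq0).2 (by linarith))
    rw [div_lt_iff₀ hq0] at h1
    rw [mul_div_assoc', le_div_iff₀ hq0] at h2
    exact ⟨d * q, mul_dvd_mul_right hd q, by push_cast; exact h1, by push_cast; exact h2⟩

theorem HasDyadicDivisors.mul_prod {D : ℕ} {B Z : ℝ} (h : HasDyadicDivisors D Z) (hB : 1 ≤ B)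
    (hZ : 0 ≤ Z) (S : Finset ℕ) (q : ℕ → ℕ) (hq : ∀ p ∈ S, B ≤ q p ∧ (q p : ℝ) ≤ Z) :
    HasDyadicDivisors (D * ∏ p ∈ S, q p) (B ^ S.card * Z) := by
  induction S using Finset.induction_on with
  | empty => simpa using h
  | insert p S hp ih =>
    obtain ⟨h1, h2⟩ := hq p (Finset.mem_insert_self p S)
    have hpow : Z ≤ B ^ S.card * Z := le_mul_of_one_le_left hZ (one_le_pow₀ hB)
    have h3 := (ih fun p' hp' => hq p' (Finset.mem_insert_of_mem hp')).mul
      (q := q p) (by exact_mod_cast hB.trans h1) (h2.trans hpow)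
    refine h3.mono (by rw [Finset.prod_insert hp, mul_assoc, mul_comm (q p)]) ?_
    rw [Finset.card_insert_of_notMem hp, pow_succ, mul_comm _ B, mul_assoc]
    exact mul_le_mul_of_nonneg_right h1 (hZ.trans hpow)

theorem prod_sub_one_dvd_totient {n : ℕ} {S : Finset ℕ} (hS : S ⊆ n.primeFactors) :
    ∏ p ∈ S, (p - 1) ∣ n.totient := by
  rw [Nat.totient_eq_div_primeFactors_mul]
  exact (Finset.prod_dvd_prod_of_subset _ _ _ hS).mul_left _

/-- The primes in `(8 ^ a, 8 ^ b]`. -/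
noncomputable def windowPrimes (a b : ℕ) : Finset ℕ :=
  (Finset.Ioc (8 ^ a) (8 ^ b)).filter Nat.Prime

/-- The primes `p ∈ (8 ^ (16 b), 8 ^ κ]` with `p - 1` divisible by a prime of `(8 ^ a, 8 ^ b]`. -/
noncomputable def shiftedPrimes (a b κ : ℕ) : Finset ℕ :=
  (Finset.Ioc (8 ^ (16 * b)) (8 ^ κ)).filter
    (fun p => p.Prime ∧ ∃ q ∈ windowPrimes a b, q ∣ p - 1)

theorem hasDyadicDivisors_totient {e : ℕ → ℕ} (he : StrictMono e) (he0 : 1 ≤ e 0) {K κ : ℕ}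
    (hK : 3 * e 1 ≤ K) (hKe : ∀ j, e (j + 2) ≤ e j * K + e (j + 1)) {n J : ℕ} (hn : n ≠ 0)
    (hJ : 1 ≤ J)
    (hcard : ∀ j < J, K ≤ ((shiftedPrimes (e j) (e (j + 1)) κ).filter (fun p => p ∣ n)).card) :
    HasDyadicDivisors n.totient (8 ^ e (J + 1)) := by
  set S : ℕ → Finset ℕ :=
    fun j => (shiftedPrimes (e j) (e (j + 1)) κ).filter (fun p => p ∣ n) with hS
  have hSn : ∀ j, S j ⊆ n.primeFactors := fun j p hp => by
    simp only [hS, shiftedPrimes, Finset.mem_filter] at hp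
    exact Nat.mem_primeFactors.2 ⟨hp.1.2.1, hp.2, hn⟩
  have hex : ∀ j p, ∃ q, p ∈ S j → q ∈ windowPrimes (e j) (e (j + 1)) ∧ q ∣ p - 1 := by
    intro j p
    by_cases hp : p ∈ S j
    · obtain ⟨q, hq⟩ := (Finset.mem_filter.1 (Finset.mem_filter.1 hp).1).2.2
      exact ⟨q, fun _ => hq⟩
    · exact ⟨0, fun h => absurd h hp⟩
  choose q hq using hex
  have hqw : ∀ j, ∀ p ∈ S j, 8 ^ e j < q j p ∧ q j p ≤ 8 ^ e (j + 1) ∧ (q j p).Prime := by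
    intro j p hp
    have h := (hq j p hp).1
    simp only [windowPrimes, Finset.mem_filter, Finset.mem_Ioc] at h
    exact ⟨h.1.1, h.1.2, h.2⟩
  set W : ℕ → ℕ := fun j => ∏ p ∈ S j, q j p with hW
  have hWdvd : ∀ j, W j ∣ n.totient := fun j =>
    (Finset.prod_dvd_prod_of_dvd _ _ fun p hp => (hq j p hp).2).trans
      (prod_sub_one_dvd_totient (hSn j))
  have h8 : ∀ j, 8 ≤ 8 ^ e j := fun j =>
    Nat.le_self_pow (by have := he.monotone (Nat.zero_le j); omega) 8
  have htwo : 2 ^ K ∣ n.totient := by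
    refine (pow_dvd_pow 2 (hcard 0 hJ)).trans ?_
    rw [← Finset.prod_const]
    refine (Finset.prod_dvd_prod_of_dvd _ _ fun p hp => ?_).trans
      (prod_sub_one_dvd_totient (hSn 0))
    have hpp := Nat.prime_of_mem_primeFactors (hSn 0 hp)
    have hne : p ≠ 2 := by
      rintro rfl
      have h1 := Nat.le_of_dvd (by norm_num) (hq 0 2 hp).2
      have h2 := (hqw 0 2 hp).1
      have := h8 0
      omega
    obtain ⟨k, hk⟩ := hpp.odd_of_ne_two hne
    exact ⟨k, by omega⟩
  have hcopW : ∀ i j, i < j → Nat.Coprime (W i) (W j) := by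
    intro i j hij
    refine Nat.Coprime.prod_left fun p hp => Nat.Coprime.prod_right fun p' hp' => ?_
    obtain ⟨-, h2, h3⟩ := hqw i p hp
    obtain ⟨h4, -, h6⟩ := hqw j p' hp'
    rw [Nat.coprime_primes h3 h6]
    have : 8 ^ e (i + 1) ≤ 8 ^ e j := Nat.pow_le_pow_right (by norm_num) (he.monotone hij)
    omega
  have hcop2 : ∀ j, Nat.Coprime (2 ^ K) (W j) := by
    intro j
    refine Nat.Coprime.pow_left K (Nat.Coprime.prod_right fun p hp => ?_)
    obtain ⟨h1, -, h3⟩ := hqw j p hp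
    rw [Nat.coprime_primes Nat.prime_two h3]
    have := h8 j
    omega
  have hdense : ∀ j ≤ J, HasDyadicDivisors (2 ^ K * ∏ i ∈ Finset.range j, W i)
      (8 ^ e (j + 1)) := by
    intro j hj
    induction j with
    | zero =>
      refine (hasDyadicDivisors_two_pow K).mono (by simp) ?_
      rw [show (8 : ℝ) = 2 ^ 3 by norm_num, ← pow_mul]
      exact pow_le_pow_right₀ (by norm_num) hK
    | succ j ih =>
      have h1 := (ih (by omega)).mul_prod (B := 8 ^ e j) (one_le_pow₀ (by norm_num))
        (by positivity) (S j) (q j) (fun p hp => by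
          obtain ⟨h1, h2, -⟩ := hqw j p hp
          exact ⟨by exact_mod_cast h1.le, by exact_mod_cast h2⟩)
      refine h1.mono (by rw [Finset.prod_range_succ, mul_assoc]) ?_
      rw [← pow_mul, ← pow_add]
      refine pow_le_pow_right₀ (by norm_num) ((hKe j).trans ?_)
      exact Nat.add_le_add_right (Nat.mul_le_mul_left _ (hcard j (by omega))) _
  refine (hdense J le_rfl).mono ?_ le_rfl
  refine Nat.Coprime.mul_dvd_of_dvd_of_dvd (Nat.Coprime.prod_right fun j _ => hcop2 j) htwo ?_
  refine Finset.prod_dvd_of_isRelPrime (fun i _ j _ hij => ?_) fun j _ => hWdvd j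
  rcases lt_or_gt_of_ne hij with h | h
  · exact Nat.coprime_iff_isRelPrime.1 (hcopW i j h)
  · exact (Nat.coprime_iff_isRelPrime.1 (hcopW j i h)).symm

theorem exists_log_le_sum_shiftedPrimes :
    ∃ e₀ m : ℕ, 1 ≤ e₀ ∧ 2 ≤ m ∧ ∀ a κ : ℕ, e₀ ≤ a → 16 * (m * a) ≤ κ →
      1 / 96 * Real.log ((κ + 1) / ((16 * (m * a) : ℕ) + 1)) ≤
        ∑ p ∈ shiftedPrimes a (m * a) κ, (1 / p : ℝ) := by
  obtain ⟨k₀, hk₀⟩ := exists_prime_block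
  obtain ⟨k₁, hk₁⟩ := exists_good_prime_block
  obtain ⟨m, hm⟩ := exists_nat_ge (max 2 (2 * Real.exp (24 * 18432)))
  have hm2 : 2 ≤ m := by exact_mod_cast (le_max_left _ _).trans hm
  have hme : Real.exp (24 * 18432) ≤ m / 2 := by
    rw [le_div_iff₀ two_pos, mul_comm]
    exact (le_max_right _ _).trans hm
  refine ⟨k₀ + k₁ + 1, m, by omega, hm2, fun a κ ha hκ => ?_⟩
  have ham : a ≤ m * a := Nat.le_mul_of_pos_left a (by omega)
  have hQ : (18432 : ℝ) ≤ ∑ q ∈ windowPrimes a (m * a), (1 / q : ℝ) := by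
    rw [windowPrimes]
    refine le_trans ?_ (log_le_sum_inv_of_blocks (c := 1 / 24) (by norm_num) ham
      fun k hk => hk₀ k (by omega))
    have h1 : (m / 2 : ℝ) ≤ ((m * a : ℕ) + 1) / (a + 1) := by
      rw [le_div_iff₀ (by positivity)]
      push_cast
      have h2 : (1 : ℝ) ≤ a := by exact_mod_cast (by omega : 1 ≤ a)
      have h3 : (0 : ℝ) ≤ m := by positivity
      nlinarith
    have h2 := Real.log_le_log (Real.exp_pos _) (hme.trans h1)
    rw [Real.log_exp] at h2
    linarith
  rw [shiftedPrimes]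
  refine log_le_sum_inv_of_blocks (c := 1 / 96) (by norm_num) hκ fun k hk => ?_
  refine hk₁ k (by omega) (windowPrimes a (m * a)) (m * a) (fun q hq => ?_) (by omega) hQ
  simp only [windowPrimes, Finset.mem_filter, Finset.mem_Ioc] at hq
  have h8 : 8 ≤ 8 ^ a := Nat.le_self_pow (by omega) 8
  exact ⟨hq.2, by omega, hq.1.2⟩

theorem exists_card_not_hasDyadicDivisors_le :
    ∃ C c : ℝ, 0 < C ∧ 0 < c ∧ ∀ δ : ℝ, 0 < δ → δ ≤ 1 / 16 → ∃ κ₀ : ℕ, ∀ κ ≥ κ₀,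
      ∀ N : ℕ, 8 ^ κ ≤ N →
      (((Finset.Ioc 0 N).filter
        (fun n => ¬ HasDyadicDivisors n.totient (8 ^ (δ * κ)))).card : ℝ) ≤
        C * (17 * δ) ^ c * N := by
  obtain ⟨e₀, m, he₀, hm, hsum⟩ := exists_log_le_sum_shiftedPrimes
  obtain ⟨N₀, hN₀⟩ := exists_card_few_prime_factors_le
  set K : ℕ := m ^ 2 + 3 * (e₀ * m) with hK
  set c : ℝ := 1 / 576 with hc
  have hm1 : (1 : ℝ) < m := by exact_mod_cast (by omega : 1 < m)
  set r : ℝ := ((m : ℝ)⁻¹) ^ c with hr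
  have hr0 : 0 < r := Real.rpow_pos_of_pos (by positivity) _
  have hr1 : r < 1 := Real.rpow_lt_one (by positivity) (inv_lt_one_of_one_lt₀ hm1) (by norm_num)
  refine ⟨2 ^ K * 42 * (1 - r)⁻¹, c, by have := sub_pos.2 hr1; positivity, by norm_num,
    fun δ hδ hδ16 => ?_⟩
  obtain ⟨κ₀, hκ₀⟩ := exists_nat_ge (e₀ * m / δ : ℝ)
  refine ⟨κ₀ + N₀ + 1, fun κ hκ N hN => ?_⟩
  have hNN₀ : N₀ ≤ N := by
    have := (Nat.lt_pow_self (by norm_num : 1 < 8) : κ < 8 ^ κ)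
    omega
  have hκpos : (0 : ℝ) < κ := by exact_mod_cast (by omega : 0 < κ)
  have he₀' : (1 : ℝ) ≤ e₀ := by exact_mod_cast he₀
  have hδκ : (e₀ * m : ℝ) ≤ δ * κ := by
    rw [div_le_iff₀ hδ] at hκ₀
    have : (κ₀ : ℝ) ≤ κ := by exact_mod_cast (by omega : κ₀ ≤ κ)
    nlinarith
  obtain ⟨J, hJ1, hJ2⟩ := exists_nat_pow_near (x := δ * κ / e₀)
    ((one_le_div (by positivity)).2 (by nlinarith)) hm1
  rw [le_div_iff₀ (by positivity)] at hJ1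
  rw [div_lt_iff₀ (by positivity)] at hJ2
  have hJ : 1 ≤ J := by
    by_contra h
    obtain rfl : J = 0 := by omega
    rw [zero_add, pow_one] at hJ2
    linarith
  set e : ℕ → ℕ := fun j => e₀ * m ^ j with he
  have hestep : ∀ j, e (j + 1) = m * e j := fun j => by simp only [he]; ring
  have hemono : StrictMono e := fun i j hij =>
    Nat.mul_lt_mul_of_pos_left (Nat.pow_lt_pow_right (by omega) hij) (by omega)
  have hκJ : 16 * e J ≤ κ := by
    have h1 : ((16 * e J : ℕ) : ℝ) ≤ κ := by
      simp only [he]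
      push_cast
      nlinarith
    exact_mod_cast h1
  have hsub : (Finset.Ioc 0 N).filter
      (fun n => ¬ HasDyadicDivisors n.totient (8 ^ (δ * κ))) ⊆
      (Finset.range J).biUnion fun j => (Finset.Ioc 0 N).filter fun n =>
        ((shiftedPrimes (e j) (e (j + 1)) κ).filter (fun p => p ∣ n)).card < K := by
    intro n hn
    obtain ⟨hn1, hn2⟩ := Finset.mem_filter.1 hn
    by_contra hcon
    simp only [Finset.mem_biUnion, Finset.mem_range, Finset.mem_filter, not_exists, not_and,
      not_lt] at hcon
    refine hn2 ((hasDyadicDivisors_totient (K := K) hemono (by simpa [he] using he₀)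
      (by simp only [hK, he]; rw [pow_one]; omega) (fun j => ?_)
      (by have := (Finset.mem_Ioc.1 hn1).1; omega) hJ fun j hj => hcon j hj hn1).mono dvd_rfl ?_)
    · have h1 : e (j + 2) = e j * m ^ 2 := by simp only [he]; ring
      rw [h1]
      have h2 : e j * m ^ 2 ≤ e j * K := Nat.mul_le_mul_left _ (by omega)
      omega
    · rw [← Real.rpow_natCast]
      refine Real.rpow_le_rpow_of_exponent_le (by norm_num) ?_
      simp only [he]
      push_cast
      linarith
  have hbad : ∀ j ∈ Finset.range J, (((Finset.Ioc 0 N).filter fun n =>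
      ((shiftedPrimes (e j) (e (j + 1)) κ).filter (fun p => p ∣ n)).card < K).card : ℝ) ≤
      2 ^ K * 42 * N * (17 * δ) ^ c * r ^ (J - 1 - j) := by
    intro j hj
    have hjJ : j + 1 ≤ J := Finset.mem_range.1 hj
    have hej : e (j + 1) ≤ e J := hemono.monotone hjJ
    refine (hN₀ N hNN₀ (shiftedPrimes (e j) (e (j + 1)) κ) K fun p hp => ?_).trans ?_
    · simp only [shiftedPrimes, Finset.mem_filter, Finset.mem_Ioc] at hp
      exact ⟨hp.2.1, hp.1.2.trans hN⟩
    have h1 := hsum (e j) κ (Nat.le_mul_of_pos_right _ (by positivity)) (by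
      rw [← hestep]; omega)
    rw [← hestep] at h1
    set A : ℝ := ((16 * e (j + 1) : ℕ) : ℝ) + 1 with hA
    have hA0 : 0 < A := by positivity
    have hAκ : A / (κ + 1) ≤ 17 * δ * (m : ℝ)⁻¹ ^ (J - 1 - j) := by
      have h2 : (e (j + 1) : ℝ) * m ^ (J - 1 - j) ≤ δ * κ := by
        refine le_trans (le_of_eq ?_) hJ1
        simp only [he]
        push_cast
        rw [mul_assoc, ← pow_add, mul_comm, show j + 1 + (J - 1 - j) = J by omega]
      have h3 : (1 : ℝ) ≤ e (j + 1) := by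
        exact_mod_cast (Nat.one_le_iff_ne_zero.2 (by simp only [he]; positivity))
      have h4 : A ≤ 17 * e (j + 1) := by
        rw [hA]
        push_cast
        linarith
      rw [inv_pow, ← div_eq_mul_inv, div_le_div_iff₀ (by positivity) (by positivity)]
      have h5 : (0 : ℝ) < (m : ℝ) ^ (J - 1 - j) := by positivity
      nlinarith
    have h6 : Real.exp (-(1 / 6) * ∑ p ∈ shiftedPrimes (e j) (e (j + 1)) κ, (1 / p : ℝ)) ≤
        (17 * δ) ^ c * r ^ (J - 1 - j) := by
      calc Real.exp (-(1 / 6) * ∑ p ∈ shiftedPrimes (e j) (e (j + 1)) κ, (1 / p : ℝ))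
          ≤ Real.exp (Real.log (A / (κ + 1)) * c) := by
            refine Real.exp_le_exp.2 ?_
            rw [← inv_div A, Real.log_inv] at h1
            rw [hc]
            linarith
        _ = (A / (κ + 1)) ^ c := (Real.rpow_def_of_pos (by positivity) _).symm
        _ ≤ (17 * δ * (m : ℝ)⁻¹ ^ (J - 1 - j)) ^ c :=
            Real.rpow_le_rpow (by positivity) hAκ (by norm_num)
        _ = _ := by
            rw [Real.mul_rpow (by positivity) (by positivity), hr, ← Real.rpow_natCast,
              ← Real.rpow_natCast, ← Real.rpow_mul (by positivity), ← Real.rpow_mul (by positivity),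
              mul_comm c]
    calc _ ≤ 2 ^ K * (42 * N * ((17 * δ) ^ c * r ^ (J - 1 - j))) := by gcongr
      _ = _ := by ring
  have hgeom : ∑ j ∈ Finset.range J, r ^ (J - 1 - j) ≤ (1 - r)⁻¹ := by
    rw [Finset.sum_range_reflect (fun i => r ^ i) J, ← tsum_geometric_of_lt_one hr0.le hr1]
    exact (summable_geometric_of_lt_one hr0.le hr1).sum_le_tsum _ fun i _ => by positivity
  calc _ ≤ (((Finset.range J).biUnion fun j => (Finset.Ioc 0 N).filter fun n =>
        ((shiftedPrimes (e j) (e (j + 1)) κ).filter (fun p => p ∣ n)).card < K).card : ℝ) := by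
        exact_mod_cast Finset.card_le_card hsub
    _ ≤ ∑ j ∈ Finset.range J, (((Finset.Ioc 0 N).filter fun n =>
        ((shiftedPrimes (e j) (e (j + 1)) κ).filter (fun p => p ∣ n)).card < K).card : ℝ) := by
        exact_mod_cast Finset.card_biUnion_le
    _ ≤ ∑ j ∈ Finset.range J, 2 ^ K * 42 * N * (17 * δ) ^ c * r ^ (J - 1 - j) :=
        Finset.sum_le_sum hbad
    _ = 2 ^ K * 42 * N * (17 * δ) ^ c * ∑ j ∈ Finset.range J, r ^ (J - 1 - j) := by
        rw [Finset.mul_sum]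
    _ ≤ 2 ^ K * 42 * N * (17 * δ) ^ c * (1 - r)⁻¹ :=
        mul_le_mul_of_nonneg_left hgeom (by positivity)
    _ = _ := by ring

end TotientDivisors

theorem stmt_11 (g : ℝ → ℝ) (hmono : Antitone g) (hg0 : Tendsto g atTop (nhds 0)) :
    ∀ ε : ℝ, 0 < ε → ∀ᶠ x : ℝ in atTop, ∀ y : ℝ, 1 ≤ y → y ≤ x ^ g x →
      (1 - ε) * x ≤ (((Finset.Icc 1 ⌊x⌋₊).filter
        (fun n => ∃ d : ℕ, d ∣ Nat.totient n ∧ y < (d : ℝ) ∧ (d : ℝ) ≤ 2 * y)).card : ℝ) := by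
  intro ε hε
  obtain ⟨C, c, hC, hc, hbound⟩ := TotientDivisors.exists_card_not_hasDyadicDivisors_le
  set β : ℝ := (ε / (2 * C)) ^ c⁻¹ with hβ
  have hβ0 : 0 < β := Real.rpow_pos_of_pos (by positivity) _
  set δ : ℝ := min (1 / 16) (β / 17) with hδ
  have hδ0 : 0 < δ := by positivity
  have hδC : C * (17 * δ) ^ c ≤ ε / 2 := by
    have h1 : 17 * δ ≤ β := by
      have := min_le_right (1 / 16) (β / 17)
      linarith
    have h2 : (17 * δ) ^ c ≤ ε / (2 * C) := by
      refine (Real.rpow_le_rpow (by positivity) h1 hc.le).trans (le_of_eq ?_)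
      rw [hβ, Real.rpow_inv_rpow (by positivity) hc.ne']
    calc C * (17 * δ) ^ c ≤ C * (ε / (2 * C)) := by gcongr
      _ = ε / 2 := by field_simp
  obtain ⟨κ₀, hκ₀⟩ := hbound δ hδ0 (min_le_left _ _)
  filter_upwards [eventually_ge_atTop ((8 : ℝ) ^ (κ₀ + 2)), eventually_ge_atTop (2 / ε),
    hg0.eventually_lt_const (show (0 : ℝ) < δ / 2 by positivity)] with x hx8 hxε hgx y hy1 hyx
  have hx1 : 1 ≤ x := (one_le_pow₀ (by norm_num)).trans hx8
  obtain ⟨κ, hκ1, hκ2⟩ := exists_nat_pow_near hx1 (show (1 : ℝ) < 8 by norm_num)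
  have hκ : κ₀ + 2 < κ + 1 :=
    (pow_lt_pow_iff_right₀ (show (1 : ℝ) < 8 by norm_num)).1 (hx8.trans_lt hκ2)
  have hN : 8 ^ κ ≤ ⌊x⌋₊ := Nat.le_floor (by exact_mod_cast hκ1)
  have hcard := hκ₀ κ (by omega) ⌊x⌋₊ hN
  have hy8 : y < 8 ^ (δ * κ) := by
    have hκr : (2 : ℝ) ≤ κ := by exact_mod_cast (by omega : 2 ≤ κ)
    calc y ≤ x ^ g x := hyx
      _ ≤ x ^ (δ / 2) := Real.rpow_le_rpow_of_exponent_le hx1 hgx.le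
      _ ≤ ((8 : ℝ) ^ (κ + 1)) ^ (δ / 2) :=
          Real.rpow_le_rpow (by positivity) hκ2.le (by positivity)
      _ = 8 ^ ((κ + 1) * (δ / 2)) := by
          rw [← Real.rpow_natCast, ← Real.rpow_mul (by norm_num)]
          push_cast
          rfl
      _ < 8 ^ (δ * κ) := Real.rpow_lt_rpow_of_exponent_lt (by norm_num) (by nlinarith)
  have hsplit := Finset.card_filter_add_card_filter_not (s := Finset.Ioc 0 ⌊x⌋₊)
    (fun n => TotientDivisors.HasDyadicDivisors n.totient (8 ^ (δ * κ)))
  have hsplit' : (((Finset.Ioc 0 ⌊x⌋₊).filter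
      (fun n => TotientDivisors.HasDyadicDivisors n.totient (8 ^ (δ * κ)))).card : ℝ) +
      (((Finset.Ioc 0 ⌊x⌋₊).filter
        (fun n => ¬ TotientDivisors.HasDyadicDivisors n.totient (8 ^ (δ * κ)))).card : ℝ) = ⌊x⌋₊ := by
    rw [Nat.card_Ioc, Nat.sub_zero] at hsplit
    exact_mod_cast hsplit
  have hsub : (((Finset.Ioc 0 ⌊x⌋₊).filter
      (fun n => TotientDivisors.HasDyadicDivisors n.totient (8 ^ (δ * κ)))).card : ℝ) ≤
      (((Finset.Icc 1 ⌊x⌋₊).filter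
        (fun n => ∃ d : ℕ, d ∣ Nat.totient n ∧ y < (d : ℝ) ∧ (d : ℝ) ≤ 2 * y)).card : ℝ) := by
    refine Nat.cast_le.2 (Finset.card_le_card fun n hn => ?_)
    obtain ⟨h1, h2⟩ := Finset.mem_filter.1 hn
    exact Finset.mem_filter.2 ⟨h1, h2 y hy1 hy8⟩
  have hfloor := Nat.lt_floor_add_one x
  have hfloor' := Nat.floor_le (zero_le_one.trans hx1)
  rw [div_le_iff₀ hε] at hxε
  have hbad : C * (17 * δ) ^ c * ⌊x⌋₊ ≤ ε / 2 * x := by gcongr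
  linarith
end
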